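/- Let D be a bounded convex domain in ℂⁿ on which the Kobayashi and Carathéodory infinitesimal metrics coincide (Lempert's theorem), and which carries a complete Kähler metric g with all sectional curvatures bounded between two negative constants. Then the Kobayashi metric K_D and the Finsler metric v ↦ √(g(v,v)) are bi-Lipschitz: there exists A ≥ 1 with A^{-1} √(g(v,v)) ≤ K_D(p,v) ≤ A √(g(v,v)) for all (p,v). -/

import Mathlib

open Set Metric

/-- Wirtinger derivative `∂f/∂z_k` of `f : ℂⁿ → ℂ` at `z`. -/
noncomputable def wDeriv {n : ℕ} (f : (Fin n → ℂ) → ℂ) (z : Fin n → ℂ) (k : Fin n) : ℂ :=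
  (1 / 2) * (fderiv ℝ f z (Pi.single k 1) - Complex.I * fderiv ℝ f z (Pi.single k Complex.I))

/-- Conjugate Wirtinger derivative `∂f/∂z̄_k` of `f : ℂⁿ → ℂ` at `z`. -/
noncomputable def wbDeriv {n : ℕ} (f : (Fin n → ℂ) → ℂ) (z : Fin n → ℂ) (k : Fin n) : ℂ :=
  (1 / 2) * (fderiv ℝ f z (Pi.single k 1) + Complex.I * fderiv ℝ f z (Pi.single k Complex.I))

/-- The Hermitian form `Σ g_{i j̄} v_i \bar{w}_j` of a Hermitian metric tensor `g`. -/
noncomputable def hermForm {n : ℕ} (g : (Fin n → ℂ) → Matrix (Fin n) (Fin n) ℂ)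
    (z v w : Fin n → ℂ) : ℂ :=
  ∑ i, ∑ j, g z i j * v i * (starRingEnd ℂ) (w j)

/-- `g` is a smooth Hermitian metric on the open set `Ω ⊆ ℂⁿ`. -/
structure IsHermitianMetricOn {n : ℕ} (Ω : Set (Fin n → ℂ))
    (g : (Fin n → ℂ) → Matrix (Fin n) (Fin n) ℂ) : Prop where
  smooth : ∀ i j, ContDiffOn ℝ (⊤ : ℕ∞) (fun z => g z i j) Ω
  hermitian : ∀ z ∈ Ω, (g z).IsHermitian
  posdef : ∀ z ∈ Ω, ∀ v : Fin n → ℂ, v ≠ 0 → 0 < (hermForm g z v v).re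

/-- `g` is a Kähler metric on `Ω`: a Hermitian metric whose coefficients satisfy the Kähler
symmetry `∂_k g_{i j̄} = ∂_i g_{k j̄}`. -/
structure IsKahlerMetricOn {n : ℕ} (Ω : Set (Fin n → ℂ))
    (g : (Fin n → ℂ) → Matrix (Fin n) (Fin n) ℂ) extends IsHermitianMetricOn Ω g : Prop where
  kahler : ∀ z ∈ Ω, ∀ i j k, wDeriv (fun w => g w i j) z k = wDeriv (fun w => g w k j) z i

/-- The curvature tensor `R_{i j̄ k l̄}` of a Hermitian metric `g`:
`R_{i j̄ k l̄} = -∂_k ∂_{l̄} g_{i j̄} + Σ_{p,q} g^{q̄ p} (∂_k g_{i q̄})(∂_{l̄} g_{p j̄})`. -/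
noncomputable def curvTensor {n : ℕ} (g : (Fin n → ℂ) → Matrix (Fin n) (Fin n) ℂ)
    (z : Fin n → ℂ) (i j k l : Fin n) : ℂ :=
  - wDeriv (fun w => wbDeriv (fun u => g u i j) w l) z k
    + ∑ p, ∑ q, (g z)⁻¹ q p * wDeriv (fun w => g w i q) z k * wbDeriv (fun w => g w p j) z l

/-- The holomorphic sectional curvature of `g` at `z` in the direction `v`:
`H(v) = R(v, v̄, v, v̄) / g(v,v)²`. -/
noncomputable def holSecCurv {n : ℕ} (g : (Fin n → ℂ) → Matrix (Fin n) (Fin n) ℂ)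
    (z v : Fin n → ℂ) : ℝ :=
  (∑ i, ∑ j, ∑ k, ∑ l, curvTensor g z i j k l * v i * (starRingEnd ℂ) (v j) * v k *
    (starRingEnd ℂ) (v l)).re / ((hermForm g z v v).re) ^ 2

/-- The Ricci curvature of a Kähler metric: `Ric_{i j̄} = -∂_i ∂_{j̄} log det g`. -/
noncomputable def ricci {n : ℕ} (g : (Fin n → ℂ) → Matrix (Fin n) (Fin n) ℂ)
    (z : Fin n → ℂ) (i j : Fin n) : ℂ :=
  - wDeriv (fun w => wbDeriv (fun u => Complex.log ((g u).det)) w j) z i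

/-- The Riemannian distance on `(Ω, g)`: infimum of `g`-lengths of `C¹` paths in `Ω`. -/
noncomputable def riemDistK {n : ℕ} (Ω : Set (Fin n → ℂ))
    (g : (Fin n → ℂ) → Matrix (Fin n) (Fin n) ℂ) (p q : Fin n → ℂ) : ℝ :=
  sInf {L : ℝ | ∃ γ : ℝ → (Fin n → ℂ), ContDiffOn ℝ 1 γ (Icc 0 1) ∧
    MapsTo γ (Icc 0 1) Ω ∧ γ 0 = p ∧ γ 1 = q ∧
    L = ∫ t in (0:ℝ)..1, Real.sqrt ((hermForm g (γ t) (derivWithin γ (Icc 0 1) t)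
      (derivWithin γ (Icc 0 1) t)).re)}

/-- `(Ω, g)` is complete: every `riemDistK`-Cauchy sequence converges in `Ω`. -/
def IsCompleteMetricOn {n : ℕ} (Ω : Set (Fin n → ℂ))
    (g : (Fin n → ℂ) → Matrix (Fin n) (Fin n) ℂ) : Prop :=
  ∀ x : ℕ → (Fin n → ℂ), (∀ k, x k ∈ Ω) →
    (∀ ε > (0:ℝ), ∃ N : ℕ, ∀ k ≥ N, ∀ m ≥ N, riemDistK Ω g (x k) (x m) < ε) →
    ∃ y ∈ Ω, Filter.Tendsto (fun k => riemDistK Ω g (x k) y) Filter.atTop (nhds 0)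

/-- The Kobayashi infinitesimal pseudometric of a domain `D`. -/
noncomputable def kobMetric {E : Type*} [NormedAddCommGroup E] [NormedSpace ℂ E]
    (D : Set E) (p v : E) : ℝ :=
  sInf {α : ℝ | 0 < α ∧ ∃ f : ℂ → E, DifferentiableOn ℂ f (ball (0:ℂ) 1) ∧
    MapsTo f (ball (0:ℂ) 1) D ∧ f 0 = p ∧ fderiv ℂ f 0 1 = α⁻¹ • v}

/-- The Carathéodory infinitesimal metric of a domain `D`. -/
noncomputable def caraMetric {E : Type*} [NormedAddCommGroup E] [NormedSpace ℂ E]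
    (D : Set E) (p v : E) : ℝ :=
  sSup {c : ℝ | ∃ f : E → ℂ, DifferentiableOn ℂ f D ∧ MapsTo f D (ball (0:ℂ) 1) ∧
    f p = 0 ∧ c = ‖fderiv ℂ f p v‖}

/-- The real coordinate vector fields `∂/∂x_i`, `∂/∂y_i` on `ℂⁿ`. -/
noncomputable def bvec {n : ℕ} : Fin n ⊕ Fin n → (Fin n → ℂ)
  | .inl i => Pi.single i 1
  | .inr i => Pi.single i Complex.I

/-- The underlying Riemannian metric of the Hermitian metric `g`, in the real coordinates
`x_1, …, x_n, y_1, …, y_n`. -/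
noncomputable def realMetric {n : ℕ} (g : (Fin n → ℂ) → Matrix (Fin n) (Fin n) ℂ)
    (z : Fin n → ℂ) : Matrix (Fin n ⊕ Fin n) (Fin n ⊕ Fin n) ℝ :=
  fun a b => (hermForm g z (bvec a) (bvec b)).re

/-- Real partial derivative in the real coordinate direction `a`. -/
noncomputable def rpd {n : ℕ} (F : (Fin n → ℂ) → ℝ) (z : Fin n → ℂ) (a : Fin n ⊕ Fin n) : ℝ :=
  fderiv ℝ F z (bvec a)

/-- Christoffel symbols `Γ^c_{ab}` of the underlying Riemannian metric. -/
noncomputable def christoffelK {n : ℕ} (g : (Fin n → ℂ) → Matrix (Fin n) (Fin n) ℂ)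
    (z : Fin n → ℂ) (c a b : Fin n ⊕ Fin n) : ℝ :=
  (1 / 2) * ∑ d, (realMetric g z)⁻¹ c d *
    (rpd (fun w => realMetric g w d b) z a + rpd (fun w => realMetric g w a d) z b
      - rpd (fun w => realMetric g w a b) z d)

/-- Riemann curvature `R^d_{cab}` of the underlying Riemannian metric. -/
noncomputable def riemCurvK {n : ℕ} (g : (Fin n → ℂ) → Matrix (Fin n) (Fin n) ℂ)
    (z : Fin n → ℂ) (d c a b : Fin n ⊕ Fin n) : ℝ :=
  rpd (fun w => christoffelK g w d b c) z a - rpd (fun w => christoffelK g w d a c) z b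
    + ∑ e, (christoffelK g z e b c * christoffelK g z d a e
        - christoffelK g z e a c * christoffelK g z d b e)

/-- Real components of a tangent vector `v ∈ ℂⁿ` in the coordinates `x_i, y_i`. -/
noncomputable def realComp {n : ℕ} (v : Fin n → ℂ) : Fin n ⊕ Fin n → ℝ
  | .inl i => (v i).re
  | .inr i => (v i).im

/-- The (real) sectional curvature of the plane spanned by the tangent vectors `u, v`. -/
noncomputable def secCurvK {n : ℕ} (g : (Fin n → ℂ) → Matrix (Fin n) (Fin n) ℂ)
    (z : Fin n → ℂ) (u v : Fin n → ℂ) : ℝ :=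
  (∑ a, ∑ b, ∑ c, ∑ e, realComp u a * realComp v b * realComp v c * realComp u e *
      ∑ d, realMetric g z e d * riemCurvK g z d c a b) /
    ((hermForm g z u u).re * (hermForm g z v v).re - ((hermForm g z u v).re) ^ 2)

section ownwork
open Filter Topology
open scoped ContDiff
set_option maxSynthPendingDepth 4
set_option linter.unusedSectionVars false

section abstractK
variable {E : Type*} [NormedAddCommGroup E] [NormedSpace ℂ E] [NormedSpace ℝ E]
  [IsScalarTower ℝ ℂ E]

/-- squared norm -/
noncomputable def Nq (G : E → E →L[ℝ] E →L[ℝ] ℂ) (z v : E) : ℝ := (G z v v).re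

/-- (1,0) derivative of the metric -/
noncomputable def Pq (G : E → E →L[ℝ] E →L[ℝ] ℂ) (z a v w : E) : ℂ :=
  (1 / 2) * (fderiv ℝ G z a v w - Complex.I * fderiv ℝ G z (Complex.I • a) v w)

/-- (0,1) derivative of the metric -/
noncomputable def Qq (G : E → E →L[ℝ] E →L[ℝ] ℂ) (z a v w : E) : ℂ :=
  (1 / 2) * (fderiv ℝ G z a v w + Complex.I * fderiv ℝ G z (Complex.I • a) v w)

/-- bisectional curvature -/
noncomputable def Rc (G : E → E →L[ℝ] E →L[ℝ] ℂ) (Γ : E → E →L[ℝ] E →L[ℝ] E) (z u a : E) : ℝ :=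
  (Qq G z a (Γ z a u) u - (1 / 4) * (fderiv ℝ (fderiv ℝ G) z a a u u +
    fderiv ℝ (fderiv ℝ G) z (Complex.I • a) (Complex.I • a) u u)).re

/-- Hermitian metric data -/
structure HPre (D : Set E) (G : E → E →L[ℝ] E →L[ℝ] ℂ) : Prop where
  isOpen : IsOpen D
  smooth : ContDiffOn ℝ ∞ G D
  lin : ∀ z v w, G z (Complex.I • v) w = Complex.I * G z v w
  herm : ∀ z ∈ D, ∀ v w, (starRingEnd ℂ) (G z v w) = G z w v
  pos : ∀ z ∈ D, ∀ v, v ≠ 0 → 0 < (G z v v).re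

/-- Kähler metric data without curvature bounds -/
structure KPre (D : Set E) (G : E → E →L[ℝ] E →L[ℝ] ℂ) (Γ : E → E →L[ℝ] E →L[ℝ] E) : Prop
    extends HPre D G where
  kah : ∀ z ∈ D, ∀ a v w, Pq G z a v w = Pq G z v a w
  gam : ∀ z ∈ D, ∀ a v w, G z (Γ z a v) w = Pq G z a v w
  gamd : DifferentiableOn ℝ Γ D

/-- Kähler metric data -/
structure KData (D : Set E) (G : E → E →L[ℝ] E →L[ℝ] ℂ) (Γ : E → E →L[ℝ] E →L[ℝ] E)
    (c₁ c₂ : ℝ) : Prop extends KPre D G Γ where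
  low : ∀ z ∈ D, ∀ u a, - c₂ * (Nq G z u * Nq G z a) ≤ Rc G Γ z u a
  upp : ∀ z ∈ D, ∀ u, Rc G Γ z u u ≤ - c₁ * (Nq G z u) ^ 2

namespace HPre
variable {D : Set E} {G : E → E →L[ℝ] E →L[ℝ] ℂ}

theorem diffAt (h : HPre D G) {z : E} (hz : z ∈ D) : DifferentiableAt ℝ G z :=
  ((h.smooth.contDiffAt (h.isOpen.mem_nhds hz)).differentiableAt (by simp))

theorem contDiffAt_fderiv (h : HPre D G) {z : E} (hz : z ∈ D) :
    ContDiffAt ℝ ∞ (fderiv ℝ G) z :=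
  (h.smooth.contDiffAt (h.isOpen.mem_nhds hz)).fderiv_right (by simp)

theorem diffAt2 (h : HPre D G) {z : E} (hz : z ∈ D) : DifferentiableAt ℝ (fderiv ℝ G) z :=
  (h.contDiffAt_fderiv hz).differentiableAt (by simp)

theorem symm2 (h : HPre D G) {z : E} (hz : z ∈ D) (a b : E) :
    fderiv ℝ (fderiv ℝ G) z a b = fderiv ℝ (fderiv ℝ G) z b a :=
  ((h.smooth.contDiffAt (h.isOpen.mem_nhds hz)).isSymmSndFDerivAt (by
    rw [minSmoothness_of_isRCLikeNormedField]; exact WithTop.coe_le_coe.2 le_top)).eq a b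

theorem hasF (h : HPre D G) {z : E} (hz : z ∈ D) (v w : E) :
    HasFDerivAt (fun y => G y v w)
      ((((ContinuousLinearMap.apply ℝ ℂ w).comp (ContinuousLinearMap.apply ℝ (E →L[ℝ] ℂ) v))).comp
        (fderiv ℝ G z)) z := by
  exact (((ContinuousLinearMap.apply ℝ ℂ w).comp
    (ContinuousLinearMap.apply ℝ (E →L[ℝ] ℂ) v)).hasFDerivAt).comp z (h.diffAt hz).hasFDerivAt

theorem hasF2 (h : HPre D G) {z : E} (hz : z ∈ D) (a v w : E) :
    HasFDerivAt (fun y => fderiv ℝ G y a v w)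
      (((((ContinuousLinearMap.apply ℝ ℂ w).comp (ContinuousLinearMap.apply ℝ (E →L[ℝ] ℂ) v))).comp
        (ContinuousLinearMap.apply ℝ (E →L[ℝ] E →L[ℝ] ℂ) a)).comp
        (fderiv ℝ (fderiv ℝ G) z)) z := by
  exact ((((ContinuousLinearMap.apply ℝ ℂ w).comp
    (ContinuousLinearMap.apply ℝ (E →L[ℝ] ℂ) v)).comp
      (ContinuousLinearMap.apply ℝ (E →L[ℝ] E →L[ℝ] ℂ) a)).hasFDerivAt).comp z
      (h.diffAt2 hz).hasFDerivAt

theorem linR (h : HPre D G) {z : E} (hz : z ∈ D) (v w : E) :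
    G z v (Complex.I • w) = - Complex.I * G z v w := by
  rw [← h.herm z hz, h.lin, map_mul, h.herm z hz, Complex.conj_I]

theorem dlin (h : HPre D G) {z : E} (hz : z ∈ D) (a v w : E) :
    fderiv ℝ G z a (Complex.I • v) w = Complex.I * fderiv ℝ G z a v w := by
  have h1 := h.hasF hz (Complex.I • v) w
  have h2 := (h.hasF hz v w).const_mul Complex.I
  have h3 : (fun y => G y (Complex.I • v) w) = fun y => Complex.I * G y v w := by
    funext y; exact h.lin y v w
  rw [h3] at h1
  have := congrArg (fun L => L a) (h1.unique h2)
  simpa using this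

theorem dherm (h : HPre D G) {z : E} (hz : z ∈ D) (a v w : E) :
    (starRingEnd ℂ) (fderiv ℝ G z a v w) = fderiv ℝ G z a w v := by
  have h1 := h.hasF hz w v
  have h2 := (Complex.conjCLE.toContinuousLinearMap.hasFDerivAt).comp z (h.hasF hz v w)
  have h3 : (fun y => G y w v) =ᶠ[𝓝 z] (Complex.conjCLE.toContinuousLinearMap ∘ fun y => G y v w) := by
    filter_upwards [h.isOpen.mem_nhds hz] with y hy
    exact (h.herm y hy v w).symm
  have := congrArg (fun L => L a) ((h1.congr_of_eventuallyEq h3.symm).unique h2)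
  simpa using this.symm

theorem dlinR (h : HPre D G) {z : E} (hz : z ∈ D) (a v w : E) :
    fderiv ℝ G z a v (Complex.I • w) = - Complex.I * fderiv ℝ G z a v w := by
  rw [← h.dherm hz, h.dlin hz, map_mul, h.dherm hz, Complex.conj_I]

theorem d2lin (h : HPre D G) {z : E} (hz : z ∈ D) (a b v w : E) :
    fderiv ℝ (fderiv ℝ G) z a b (Complex.I • v) w =
      Complex.I * fderiv ℝ (fderiv ℝ G) z a b v w := by
  have h1 := h.hasF2 hz b (Complex.I • v) w
  have h2 := (h.hasF2 hz b v w).const_mul Complex.I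
  have h3 : (fun y => fderiv ℝ G y b (Complex.I • v) w) =ᶠ[𝓝 z]
      fun y => Complex.I * fderiv ℝ G y b v w := by
    filter_upwards [h.isOpen.mem_nhds hz] with y hy
    exact h.dlin hy b v w
  have := congrArg (fun L => L a) ((h1.congr_of_eventuallyEq h3.symm).unique h2)
  simpa using this

theorem nondeg (h : HPre D G) {z : E} (hz : z ∈ D) {x y : E}
    (hxy : ∀ w, G z x w = G z y w) : x = y := by
  by_contra hne
  have := h.pos z hz (x - y) (sub_ne_zero.2 hne)
  have h2 : G z (x - y) (x - y) = 0 := by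
    have h3 : G z (x - y) = G z x - G z y := map_sub _ _ _
    rw [h3, sub_apply, hxy, sub_self]
  rw [h2] at this
  simp at this

end HPre

namespace KPre
variable {D : Set E} {G : E → E →L[ℝ] E →L[ℝ] ℂ} {Γ : E → E →L[ℝ] E →L[ℝ] E}

theorem Q_eq (h : KPre D G Γ) {z : E} (hz : z ∈ D) (a v w : E) :
    Qq G z a v w = (starRingEnd ℂ) (Pq G z a w v) := by
  unfold Qq Pq
  rw [map_mul, map_sub, map_mul, h.dherm hz, h.dherm hz, Complex.conj_I]
  have : (starRingEnd ℂ) (1 / 2 : ℂ) = 1 / 2 := by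
    rw [map_div₀, map_one, map_ofNat]
  rw [this]; ring

theorem isq (a : E) : Complex.I • Complex.I • a = -a := by
  rw [smul_smul, Complex.I_mul_I]; simp

theorem gam_symm (h : KPre D G Γ) {z : E} (hz : z ∈ D) (a b : E) : Γ z a b = Γ z b a :=
  h.nondeg hz fun w => by rw [h.gam z hz, h.gam z hz, h.kah z hz]

theorem gam_I (h : KPre D G Γ) {z : E} (hz : z ∈ D) (a b : E) :
    Γ z a (Complex.I • b) = Complex.I • Γ z a b :=
  h.nondeg hz fun w => by
    rw [h.gam z hz, h.lin, h.gam z hz]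
    unfold Pq
    rw [h.dlin hz, h.dlin hz]; ring

theorem gam_I' (h : KPre D G Γ) {z : E} (hz : z ∈ D) (a b : E) :
    Γ z (Complex.I • a) b = Complex.I • Γ z a b := by
  rw [h.gam_symm hz, h.gam_I hz, h.gam_symm hz]

theorem Q_I (G : E → E →L[ℝ] E →L[ℝ] ℂ) (z a v w : E) :
    Qq G z (Complex.I • a) v w = - Complex.I * Qq G z a v w := by
  unfold Qq
  rw [isq, map_neg, neg_apply, neg_apply]
  linear_combination (1/2) * (fderiv ℝ G z (Complex.I • a) v w) * (Complex.I_mul_I)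

theorem Q_lin (h : KPre D G Γ) {z : E} (hz : z ∈ D) (a v w : E) :
    Qq G z a (Complex.I • v) w = Complex.I * Qq G z a v w := by
  unfold Qq
  rw [h.dlin hz, h.dlin hz]; ring

/-- the curvature operator -/
noncomputable def Rv (Γ : E → E →L[ℝ] E →L[ℝ] E) (z a b c : E) : E :=
  fderiv ℝ Γ z a b c - fderiv ℝ Γ z b a c + (Γ z a (Γ z b c) - Γ z b (Γ z a c))

theorem dgam (h : KPre D G Γ) {z : E} (hz : z ∈ D) (a b c w : E) :
    fderiv ℝ G z a (Γ z b c) w + G z (fderiv ℝ Γ z a b c) w =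
      (1 / 2) * (fderiv ℝ (fderiv ℝ G) z a b c w -
        Complex.I * fderiv ℝ (fderiv ℝ G) z a (Complex.I • b) c w) := by
  have hΓ : HasFDerivAt Γ (fderiv ℝ Γ z) z :=
    (h.gamd.differentiableAt (h.isOpen.mem_nhds hz)).hasFDerivAt
  have h0 : HasFDerivAt (fun y => Γ y b c)
      ((((ContinuousLinearMap.apply ℝ E c).comp (ContinuousLinearMap.apply ℝ (E →L[ℝ] E) b))).comp
        (fderiv ℝ Γ z)) z :=
    (((ContinuousLinearMap.apply ℝ E c).comp
      (ContinuousLinearMap.apply ℝ (E →L[ℝ] E) b)).hasFDerivAt).comp z hΓ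
  have h1 := ((h.diffAt hz).hasFDerivAt.clm_apply h0).clm_apply (hasFDerivAt_const w z)
  have h2 := ((h.hasF2 hz b c w).sub ((h.hasF2 hz (Complex.I • b) c w).const_mul
    Complex.I)).const_mul (1/2 : ℂ)
  have h3 : (fun y => G y (Γ y b c) w) =ᶠ[𝓝 z]
      fun y => (1/2 : ℂ) * (fderiv ℝ G y b c w - Complex.I * fderiv ℝ G y (Complex.I • b) c w) := by
    filter_upwards [h.isOpen.mem_nhds hz] with y hy
    exact h.gam y hy b c w
  have := congrArg (fun L => L a) ((h1.congr_of_eventuallyEq h3.symm).unique h2)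
  simpa [add_comm] using this

theorem dkah (h : KPre D G Γ) {z : E} (hz : z ∈ D) (a b c w : E) :
    (fderiv ℝ (fderiv ℝ G) z a b c w -
        Complex.I * fderiv ℝ (fderiv ℝ G) z a (Complex.I • b) c w) =
    (fderiv ℝ (fderiv ℝ G) z a c b w -
        Complex.I * fderiv ℝ (fderiv ℝ G) z a (Complex.I • c) b w) := by
  have e1 := h.dgam hz a b c w
  have e2 := h.dgam hz a c b w
  have hs : fderiv ℝ Γ z a b c = fderiv ℝ Γ z a c b := by
    have hΓ : HasFDerivAt Γ (fderiv ℝ Γ z) z :=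
      (h.gamd.differentiableAt (h.isOpen.mem_nhds hz)).hasFDerivAt
    have h0 : ∀ b c, HasFDerivAt (fun y => Γ y b c)
      ((((ContinuousLinearMap.apply ℝ E c).comp (ContinuousLinearMap.apply ℝ (E →L[ℝ] E) b))).comp
        (fderiv ℝ Γ z)) z := fun b c =>
      (((ContinuousLinearMap.apply ℝ E c).comp
        (ContinuousLinearMap.apply ℝ (E →L[ℝ] E) b)).hasFDerivAt).comp z hΓ
    have h3 : (fun y => Γ y b c) =ᶠ[𝓝 z] fun y => Γ y c b := by
      filter_upwards [h.isOpen.mem_nhds hz] with y hy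
      exact h.gam_symm hy b c
    have := congrArg (fun L => L a) (((h0 b c).congr_of_eventuallyEq h3.symm).unique (h0 c b))
    simpa using this
  rw [h.gam_symm hz b c, hs] at e1
  linear_combination (-2) * e1 + 2 * e2

theorem G_Rv (h : KPre D G Γ) {z : E} (hz : z ∈ D) (a b c w : E) :
    G z (Rv Γ z a b c) w =
      - (Complex.I / 2) * (fderiv ℝ (fderiv ℝ G) z a (Complex.I • b) c w
        - fderiv ℝ (fderiv ℝ G) z b (Complex.I • a) c w)
      - Qq G z a (Γ z b c) w + Qq G z b (Γ z a c) w := by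
  unfold Rv
  have e1 := h.dgam hz a b c w
  have e2 := h.dgam hz b a c w
  have e3 := h.gam z hz a (Γ z b c) w
  have e4 := h.gam z hz b (Γ z a c) w
  have e5 := congrArg (fun L => L c w) (h.symm2 hz a b)
  simp only [map_add, map_sub, add_apply, sub_apply]
  rw [e3, e4]
  unfold Pq Qq
  linear_combination e1 - e2 + (1/2) * e5

theorem two_Rc (h : KPre D G Γ) {z : E} (hz : z ∈ D) (u v : E) :
    (G z (Rv Γ z u v v) u).re + (G z (Rv Γ z u (Complex.I • v) (Complex.I • v)) u).re
      = 2 * Rc G Γ z u v := by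
  rw [← Complex.add_re, h.G_Rv hz, h.G_Rv hz]
  unfold Rc
  have : ∀ x : ℂ, 2 * x.re = (2 * x).re := by intro x; simp
  rw [this]
  congr 1
  rw [isq, h.gam_I hz, h.gam_I' hz, h.gam_I hz, isq]
  rw [Q_I]
  simp only [map_neg, neg_apply]
  have q1 : Qq G z u (-(Γ z v) v) u = - Qq G z u (Γ z v v) u := by
    unfold Qq; simp only [map_neg, neg_apply]; ring
  rw [q1, h.Q_lin hz, h.d2lin hz, h.d2lin hz]
  have k1 := h.dkah hz v u v u
  have k2 := h.dkah hz (Complex.I • v) u v u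
  rw [h.symm2 hz u v, h.symm2 hz u (Complex.I • v), h.gam_symm hz u v]
  have k3 := congrArg (fun L => L u u) (h.symm2 hz v (Complex.I • v))
  linear_combination (-1/2) * k1 + (-Complex.I/2) * k2 + (Complex.I/2) * k3
    + (1/2 * fderiv ℝ (fderiv ℝ G) z v u v u
       + 1/2 * fderiv ℝ (fderiv ℝ G) z (Complex.I • v) (Complex.I • v) u u - Qq G z v (Γ z v u) u) * Complex.I_mul_I

end KPre
end abstractK

section hasD2
variable {F : Type*} [NormedAddCommGroup F] [NormedSpace ℝ F]
variable {FF : Type*} [NormedAddCommGroup FF] [NormedSpace ℝ FF]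

/-- first and second derivative at zero -/
def HasD2 (φ : ℝ → F) (a b : F) : Prop :=
  ∃ φ1 : ℝ → F, (∀ᶠ s in 𝓝 (0:ℝ), HasDerivAt φ (φ1 s) s) ∧ φ1 0 = a ∧ HasDerivAt φ1 b 0

theorem HasD2.hasDerivAt {φ : ℝ → F} {a b : F} (h : HasD2 φ a b) : HasDerivAt φ a 0 := by
  obtain ⟨φ1, h1, rfl, h3⟩ := h
  exact h1.self_of_nhds

theorem HasD2.add {φ ψ : ℝ → F} {a b a' b' : F} (h : HasD2 φ a b) (h' : HasD2 ψ a' b') :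
    HasD2 (fun s => φ s + ψ s) (a + a') (b + b') := by
  obtain ⟨φ1, h1, rfl, h3⟩ := h
  obtain ⟨ψ1, g1, rfl, g3⟩ := h'
  refine ⟨fun s => φ1 s + ψ1 s, ?_, rfl, h3.add g3⟩
  filter_upwards [h1, g1] with s hs gs
  exact hs.add gs

theorem HasD2.congr {φ ψ : ℝ → F} {a b : F} (h : HasD2 φ a b) (he : ψ =ᶠ[𝓝 0] φ) :
    HasD2 ψ a b := by
  obtain ⟨φ1, h1, rfl, h3⟩ := h
  refine ⟨φ1, ?_, rfl, h3⟩
  filter_upwards [h1, he.eventually_nhds] with s hs gs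
  exact hs.congr_of_eventuallyEq gs

theorem HasD2.clm {φ : ℝ → F} {a b : F} (L : F →L[ℝ] FF) (h : HasD2 φ a b) :
    HasD2 (fun s => L (φ s)) (L a) (L b) := by
  obtain ⟨φ1, h1, rfl, h3⟩ := h
  refine ⟨fun s => L (φ1 s), ?_, rfl, L.hasFDerivAt.comp_hasDerivAt 0 h3⟩
  filter_upwards [h1] with s hs
  exact L.hasFDerivAt.comp_hasDerivAt s hs

theorem HasD2.const_mul {φ : ℝ → ℝ} {a b : ℝ} (k : ℝ) (h : HasD2 φ a b) :
    HasD2 (fun s => k * φ s) (k * a) (k * b) := by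
  obtain ⟨φ1, h1, rfl, h3⟩ := h
  refine ⟨fun s => k * φ1 s, ?_, rfl, h3.const_mul k⟩
  filter_upwards [h1] with s hs
  exact hs.const_mul k

theorem HasD2.log {φ : ℝ → ℝ} {a b : ℝ} (h : HasD2 φ a b) (h0 : 0 < φ 0) :
    HasD2 (fun s => Real.log (φ s)) (a / φ 0) (b / φ 0 - a ^ 2 / φ 0 ^ 2) := by
  have hc : ∀ᶠ s in 𝓝 (0:ℝ), φ s ≠ 0 :=
    (h.hasDerivAt.continuousAt).eventually_ne h0.ne'
  have hd := h.hasDerivAt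
  obtain ⟨φ1, h1, rfl, h3⟩ := h
  refine ⟨fun s => φ1 s / φ s, ?_, rfl, ?_⟩
  · filter_upwards [h1, hc] with s hs hs'
    exact hs.log hs'
  · refine (h3.div hd h0.ne').congr_deriv ?_
    have := h0.ne'
    field_simp

theorem HasD2.unique {φ : ℝ → F} {a b a' b' : F} (h : HasD2 φ a b) (h' : HasD2 φ a' b') :
    a = a' ∧ b = b' := by
  refine ⟨h.hasDerivAt.unique h'.hasDerivAt, ?_⟩
  obtain ⟨φ1, h1, rfl, h3⟩ := h
  obtain ⟨ψ1, g1, rfl, g3⟩ := h'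
  have : ψ1 =ᶠ[𝓝 0] φ1 := by
    filter_upwards [h1, g1] with s hs gs
    exact gs.unique hs
  exact (h3.congr_of_eventuallyEq this).unique g3

theorem HasD2.localMax {φ : ℝ → ℝ} {a b : ℝ} (h : HasD2 φ a b) (hm : IsLocalMax φ 0) :
    a = 0 ∧ b ≤ 0 := by
  have ha : a = 0 := hm.hasDerivAt_eq_zero h.hasDerivAt
  refine ⟨ha, ?_⟩
  obtain ⟨φ1, h1, h2, h3⟩ := h
  by_contra hb
  push Not at hb
  rw [ha] at h2
  -- φ1 s > 0 for small positive s
  have hpos : ∀ᶠ s in 𝓝[>] (0:ℝ), 0 < φ1 s := by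
    have := h3.hasDerivWithinAt (s := Ioi 0)
    rw [hasDerivWithinAt_iff_tendsto_slope] at this
    simp only [mem_Ioi, lt_self_iff_false, not_false_eq_true, sdiff_singleton_eq_self] at this
    filter_upwards [this.eventually (lt_mem_nhds hb), self_mem_nhdsWithin] with s hs hs'
    rw [slope_def_field, h2] at hs
    have hs'' : 0 < s := hs'
    simp only [sub_zero] at hs
    exact (div_pos_iff_of_pos_right hs'').1 hs
  obtain ⟨ε, hε, hε'⟩ := Metric.eventually_nhds_iff.1 (h1.and hm)
  obtain ⟨δ, hδ, hδ'⟩ := Metric.eventually_nhds_iff.1 (eventually_nhdsWithin_iff.1 hpos)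
  set r := min ε δ / 2 with hr
  have hr0 : 0 < r := by positivity
  have hrε : r < ε := by have := min_le_left ε δ; have : 0 < min ε δ := by positivity
                         linarith
  have hrδ : r < δ := by have := min_le_right ε δ; have : 0 < min ε δ := by positivity
                         linarith
  have hin : ∀ s ∈ Icc 0 r, HasDerivAt φ (φ1 s) s := fun s hs =>
    (hε' (by rw [Real.dist_eq, sub_zero, abs_of_nonneg hs.1]; linarith [hs.2])).1
  have hmono : StrictMonoOn φ (Icc 0 r) := by
    apply strictMonoOn_of_deriv_pos (convex_Icc 0 r)
    · exact fun s hs => (hin s hs).continuousAt.continuousWithinAt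
    · intro s hs
      rw [interior_Icc] at hs
      rw [(hin s ⟨hs.1.le, hs.2.le⟩).deriv]
      exact hδ' (by rw [Real.dist_eq, sub_zero, abs_of_pos hs.1]; linarith [hs.2]) hs.1
  have h4 := hmono ⟨le_rfl, hr0.le⟩ ⟨hr0.le, le_rfl⟩ hr0
  have h5 := (hε' (y := r) (by rw [Real.dist_eq, sub_zero, abs_of_pos hr0]; exact hrε)).2
  linarith

end hasD2

section key
variable {E : Type*} [NormedAddCommGroup E] [NormedSpace ℂ E] [NormedSpace ℝ E]
  [IsScalarTower ℝ ℂ E]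
variable {D : Set E} {G : E → E →L[ℝ] E →L[ℝ] ℂ} {Γ : E → E →L[ℝ] E →L[ℝ] E}

theorem KPre.hasD2_N (h : KPre D G Γ) {x V : ℝ → E} {x1 x2 V1 V2 : E} (hx : HasD2 x x1 x2)
    (hV : HasD2 V V1 V2) (h0 : x 0 ∈ D) :
    HasD2 (fun s => Nq G (x s) (V s))
      ((fderiv ℝ G (x 0) x1 (V 0) (V 0) + G (x 0) V1 (V 0) + G (x 0) (V 0) V1).re)
      ((fderiv ℝ (fderiv ℝ G) (x 0) x1 x1 (V 0) (V 0) + fderiv ℝ G (x 0) x2 (V 0) (V 0)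
        + 2 * (fderiv ℝ G (x 0) x1 V1 (V 0) + fderiv ℝ G (x 0) x1 (V 0) V1)
        + G (x 0) V2 (V 0) + G (x 0) (V 0) V2 + 2 * G (x 0) V1 V1).re) := by
  have hxc : ∀ᶠ s in 𝓝 (0:ℝ), x s ∈ D :=
    hx.hasDerivAt.continuousAt.eventually_mem (h.isOpen.mem_nhds h0)
  have hVd := hV.hasDerivAt
  have hxd := hx.hasDerivAt
  obtain ⟨y1, h1, rfl, h3⟩ := hx
  obtain ⟨W1, g1, rfl, g3⟩ := hV
  refine ⟨fun s => (fderiv ℝ G (x s) (y1 s) (V s) (V s) + G (x s) (W1 s) (V s)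
    + G (x s) (V s) (W1 s)).re, ?_, rfl, ?_⟩
  · filter_upwards [h1, g1, hxc] with s hs gs hsD
    have e1 := (h.diffAt hsD).hasFDerivAt.comp_hasDerivAt s hs
    have e2 := (e1.clm_apply gs).clm_apply gs
    have e3 := Complex.reCLM.hasFDerivAt.comp_hasDerivAt s e2
    simp only [Function.comp_def, Complex.reCLM_apply] at e3
    refine e3.congr_deriv ?_
    simp
  · have e1 := (h.diffAt h0).hasFDerivAt.comp_hasDerivAt (0:ℝ) hxd
    have e2 := (h.diffAt2 h0).hasFDerivAt.comp_hasDerivAt (0:ℝ) hxd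
    have a1 := ((e2.clm_apply h3).clm_apply hVd).clm_apply hVd
    have a2 := (e1.clm_apply g3).clm_apply hVd
    have a3 := (e1.clm_apply hVd).clm_apply g3
    have e3 := Complex.reCLM.hasFDerivAt.comp_hasDerivAt (0:ℝ) ((a1.add a2).add a3)
    simp only [Function.comp_def, Complex.reCLM_apply, Pi.add_apply] at e3
    refine e3.congr_deriv ?_
    simp
    ring

theorem hasD2_hol {c : ℂ → E} (hc : ∀ᶠ z in 𝓝 (0:ℂ), DifferentiableAt ℂ c z)
    (hc' : DifferentiableAt ℂ (deriv c) 0) (d : ℂ) :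
    HasD2 (fun s : ℝ => c (s * d)) (d • deriv c 0) ((d * d) • deriv (deriv c) 0) := by
  have hl : ∀ s : ℝ, HasDerivAt (fun s : ℝ => (s : ℂ) * d) d s := fun s => by
    simpa using (Complex.ofRealCLM.hasDerivAt (x := s)).mul_const d
  refine ⟨fun s => d • deriv c (s * d), ?_, by simp, ?_⟩
  · have ht : Tendsto (fun s : ℝ => (s : ℂ) * d) (𝓝 0) (𝓝 0) := by
      have := (hl 0).continuousAt.tendsto
      simpa using this
    filter_upwards [ht.eventually hc] with s hs
    exact hs.hasDerivAt.scomp s (hl s)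
  · have h0 : HasDerivAt (deriv c) (deriv (deriv c) 0) (((0:ℝ):ℂ) * d) := by
      simpa using hc'.hasDerivAt
    have := (h0.scomp (0:ℝ) (hl 0)).const_smul d
    simp only [smul_smul] at this
    exact this

/-- key formula -/
theorem KPre.key (h : KPre D G Γ) {c V : ℂ → E} (hc : ∀ᶠ z in 𝓝 (0:ℂ), DifferentiableAt ℂ c z)
    (hc' : DifferentiableAt ℂ (deriv c) 0) (hV : ∀ᶠ z in 𝓝 (0:ℂ), DifferentiableAt ℂ V z)
    (hV' : DifferentiableAt ℂ (deriv V) 0) (h0 : c 0 ∈ D) :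
    ∃ b1 b2 : ℝ, HasD2 (fun s : ℝ => Nq G (c (s * 1)) (V (s * 1)))
        (2 * (G (c 0) (deriv V 0 + Γ (c 0) (deriv c 0) (V 0)) (V 0)).re) b1 ∧
      HasD2 (fun s : ℝ => Nq G (c (s * Complex.I)) (V (s * Complex.I)))
        (2 * (Complex.I * G (c 0) (deriv V 0 + Γ (c 0) (deriv c 0) (V 0)) (V 0)).re) b2 ∧
      b1 + b2 = 4 * (- Rc G Γ (c 0) (V 0) (deriv c 0)
        + Nq G (c 0) (deriv V 0 + Γ (c 0) (deriv c 0) (V 0))) := by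
  have k1 := h.hasD2_N (hasD2_hol hc hc' 1) (hasD2_hol hV hV' 1) (by simpa using h0)
  have k2 := h.hasD2_N (hasD2_hol hc hc' Complex.I) (hasD2_hol hV hV' Complex.I) (by simpa using h0)
  simp only [Complex.ofReal_zero, zero_mul, one_mul, one_smul, neg_smul, Complex.I_mul_I] at k1 k2
  have pre : ∀ a, (G (c 0) (Γ (c 0) a (V 0)) (V 0)).re * 2 = (fderiv ℝ G (c 0) a (V 0) (V 0)).re := by
    intro a
    rw [h.gam _ h0]
    have him : (fderiv ℝ G (c 0) (Complex.I • a) (V 0) (V 0)).im = 0 :=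
      Complex.conj_eq_iff_im.1 (h.dherm h0 _ _ _)
    unfold Pq
    simp [him]
    ring
  have gc : ∀ v w, (G (c 0) v w).re = (G (c 0) w v).re := by
    intro v w; rw [← h.herm _ h0]; simp
  have gmap : ∀ v w u, G (c 0) (v + w) u = G (c 0) v u + G (c 0) w u := by
    intro v w u; rw [map_add, add_apply]
  have k1' : (2 * (G (c 0) (deriv V 0 + Γ (c 0) (deriv c 0) (V 0)) (V 0)).re) =
      (fderiv ℝ G (c 0) (deriv c 0) (V 0) (V 0) + G (c 0) (deriv V 0) (V 0)
        + G (c 0) (V 0) (deriv V 0)).re := by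
    rw [gmap]
    have := pre (deriv c 0)
    have e2 := gc (V 0) (deriv V 0)
    simp only [Complex.add_re] at *
    linarith
  have k2' : (2 * (Complex.I * G (c 0) (deriv V 0 + Γ (c 0) (deriv c 0) (V 0)) (V 0)).re) =
      (fderiv ℝ G (c 0) (Complex.I • deriv c 0) (V 0) (V 0) + G (c 0) (Complex.I • deriv V 0) (V 0)
        + G (c 0) (V 0) (Complex.I • deriv V 0)).re := by
    rw [h.lin, h.linR h0, gmap]
    have e1 : Complex.I * (G (c 0) (deriv V 0) (V 0) + G (c 0) (Γ (c 0) (deriv c 0) (V 0)) (V 0))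
      = Complex.I * G (c 0) (deriv V 0) (V 0) +
        G (c 0) (Γ (c 0) (Complex.I • deriv c 0) (V 0)) (V 0) := by
      rw [h.gam_I' h0, h.lin]; ring
    rw [e1]
    have := pre (Complex.I • deriv c 0)
    have e2 : (- Complex.I * G (c 0) (V 0) (deriv V 0)).re
        = (Complex.I * G (c 0) (deriv V 0) (V 0)).re := by
      rw [← h.lin, ← h.linR h0, gc]
    simp only [Complex.add_re] at *
    linarith
  rw [← k1'] at k1
  rw [← k2'] at k2
  refine ⟨_, _, k1, k2, ?_⟩
  clear k1 k2 k1' k2'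
  set z := c 0
  set a := deriv c 0
  set v := V 0
  set w := deriv V 0
  have e1 : G z (Γ z a v) w = (starRingEnd ℂ) (Qq G z a w v) := by
    rw [h.Q_eq h0, h.gam z h0]; simp
  have e2 : G z (Γ z a v) (Γ z a v) = (starRingEnd ℂ) (Qq G z a (Γ z a v) v) := by
    rw [h.Q_eq h0, h.gam z h0]; simp
  have e3 : Nq G z (w + Γ z a v) = (G z w w).re + 2 * (Qq G z a w v).re
      + (Qq G z a (Γ z a v) v).re := by
    unfold Nq
    have : G z (w + Γ z a v) (w + Γ z a v) = G z w w + G z w (Γ z a v) + G z (Γ z a v) w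
      + G z (Γ z a v) (Γ z a v) := by
      rw [gmap, map_add, map_add]; ring
    rw [this, Complex.add_re, Complex.add_re, Complex.add_re, gc w (Γ z a v), e1, e2]
    simp only [Complex.conj_re]; ring
  rw [e3]
  have e4 : (fderiv ℝ G z a w v).re + (Complex.I * fderiv ℝ G z (Complex.I • a) w v).re =
      2 * (Qq G z a w v).re := by
    unfold Qq
    have : (1 / 2 : ℂ) = ((1 / 2 : ℝ) : ℂ) := by norm_num
    rw [this, Complex.re_ofReal_mul, Complex.add_re]; ring
  have e5 : (fderiv ℝ G z a v w).re = (fderiv ℝ G z a w v).re := by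
    rw [← h.dherm h0]; simp
  have e6 : (-Complex.I * fderiv ℝ G z (Complex.I • a) v w).re =
      (Complex.I * fderiv ℝ G z (Complex.I • a) w v).re := by
    rw [← h.dherm h0]; simp
  have e7 : Rc G Γ z v a = (Qq G z a (Γ z a v) v).re - (1 / 4) * ((fderiv ℝ (fderiv ℝ G) z a a v v).re +
    (fderiv ℝ (fderiv ℝ G) z (Complex.I • a) (Complex.I • a) v v).re) := by
    unfold Rc
    have : (1 / 4 : ℂ) = ((1 / 4 : ℝ) : ℂ) := by norm_num
    rw [Complex.sub_re, this, Complex.re_ofReal_mul, Complex.add_re]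
  rw [e7]
  have e8 : G z (Complex.I • w) (Complex.I • w) = G z w w := by
    rw [h.lin, h.linR h0]; linear_combination (- G z w w) * Complex.I_mul_I
  have two : ∀ x : ℂ, (2 * x).re = 2 * x.re := by intro x; simp
  rw [h.dlin h0, h.dlinR h0, e8]
  simp only [Complex.add_re, map_neg, neg_apply, Complex.neg_re, two, e5, e6]
  linarith

end key

section ahlfors
variable {E : Type*} [NormedAddCommGroup E] [NormedSpace ℂ E] [NormedSpace ℝ E]
  [IsScalarTower ℝ ℂ E]
variable {D : Set E} {G : E → E →L[ℝ] E →L[ℝ] ℂ} {Γ : E → E →L[ℝ] E →L[ℝ] E}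

theorem csmul_eq (α : ℂ) (v : E) : α • v = α.re • v + α.im • (Complex.I • v) := by
  conv_lhs => rw [← Complex.re_add_im α]
  rw [add_smul, mul_smul]
  have : ∀ (r : ℝ) (w : E), (r : ℂ) • w = r • w := by
    intro r w
    rw [← one_smul ℂ w, ← smul_assoc r (1:ℂ) w, one_smul]; simp
  rw [this, this]

theorem KPre.smulL (h : KPre D G Γ) (z : E) (α : ℂ) (v w : E) :
    G z (α • v) w = α * G z v w := by
  rw [csmul_eq, map_add, map_smul, map_smul, add_apply, smul_apply,
    smul_apply, h.lin]
  conv_rhs => rw [← Complex.re_add_im α]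
  simp only [Complex.real_smul]; ring

theorem KPre.smulR (h : KPre D G Γ) {z : E} (hz : z ∈ D) (α : ℂ) (v w : E) :
    G z v (α • w) = (starRingEnd ℂ) α * G z v w := by
  rw [← h.herm z hz, h.smulL, map_mul, h.herm z hz]

theorem KPre.G_self (h : KPre D G Γ) {z : E} (hz : z ∈ D) (v : E) : G z v v = (Nq G z v : ℂ) := by
  unfold Nq
  exact (Complex.conj_eq_iff_re.1 (h.herm z hz v v)).symm

theorem KPre.N_nonneg (h : KPre D G Γ) {z : E} (hz : z ∈ D) (v : E) : 0 ≤ Nq G z v := by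
  by_cases hv : v = 0
  · simp [hv, Nq]
  · exact (h.pos z hz v hv).le

theorem KPre.N_pos (h : KPre D G Γ) {z : E} (hz : z ∈ D) {v : E} (hv : v ≠ 0) : 0 < Nq G z v :=
  h.pos z hz v hv

theorem KPre.cs (h : KPre D G Γ) {z : E} (hz : z ∈ D) (v w : E) :
    Complex.normSq (G z v w) ≤ Nq G z v * Nq G z w := by
  by_cases hw : w = 0
  · simp [hw, Nq]
  have hp := h.N_pos hz hw
  set t := G z v w with ht
  have hcj : G z w v = (starRingEnd ℂ) t := by rw [ht, h.herm z hz]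
  have h1 := h.N_nonneg hz ((Nq G z w : ℂ) • v - t • w)
  have h2 : G z ((Nq G z w : ℂ) • v - t • w) ((Nq G z w : ℂ) • v - t • w) =
     (((Nq G z w) * (Nq G z v * Nq G z w - Complex.normSq t) : ℝ) : ℂ) := by
    have e : ∀ x y : E, G z (x - y) (x - y) = G z x x - G z x y - G z y x + G z y y := by
      intro x y
      have : G z (x - y) = G z x - G z y := map_sub _ _ _
      rw [this, map_sub, sub_apply, sub_apply]; ring
    rw [e]
    simp only [h.smulL, h.smulR hz, h.G_self hz, ← ht, hcj, Complex.conj_ofReal]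
    push_cast
    rw [Complex.normSq_eq_conj_mul_self]
    ring
  have h3 : Nq G z ((Nq G z w : ℂ) • v - t • w) =
      (Nq G z w) * (Nq G z v * Nq G z w - Complex.normSq t) := by
    have := congrArg Complex.re h2
    rw [Complex.ofReal_re] at this
    exact this
  rw [h3] at h1
  have := nonneg_of_mul_nonneg_right h1 hp
  linarith

theorem KPre.N_smul (h : KPre D G Γ) {z : E} (hz : z ∈ D) (α : ℂ) (v : E) :
    Nq G z (α • v) = Complex.normSq α * Nq G z v := by
  unfold Nq
  rw [h.smulL, h.smulR hz, ← mul_assoc, Complex.mul_conj, Complex.re_ofReal_mul]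

theorem Nq_rsmul (z : E) (r : ℝ) (v : E) :
    Nq G z (r • v) = r ^ 2 * Nq G z v := by
  unfold Nq
  simp
  ring

/-- Laplacian of log of the squared norm. -/
theorem KPre.key_log (h : KPre D G Γ) {c V : ℂ → E}
    (hc : ∀ᶠ z in 𝓝 (0:ℂ), DifferentiableAt ℂ c z)
    (hc' : DifferentiableAt ℂ (deriv c) 0) (hV : ∀ᶠ z in 𝓝 (0:ℂ), DifferentiableAt ℂ V z)
    (hV' : DifferentiableAt ℂ (deriv V) 0) (h0 : c 0 ∈ D) (hV0 : V 0 ≠ 0) :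
    ∃ a1 a2 b1 b2 : ℝ, HasD2 (fun s : ℝ => Real.log (Nq G (c (s * 1)) (V (s * 1)))) a1 b1 ∧
      HasD2 (fun s : ℝ => Real.log (Nq G (c (s * Complex.I)) (V (s * Complex.I)))) a2 b2 ∧
      - 4 * Rc G Γ (c 0) (V 0) (deriv c 0) / Nq G (c 0) (V 0) ≤ b1 + b2 ∧
      (deriv V 0 + Γ (c 0) (deriv c 0) (V 0) = 0 →
        b1 + b2 = - 4 * Rc G Γ (c 0) (V 0) (deriv c 0) / Nq G (c 0) (V 0)) := by
  obtain ⟨b1, b2, h1, h2, h3⟩ := h.key hc hc' hV hV' h0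
  have hp := h.N_pos h0 hV0
  have l1 := h1.log (by simpa using hp)
  have l2 := h2.log (by simpa using hp)
  simp only [Complex.ofReal_zero, zero_mul] at l1 l2
  refine ⟨_, _, _, _, l1, l2, ?_, ?_⟩
  · set ν := deriv V 0 + Γ (c 0) (deriv c 0) (V 0)
    have hcs := h.cs h0 ν (V 0)
    rw [Complex.normSq_apply] at hcs
    simp only [Complex.mul_re, Complex.I_re, Complex.I_im, zero_mul, one_mul, zero_sub] 
    have e : b1 / Nq G (c 0) (V 0) - (2 * (G (c 0) ν (V 0)).re) ^ 2 / Nq G (c 0) (V 0) ^ 2 +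
        (b2 / Nq G (c 0) (V 0) - (2 * -(G (c 0) ν (V 0)).im) ^ 2 / Nq G (c 0) (V 0) ^ 2) -
        - 4 * Rc G Γ (c 0) (V 0) (deriv c 0) / Nq G (c 0) (V 0) =
        4 * (Nq G (c 0) ν * Nq G (c 0) (V 0) - ((G (c 0) ν (V 0)).re * (G (c 0) ν (V 0)).re +
          (G (c 0) ν (V 0)).im * (G (c 0) ν (V 0)).im)) / Nq G (c 0) (V 0) ^ 2 := by
      have : b2 = 4 * (- Rc G Γ (c 0) (V 0) (deriv c 0) + Nq G (c 0) ν) - b1 := by linarith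
      rw [this]
      field_simp
      ring
    have : 0 ≤ 4 * (Nq G (c 0) ν * Nq G (c 0) (V 0) - ((G (c 0) ν (V 0)).re * (G (c 0) ν (V 0)).re +
          (G (c 0) ν (V 0)).im * (G (c 0) ν (V 0)).im)) / Nq G (c 0) (V 0) ^ 2 := by
      apply div_nonneg _ (by positivity)
      linarith
    linarith
  · intro hν
    rw [hν] at h3 ⊢
    have hz : Nq G (c 0) 0 = 0 := by simp [Nq]
    have : b2 = 4 * (- Rc G Γ (c 0) (V 0) (deriv c 0)) - b1 := by rw [hz] at h3; linarith
    rw [this]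
    simp
    field_simp
    ring

theorem hasD2_q (ρ : ℝ) (w d : ℂ) :
    HasD2 (fun s : ℝ => ρ ^ 2 - Complex.normSq (w + s * d))
      (- 2 * (w.re * d.re + w.im * d.im)) (- 2 * Complex.normSq d) := by
  have e : ∀ s : ℝ, ρ ^ 2 - Complex.normSq (w + s * d) = ρ ^ 2 - Complex.normSq w +
     s * (- 2 * (w.re * d.re + w.im * d.im)) + s ^ 2 * (- Complex.normSq d) := by
    intro s; simp [Complex.normSq_apply]; ring
  simp only [e]
  refine ⟨fun s => (- 2 * (w.re * d.re + w.im * d.im)) + (2 * s) * (- Complex.normSq d), ?_, by simp, ?_⟩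
  · refine Eventually.of_forall fun s => ?_
    have := (((hasDerivAt_id s).mul_const (- 2 * (w.re * d.re + w.im * d.im))).const_add
      (ρ ^ 2 - Complex.normSq w)).add (((hasDerivAt_id s).pow 2).mul_const (- Complex.normSq d))
    refine this.congr_deriv ?_
    simp
  · have := ((((hasDerivAt_id (0:ℝ)).const_mul 2).mul_const (- Complex.normSq d))).const_add
      (- 2 * (w.re * d.re + w.im * d.im))
    refine this.congr_deriv ?_
    simp

theorem KData.ahlfors [CompleteSpace E] {c₁ c₂ : ℝ} (h : KData D G Γ c₁ c₂) (hc₁ : 0 < c₁) {f : ℂ → E}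
    (hf : DifferentiableOn ℂ f (ball 0 1)) (hm : MapsTo f (ball 0 1) D) :
    Nq G (f 0) (deriv f 0) ≤ 2 / c₁ := by
  have hfd : DifferentiableOn ℂ (deriv f) (ball 0 1) := hf.deriv isOpen_ball
  have hfdd : DifferentiableOn ℂ (deriv (deriv f)) (ball 0 1) := hfd.deriv isOpen_ball
  -- fixed radius
  have main : ∀ ρ : ℝ, 0 < ρ → ρ < 1 → ρ ^ 2 * Nq G (f 0) (deriv f 0) ≤ 2 / c₁ := by
    intro ρ hρ hρ1
    have hsub : closedBall (0:ℂ) ρ ⊆ ball 0 1 := closedBall_subset_ball hρ1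
    set F : ℂ → ℝ := fun ζ => (ρ ^ 2 - Complex.normSq ζ) ^ 2 * Nq G (f ζ) (deriv f ζ) with hF
    have hcont : ContinuousOn F (closedBall 0 ρ) := by
      have c1 : ContinuousOn (fun ζ => G (f ζ)) (closedBall 0 ρ) :=
        (h.smooth.continuousOn.comp (hf.continuousOn.mono hsub) (hm.mono_left hsub))
      have c2 := hfd.continuousOn.mono hsub
      have c3 := (c1.clm_apply c2).clm_apply c2
      have c4 := Complex.continuous_re.comp_continuousOn c3
      exact ((continuous_const.sub Complex.continuous_normSq).pow 2).continuousOn.mul c4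
    obtain ⟨w, hw, hmax⟩ := (isCompact_closedBall (0:ℂ) ρ).exists_isMaxOn
      ⟨0, by simp [hρ.le]⟩ hcont
    have hF0 : F 0 = ρ ^ 2 * (ρ ^ 2 * Nq G (f 0) (deriv f 0)) := by
      simp [hF]; ring
    have h0w : F 0 ≤ F w := hmax (by simp [hρ.le])
    suffices hs : F w ≤ ρ ^ 2 * (2 / c₁) by
      have : ρ ^ 2 * (ρ ^ 2 * Nq G (f 0) (deriv f 0)) ≤ ρ ^ 2 * (2 / c₁) := by linarith
      exact le_of_mul_le_mul_left this (by positivity)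
    by_cases hFw : F w ≤ 0
    · exact hFw.trans (by positivity)
    push Not at hFw
    have hwD : f w ∈ D := hm (hsub hw)
    have hN0 := h.N_nonneg hwD (deriv f w)
    have hq : ρ ^ 2 - Complex.normSq w ≠ 0 := by
      intro hq; simp only [hF, hq] at hFw; simp at hFw
    have hwn : Complex.normSq w ≤ ρ ^ 2 := by
      rw [Complex.normSq_eq_norm_sq]
      have : ‖w‖ ≤ ρ := by simpa using hw
      gcongr
    have hqp : 0 < ρ ^ 2 - Complex.normSq w := lt_of_le_of_ne (by linarith) hq.symm
    have hN : 0 < Nq G (f w) (deriv f w) := by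
      rcases hN0.eq_or_lt with h' | h'
      · simp only [hF, ← h'] at hFw; simp at hFw
      · exact h'
    have hV0 : deriv f w ≠ 0 := by
      intro h'; rw [h'] at hN; simp [Nq] at hN
    have hwb : ‖w‖ < ρ := by
      rw [Complex.normSq_eq_norm_sq] at hqp
      exact lt_of_pow_lt_pow_left₀ 2 hρ.le (by linarith)
    have hnear : ∀ᶠ ζ in 𝓝 (0:ℂ), w + ζ ∈ ball (0:ℂ) ρ := by
      have : Tendsto (fun ζ : ℂ => w + ζ) (𝓝 0) (𝓝 w) := by
        have := (show Continuous fun ζ : ℂ => w + ζ by fun_prop).tendsto 0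
        simpa using this
      exact this.eventually (isOpen_ball.mem_nhds (by simpa using hwb))
    have hdc : ∀ (k : ℂ → E), DifferentiableOn ℂ k (ball 0 1) →
        ∀ᶠ ζ in 𝓝 (0:ℂ), DifferentiableAt ℂ (fun ζ => k (w + ζ)) ζ := by
      intro k hk
      filter_upwards [hnear] with ζ hζ
      have h1 : DifferentiableAt ℂ k (w + ζ) :=
        hk.differentiableAt (isOpen_ball.mem_nhds (ball_subset_ball hρ1.le hζ))
      exact h1.comp ζ ((differentiableAt_const w).add differentiableAt_id)
    have hd1 : ∀ k : ℂ → E, deriv (fun ζ => k (w + ζ)) = fun ζ => deriv k (w + ζ) := by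
      intro k; funext ζ; exact deriv_comp_const_add _ _ _
    obtain ⟨a1, a2, b1, b2, l1, l2, l3, -⟩ := h.key_log (c := fun ζ => f (w + ζ))
      (V := fun ζ => deriv f (w + ζ)) (hdc _ hf)
      (by rw [hd1]; exact (hdc _ hfd).self_of_nhds) (hdc _ hfd)
      (by rw [hd1]; exact (hdc _ hfdd).self_of_nhds) (by simpa using hwD) (by simpa using hV0)
    have hq1 := (((hasD2_q ρ w 1).log (by simpa using hqp)).const_mul 2).add l1
    have hq2 := (((hasD2_q ρ w Complex.I).log (by simpa using hqp)).const_mul 2).add l2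
    have hlm : ∀ d : ℂ, IsLocalMax (fun s : ℝ => 2 * Real.log (ρ ^ 2 - Complex.normSq (w + s * d)) +
        Real.log (Nq G (f (w + s * d)) (deriv f (w + s * d)))) 0 := by
      intro d
      have ht : Tendsto (fun s : ℝ => (s : ℂ) * d) (𝓝 0) (𝓝 0) := by
        have := (show Continuous fun s : ℝ => (s : ℂ) * d by fun_prop).tendsto 0
        simpa using this
      have hl : ∀ ζ, 0 < F ζ → 2 * Real.log (ρ ^ 2 - Complex.normSq ζ) +
          Real.log (Nq G (f ζ) (deriv f ζ)) = Real.log (F ζ) := by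
        intro ζ hζ
        have n1 : ρ ^ 2 - Complex.normSq ζ ≠ 0 := by
          intro hq; simp only [hF, hq] at hζ; simp at hζ
        have n2 : Nq G (f ζ) (deriv f ζ) ≠ 0 := by
          intro hq; simp only [hF, hq] at hζ; simp at hζ
        simp only [hF]
        rw [Real.log_mul (pow_ne_zero 2 n1) n2, Real.log_pow]
        norm_num
      have hFc : ∀ᶠ ζ in 𝓝 (0:ℂ), 0 < F (w + ζ) := by
        have hca : ContinuousAt F w := hcont.continuousAt (closedBall_mem_nhds_of_mem (by simpa using hwb))
        have : Tendsto (fun ζ : ℂ => w + ζ) (𝓝 0) (𝓝 w) := by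
          have := (show Continuous fun ζ : ℂ => w + ζ by fun_prop).tendsto 0
          simpa using this
        exact (hca.tendsto.comp this).eventually (lt_mem_nhds hFw)
      filter_upwards [ht.eventually hFc, ht.eventually hnear] with s hs hs'
      rw [hl _ hs]
      have : 2 * Real.log (ρ ^ 2 - Complex.normSq (w + ((0:ℝ):ℂ) * d)) +
          Real.log (Nq G (f (w + ((0:ℝ):ℂ) * d)) (deriv f (w + ((0:ℝ):ℂ) * d))) = Real.log (F w) := by
        rw [← hl w hFw]; simp
      rw [this]
      exact Real.log_le_log hs (hmax (ball_subset_closedBall hs'))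
    have m1 := (hq1.localMax (hlm 1)).2
    have m2 := (hq2.localMax (hlm Complex.I)).2
    simp only [Complex.ofReal_zero, zero_mul, add_zero, Complex.one_re, Complex.one_im, Complex.I_re,
      Complex.I_im, mul_one, mul_zero, zero_add, map_one, Complex.normSq_I] at m1 m2
    simp only [hd1, add_zero] at l3
    have hu := h.upp (f w) hwD (deriv f w)
    set N := Nq G (f w) (deriv f w) with hNdef
    set q := ρ ^ 2 - Complex.normSq w with hqdef
    have l4 : 4 * c₁ * N ≤ b1 + b2 := by
      refine le_trans ?_ l3
      rw [le_div_iff₀ hN]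
      nlinarith
    have e : 2 * (-2 / q - (-2 * w.re) ^ 2 / q ^ 2) + 2 * (-2 / q - (-2 * w.im) ^ 2 / q ^ 2) =
        - 8 * ρ ^ 2 / q ^ 2 := by
      have : ρ ^ 2 = q + (w.re * w.re + w.im * w.im) := by
        rw [hqdef, Complex.normSq_apply]; ring
      rw [this]
      field_simp
      ring
    have l5 : 4 * c₁ * N ≤ 8 * ρ ^ 2 / q ^ 2 := by
      have : - 8 * ρ ^ 2 / q ^ 2 = - (8 * ρ ^ 2 / q ^ 2) := by ring
      linarith
    rw [le_div_iff₀ (by positivity)] at l5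
    have : F w = q ^ 2 * N := rfl
    rw [this, mul_div_assoc', le_div_iff₀ hc₁]
    nlinarith
  have ht : Tendsto (fun ρ : ℝ => ρ ^ 2 * Nq G (f 0) (deriv f 0)) (𝓝[<] 1)
      (𝓝 (Nq G (f 0) (deriv f 0))) := by
    have : Continuous (fun ρ : ℝ => ρ ^ 2 * Nq G (f 0) (deriv f 0)) := by fun_prop
    have := (this.tendsto 1).mono_left (nhdsWithin_le_nhds (s := Iio 1))
    simpa using this
  refine le_of_tendsto ht ?_
  have : Ioo (0:ℝ) 1 ∈ 𝓝[<] (1:ℝ) := Ioo_mem_nhdsLT (by norm_num)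
  filter_upwards [this] with ρ hρ
  exact main ρ hρ.1 hρ.2

end ahlfors

section lemU
variable {W : Type*} [NormedAddCommGroup W] [NormedSpace ℝ W]

theorem taylor_aux {φ φ1 φ2 : ℝ → ℝ} {r η a b : ℝ} (hr : 0 < r)
    (h1 : ∀ s ∈ Icc (-r) r, HasDerivAt φ (φ1 s) s) (h2 : ∀ s ∈ Icc (-r) r, HasDerivAt φ1 (φ2 s) s)
    (ha : φ1 0 = a) (hb1 : ∀ s ∈ Icc (-r) r, |φ1 s - a| ≤ η)
    (hb2 : ∀ s ∈ Icc (-r) r, |φ2 s - b| ≤ η) :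
    |φ r - φ 0 - r * a| ≤ η * r ∧ |φ (-r) - φ 0 + r * a| ≤ η * r ∧
      |φ r + φ (-r) - 2 * φ 0 - r ^ 2 * b| ≤ 2 * η * r ^ 2 := by
  have z0 : (0:ℝ) ∈ Icc (-r) r := ⟨by linarith, hr.le⟩
  have zr : r ∈ Icc (-r) r := ⟨by linarith, le_rfl⟩
  have zn : -r ∈ Icc (-r) r := ⟨le_rfl, by linarith⟩
  have hη : 0 ≤ η := (abs_nonneg _).trans (hb1 0 z0)
  have A : ∀ s ∈ Icc (-r) r, |φ s - s * a - (φ 0)| ≤ η * |s| := by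
    intro s hs
    have := Convex.norm_image_sub_le_of_norm_hasDerivWithin_le (f := fun s => φ s - s * a)
      (f' := fun s => φ1 s - a) (s := Icc (-r) r) (C := η) (x := 0) (y := s)
      (fun x hx => ((h1 x hx).sub (by simpa using (hasDerivAt_id x).mul_const a)).hasDerivWithinAt)
      (fun x hx => by simpa using hb1 x hx) (convex_Icc _ _) z0 hs
    simpa using this
  have B : ∀ s ∈ Icc (-r) r, |φ1 s - s * b - a| ≤ η * |s| := by
    intro s hs
    have := Convex.norm_image_sub_le_of_norm_hasDerivWithin_le (f := fun s => φ1 s - s * b)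
      (f' := fun s => φ2 s - b) (s := Icc (-r) r) (C := η) (x := 0) (y := s)
      (fun x hx => ((h2 x hx).sub (by simpa using (hasDerivAt_id x).mul_const b)).hasDerivWithinAt)
      (fun x hx => by simpa using hb2 x hx) (convex_Icc _ _) z0 hs
    simpa [ha] using this
  have C : ∀ s ∈ Icc (-r) r, |φ s - s * a - s ^ 2 / 2 * b - (φ 0)| ≤ η * r * |s| := by
    intro s hs
    have hd : ∀ x ∈ Icc (-r) r, HasDerivAt (fun s => φ s - s * a - s ^ 2 / 2 * b)
        (φ1 x - x * b - a) x := by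
      intro x hx
      have e1 := ((h1 x hx).sub ((hasDerivAt_id x).mul_const a)).sub
        ((((hasDerivAt_id x).pow 2).div_const 2).mul_const b)
      refine e1.congr_deriv ?_
      simp; ring
    have := Convex.norm_image_sub_le_of_norm_hasDerivWithin_le
      (f := fun s => φ s - s * a - s ^ 2 / 2 * b)
      (f' := fun s => φ1 s - s * b - a) (s := Icc (-r) r) (C := η * r) (x := 0) (y := s)
      (fun x hx => (hd x hx).hasDerivWithinAt)
      (fun x hx => (B x hx).trans (by
        have : |x| ≤ r := abs_le.2 hx
        gcongr)) (convex_Icc _ _) z0 hs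
    simpa using this
  have a1 := A r zr
  have a2 := A (-r) zn
  have c1 := C r zr
  have c2 := C (-r) zn
  rw [abs_neg] at a2 c2
  rw [abs_of_pos hr] at a1 a2 c1 c2
  refine ⟨?_, ?_, ?_⟩
  · convert a1 using 2; ring
  · convert a2 using 2; ring
  · rw [abs_le] at c1 c2 ⊢
    constructor <;> nlinarith

set_option maxHeartbeats 800000 in
theorem lemU {Ψ : W × ℂ → ℝ} {O : Set (W × ℂ)} (hO : IsOpen O) (hΨ : ContDiffOn ℝ 2 Ψ O)
    {Kc : Set W} (hK : IsCompact Kc) (hKO : ∀ k ∈ Kc, (k, (0:ℂ)) ∈ O) (d : ℂ) {η : ℝ} (hη : 0 < η) :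
    ∃ r0 > (0:ℝ), ∀ k ∈ Kc, ∀ r : ℝ, 0 < r → r ≤ r0 →
      (k, (r:ℂ) * d) ∈ O ∧ (k, -(r:ℂ) * d) ∈ O ∧
      ∀ a b : ℝ, HasD2 (fun s : ℝ => Ψ (k, s * d)) a b →
      |Ψ (k, r * d) - Ψ (k, 0) - r * a| ≤ η * r ∧ |Ψ (k, - r * d) - Ψ (k, 0) + r * a| ≤ η * r ∧
      |Ψ (k, r * d) + Ψ (k, - r * d) - 2 * Ψ (k, 0) - r ^ 2 * b| ≤ η * r ^ 2 := by
  set D1 : W × ℂ → ℝ := fun x => fderiv ℝ Ψ x (0, d) with hD1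
  set D2 : W × ℂ → ℝ := fun x => fderiv ℝ (fderiv ℝ Ψ) x (0, d) (0, d) with hD2
  have hc1 : ContDiffOn ℝ 1 (fderiv ℝ Ψ) O := hΨ.fderiv_of_isOpen hO (by norm_num)
  have hcD1 : ContinuousOn D1 O := hc1.continuousOn.clm_apply continuousOn_const
  have hcD2 : ContinuousOn D2 O :=
    ((hc1.continuousOn_fderiv_of_isOpen hO (by norm_num)).clm_apply continuousOn_const).clm_apply
      continuousOn_const
  have hl : ∀ (k : W) (s : ℝ), HasDerivAt (fun s : ℝ => (k, (s : ℂ) * d)) ((0 : W), d) s := fun k s => by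
    have : HasDerivAt (fun s : ℝ => (s : ℂ) * d) d s := by
      simpa using (Complex.ofRealCLM.hasDerivAt (x := s)).mul_const d
    exact (hasDerivAt_const s k).prodMk this
  have hev : ∀ᶠ s : ℝ in 𝓝 (0:ℝ), ∀ k ∈ Kc, (k, (s:ℂ) * d) ∈ O ∧
      |D1 (k, (s:ℂ) * d) - D1 (k, 0)| < η / 2 ∧ |D2 (k, (s:ℂ) * d) - D2 (k, 0)| < η / 2 := by
    apply hK.eventually_forall_of_forall_eventually
    intro k hk
    have cont1 : Continuous (fun z : ℝ × W => (z.2, (z.1 : ℂ) * d)) := by fun_prop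
    have cont2 : Continuous (fun z : ℝ × W => (z.2, (0 : ℂ))) := by fun_prop
    have t1 : Tendsto (fun z : ℝ × W => (z.2, (z.1 : ℂ) * d)) (𝓝 ((0:ℝ), k)) (𝓝 (k, (0:ℂ))) := by
      have := cont1.tendsto (0, k); simpa using this
    have t2 : Tendsto (fun z : ℝ × W => (z.2, (0 : ℂ))) (𝓝 ((0:ℝ), k)) (𝓝 (k, (0:ℂ))) :=
      cont2.tendsto (0, k)
    have hn := hO.mem_nhds (hKO k hk)
    have gen : ∀ f : W × ℂ → ℝ, ContinuousOn f O →
        ∀ᶠ z : ℝ × W in 𝓝 ((0:ℝ), k), |f (z.2, (z.1 : ℂ) * d) - f (z.2, 0)| < η / 2 := by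
      intro f hf
      have hca := (hf.continuousAt hn).tendsto
      have := ((hca.comp t1).sub (hca.comp t2)).abs
      simp only [sub_self, abs_zero] at this
      exact this.eventually (gt_mem_nhds (by positivity))
    filter_upwards [t1.eventually hn, gen D1 hcD1, gen D2 hcD2] with z h1 h2 h3
    exact ⟨h1, h2, h3⟩
  obtain ⟨ε, hε, hε'⟩ := Metric.eventually_nhds_iff.1 hev
  refine ⟨ε / 2, by positivity, fun k hk r hr hr0 => ?_⟩
  have hin : ∀ s ∈ Icc (-r) r, (k, (s:ℂ) * d) ∈ O ∧
      |D1 (k, (s:ℂ) * d) - D1 (k, 0)| < η / 2 ∧ |D2 (k, (s:ℂ) * d) - D2 (k, 0)| < η / 2 := by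
    intro s hs
    refine hε' ?_ k hk
    rw [Real.dist_eq, sub_zero]
    have := abs_le.2 hs
    linarith
  have zr : r ∈ Icc (-r) r := ⟨by linarith, le_rfl⟩
  have zn : -r ∈ Icc (-r) r := ⟨le_rfl, by linarith⟩
  have z0 : (0:ℝ) ∈ Icc (-r) r := ⟨by linarith, hr.le⟩
  refine ⟨(hin r zr).1, by simpa using (hin (-r) zn).1, fun a b hab => ?_⟩
  have der1 : ∀ s : ℝ, (k, (s:ℂ) * d) ∈ O →
      HasDerivAt (fun s : ℝ => Ψ (k, s * d)) (D1 (k, s * d)) s := by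
    intro s hs
    have := (hΨ.differentiableOn (by norm_num)).differentiableAt (hO.mem_nhds hs)
    exact this.hasFDerivAt.comp_hasDerivAt s (hl k s)
  have der2 : ∀ s : ℝ, (k, (s:ℂ) * d) ∈ O →
      HasDerivAt (fun s : ℝ => D1 (k, s * d)) (D2 (k, s * d)) s := by
    intro s hs
    have := (hc1.differentiableOn (by norm_num)).differentiableAt (hO.mem_nhds hs)
    have h4 := this.hasFDerivAt.comp_hasDerivAt s (hl k s)
    exact ((ContinuousLinearMap.apply ℝ ℝ ((0:W), d)).hasFDerivAt).comp_hasDerivAt s h4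
  have h2' : HasD2 (fun s : ℝ => Ψ (k, s * d)) (D1 (k, 0)) (D2 (k, 0)) := by
    refine ⟨fun s => D1 (k, s * d), ?_, by simp, ?_⟩
    · have : ∀ᶠ s in 𝓝 (0:ℝ), s ∈ Icc (-r) r := Icc_mem_nhds (by linarith) hr
      filter_upwards [this] with s hs
      exact der1 s (hin s hs).1
    · simpa using der2 0 (hin 0 z0).1
  obtain ⟨rfl, rfl⟩ := hab.unique h2'
  have := taylor_aux (η := η / 2) (φ := fun s : ℝ => Ψ (k, s * d)) (φ1 := fun s : ℝ => D1 (k, s * d))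
    (φ2 := fun s : ℝ => D2 (k, s * d)) (a := D1 (k, 0)) (b := D2 (k, 0)) hr
    (fun s hs => der1 s (hin s hs).1) (fun s hs => der2 s (hin s hs).1) (by simp)
    (fun s hs => (hin s hs).2.1.le) (fun s hs => (hin s hs).2.2.le)
  simp only [Complex.ofReal_neg, Complex.ofReal_zero, zero_mul] at this
  obtain ⟨t1, t2, t3⟩ := this
  refine ⟨t1.trans (by nlinarith), t2.trans (by nlinarith), t3.trans (by linarith)⟩

end lemU

section concrete
variable {n : ℕ}

/-- elementary sesquilinear form -/
noncomputable def Bij (i j : Fin n) : (Fin n → ℂ) →L[ℝ] (Fin n → ℂ) →L[ℝ] ℂ :=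
  (ContinuousLinearMap.mul ℝ ℂ).bilinearComp (ContinuousLinearMap.proj i)
    (Complex.conjCLE.toContinuousLinearMap.comp (ContinuousLinearMap.proj j))

theorem Bij_apply (i j : Fin n) (v w : Fin n → ℂ) : Bij i j v w = v i * (starRingEnd ℂ) (w j) := by
  simp [Bij]

/-- scalar times elementary sesquilinear form -/
noncomputable def LBij (i j : Fin n) : ℂ →L[ℝ] (Fin n → ℂ) →L[ℝ] (Fin n → ℂ) →L[ℝ] ℂ :=
  (ContinuousLinearMap.toSpanSingleton ℂ (Bij i j)).restrictScalars ℝ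

theorem LBij_apply (i j : Fin n) (c : ℂ) (v w : Fin n → ℂ) :
    LBij i j c v w = c * v i * (starRingEnd ℂ) (w j) := by
  simp [LBij, Bij_apply]; ring

/-- hermitian form as continuous bilinear map -/
noncomputable def Gq (g : (Fin n → ℂ) → Matrix (Fin n) (Fin n) ℂ) (z : Fin n → ℂ) :
    (Fin n → ℂ) →L[ℝ] (Fin n → ℂ) →L[ℝ] ℂ := ∑ i, ∑ j, LBij i j (g z i j)

theorem Gq_apply (g : (Fin n → ℂ) → Matrix (Fin n) (Fin n) ℂ) (z v w : Fin n → ℂ) :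
    Gq g z v w = hermForm g z v w := by
  simp only [Gq, hermForm, sum_apply, LBij_apply]

theorem hPre_Gq {D : Set (Fin n → ℂ)} {g : (Fin n → ℂ) → Matrix (Fin n) (Fin n) ℂ}
    (hopen : IsOpen D) (hg : IsHermitianMetricOn D g) : HPre D (Gq g) where
  isOpen := hopen
  smooth := by
    unfold Gq
    refine ContDiffOn.sum fun i _ => ContDiffOn.sum fun j _ => ?_
    exact (LBij i j).contDiff.comp_contDiffOn (hg.smooth i j)
  lin := by
    intro z v w
    simp only [Gq_apply, hermForm, Finset.mul_sum]
    refine Finset.sum_congr rfl fun i _ => Finset.sum_congr rfl fun j _ => ?_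
    simp; ring
  herm := by
    intro z hz v w
    simp only [Gq_apply, hermForm, map_sum, map_mul]
    rw [Finset.sum_comm]
    refine Finset.sum_congr rfl fun i _ => Finset.sum_congr rfl fun j _ => ?_
    have := (hg.hermitian z hz).apply i j
    rw [← this]
    simp; ring
  pos := by
    intro z hz v hv
    rw [Gq_apply]
    exact hg.posdef z hz v hv

/-- real coordinate functional -/
noncomputable def rcL (a : Fin n ⊕ Fin n) : (Fin n → ℂ) →L[ℝ] ℝ :=
  match a with
  | .inl i => Complex.reCLM.comp (ContinuousLinearMap.proj i)
  | .inr i => Complex.imCLM.comp (ContinuousLinearMap.proj i)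

theorem rcL_apply (a : Fin n ⊕ Fin n) (v : Fin n → ℂ) : rcL a v = realComp v a := by
  cases a <;> simp [rcL, realComp]

theorem rc_expand (v : Fin n → ℂ) : v = ∑ a, realComp v a • bvec a := by
  ext k
  rw [Fintype.sum_sum_type]
  simp only [realComp, bvec, Pi.add_apply, Finset.sum_apply, Pi.smul_apply, Pi.single_apply]
  simp [Complex.re_add_im]

theorem rc_bvec (a b : Fin n ⊕ Fin n) : realComp (bvec a) b = if a = b then 1 else 0 := by
  cases a <;> cases b <;> simp [realComp, bvec, Pi.single_apply, apply_ite, eq_comm]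

theorem lin_expand {F : Type*} [AddCommGroup F] [Module ℝ F] {f : (Fin n → ℂ) → F}
    (hf : IsLinearMap ℝ f) (v : Fin n → ℂ) : f v = ∑ a, realComp v a • f (bvec a) := by
  conv_lhs => rw [rc_expand v]
  have : f = hf.mk' f := rfl
  rw [this, map_sum]
  simp only [map_smul]

theorem ext_b {F : Type*} [AddCommGroup F] [Module ℝ F] {f g : (Fin n → ℂ) → F}
    (hf : IsLinearMap ℝ f) (hg : IsLinearMap ℝ g) (h : ∀ a, f (bvec a) = g (bvec a))
    (v : Fin n → ℂ) : f v = g v := by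
  rw [lin_expand hf, lin_expand hg]
  simp only [h]

theorem clm_lin {F : Type*} [AddCommGroup F] [Module ℝ F] [TopologicalSpace F]
    (L : (Fin n → ℂ) →L[ℝ] F) : IsLinearMap ℝ L := ⟨map_add L, map_smul L⟩

/-- elementary bilinear map -/
noncomputable def Cabc (c a b : Fin n ⊕ Fin n) : (Fin n → ℂ) →L[ℝ] (Fin n → ℂ) →L[ℝ] (Fin n → ℂ) :=
  (rcL a).smulRight ((rcL b).smulRight (bvec c))

theorem Cabc_apply (c a b : Fin n ⊕ Fin n) (v w : Fin n → ℂ) :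
    Cabc c a b v w = (realComp v a * realComp w b) • bvec c := by
  simp [Cabc, rcL_apply, smul_smul]

/-- Christoffel operator -/
noncomputable def Gam (g : (Fin n → ℂ) → Matrix (Fin n) (Fin n) ℂ) (z : Fin n → ℂ) :
    (Fin n → ℂ) →L[ℝ] (Fin n → ℂ) →L[ℝ] (Fin n → ℂ) :=
  ∑ c, ∑ a, ∑ b, christoffelK g z c a b • Cabc c a b

theorem Gam_bvec (g : (Fin n → ℂ) → Matrix (Fin n) (Fin n) ℂ) (z : Fin n → ℂ)
    (a b : Fin n ⊕ Fin n) : Gam g z (bvec a) (bvec b) = ∑ c, christoffelK g z c a b • bvec c := by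
  simp only [Gam, sum_apply, smul_apply, Cabc_apply, rc_bvec]
  refine Finset.sum_congr rfl fun c _ => ?_
  rw [Finset.sum_eq_single a, Finset.sum_eq_single b] <;> simp +contextual [eq_comm]

theorem rc_sum (x : Fin n ⊕ Fin n → ℝ) (d : Fin n ⊕ Fin n) :
    realComp (∑ c, x c • (bvec c : Fin n → ℂ)) d = x d := by
  rw [← rcL_apply, map_sum]
  simp [rcL_apply, rc_bvec]

theorem rc_Gam (g : (Fin n → ℂ) → Matrix (Fin n) (Fin n) ℂ) (z : Fin n → ℂ)
    (a b d : Fin n ⊕ Fin n) : realComp (Gam g z (bvec a) (bvec b)) d = christoffelK g z d a b := by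
  rw [Gam_bvec, rc_sum]

end concrete

section smoothinv
variable {V : Type*} [NormedAddCommGroup V] [NormedSpace ℝ V]
variable {m : Type*} [Fintype m] [DecidableEq m]

theorem diffAt_det {A : V → Matrix m m ℝ} {x : V}
    (h : ∀ i j, DifferentiableAt ℝ (fun y => A y i j) x) :
    DifferentiableAt ℝ (fun y => (A y).det) x := by
  simp only [Matrix.det_apply]
  refine DifferentiableAt.fun_sum fun σ _ => ?_
  refine DifferentiableAt.const_smul ?_ _
  exact (HasFDerivAt.finsetProd fun i _ => (h (σ i) i).hasFDerivAt).differentiableAt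

theorem diffAt_inv {A : V → Matrix m m ℝ} {x : V}
    (h : ∀ i j, DifferentiableAt ℝ (fun y => A y i j) x) (hd : (A x).det ≠ 0) (i j : m) :
    DifferentiableAt ℝ (fun y => (A y)⁻¹ i j) x := by
  simp only [Matrix.inv_def, Matrix.smul_apply, Matrix.adjugate_apply, Ring.inverse_eq_inv', smul_eq_mul]
  refine DifferentiableAt.mul ((diffAt_det h).inv hd) (diffAt_det fun k l => ?_)
  simp only [Matrix.updateRow_apply]
  split_ifs
  · exact differentiableAt_const _
  · exact h _ _

end smoothinv

section concrete2
variable {n : ℕ} {D : Set (Fin n → ℂ)} {g : (Fin n → ℂ) → Matrix (Fin n) (Fin n) ℂ}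

theorem rm_eq (z : Fin n → ℂ) (a b : Fin n ⊕ Fin n) :
    realMetric g z a b = (Gq g z (bvec a) (bvec b)).re := by
  rw [Gq_apply]; rfl

theorem rm_symm (h : HPre D (Gq g)) {z : Fin n → ℂ} (hz : z ∈ D) (a b : Fin n ⊕ Fin n) :
    realMetric g z a b = realMetric g z b a := by
  rw [rm_eq, rm_eq, ← h.herm z hz]; simp

theorem rm_has (h : HPre D (Gq g)) {z : Fin n → ℂ} (hz : z ∈ D) (a b : Fin n ⊕ Fin n) :
    HasFDerivAt (fun w => realMetric g w a b) (Complex.reCLM.comp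
      ((((ContinuousLinearMap.apply ℝ ℂ (bvec b)).comp
        (ContinuousLinearMap.apply ℝ ((Fin n → ℂ) →L[ℝ] ℂ) (bvec a)))).comp
        (fderiv ℝ (Gq g) z))) z := by
  simp only [rm_eq]
  exact Complex.reCLM.hasFDerivAt.comp z (h.hasF hz (bvec a) (bvec b))

theorem rpd_rm (h : HPre D (Gq g)) {z : Fin n → ℂ} (hz : z ∈ D) (a b c : Fin n ⊕ Fin n) :
    rpd (fun w => realMetric g w a b) z c = (fderiv ℝ (Gq g) z (bvec c) (bvec a) (bvec b)).re := by
  unfold rpd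
  rw [(rm_has h hz a b).fderiv]
  rfl

theorem rm_det (h : HPre D (Gq g)) {z : Fin n → ℂ} (hz : z ∈ D) : (realMetric g z).det ≠ 0 := by
  intro h0
  obtain ⟨x, hx, hx0⟩ := Matrix.exists_mulVec_eq_zero_iff.2 h0
  set v : Fin n → ℂ := ∑ c, x c • bvec c with hv
  have hv0 : v ≠ 0 := by
    intro h1
    apply hx
    funext d
    rw [← rc_sum x d, ← hv, h1, ← rcL_apply]; simp
  have hp := h.pos z hz v hv0
  have : (Gq g z v v).re = ∑ a, x a * (Matrix.mulVec (realMetric g z) x) a := by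
    rw [hv]
    rw [map_sum, Complex.re_sum]
    refine Finset.sum_congr rfl fun i _ => ?_
    rw [map_smul, Complex.real_smul, Complex.re_ofReal_mul, map_sum, sum_apply, Complex.re_sum]
    congr 1
    simp only [Matrix.mulVec, dotProduct]
    refine Finset.sum_congr rfl fun j _ => ?_
    rw [map_smul, smul_apply, Complex.real_smul, Complex.re_ofReal_mul, rm_symm h hz, rm_eq, mul_comm]
  rw [this, hx0] at hp
  simp at hp

/-- Koszul -/
theorem koszul (h : HPre D (Gq g)) {z : Fin n → ℂ} (hz : z ∈ D) (a b d : Fin n → ℂ) :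
    (Gq g z (Gam g z a b) d).re = (1 / 2) * ((fderiv ℝ (Gq g) z a d b).re +
      (fderiv ℝ (Gq g) z b a d).re - (fderiv ℝ (Gq g) z d a b).re) := by
  have base : ∀ a b d : Fin n ⊕ Fin n, (Gq g z (Gam g z (bvec a) (bvec b)) (bvec d)).re =
      (1 / 2) * ((fderiv ℝ (Gq g) z (bvec a) (bvec d) (bvec b)).re +
      (fderiv ℝ (Gq g) z (bvec b) (bvec a) (bvec d)).re -
      (fderiv ℝ (Gq g) z (bvec d) (bvec a) (bvec b)).re) := by
    intro a b d
    have e1 : (Gq g z (Gam g z (bvec a) (bvec b)) (bvec d)).re =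
        ∑ c, realMetric g z d c * christoffelK g z c a b := by
      rw [Gam_bvec]
      simp only [map_sum, map_smul, sum_apply, smul_apply, Complex.re_sum]
      refine Finset.sum_congr rfl fun c _ => ?_
      rw [rm_symm h hz, rm_eq]; simp; ring
    rw [e1]
    unfold christoffelK
    have e2 : ∀ T : Fin n ⊕ Fin n → ℝ, ∑ c, realMetric g z d c * ((1/2) * ∑ e, (realMetric g z)⁻¹ c e * T e)
        = (1/2) * T d := by
      intro T
      have hu : IsUnit (realMetric g z).det := (rm_det h hz).isUnit
      have : Matrix.mulVec (realMetric g z) (Matrix.mulVec (realMetric g z)⁻¹ T) = T := by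
        rw [Matrix.mulVec_mulVec, Matrix.mul_nonsing_inv _ hu, Matrix.one_mulVec]
      have h2 := congrFun this d
      simp only [Matrix.mulVec, dotProduct] at h2
      rw [← h2, Finset.mul_sum]
      refine Finset.sum_congr rfl fun c _ => ?_
      ring
    rw [e2 (fun e => rpd (fun w => realMetric g w e b) z a + rpd (fun w => realMetric g w a e) z b
      - rpd (fun w => realMetric g w a b) z e)]
    rw [rpd_rm h hz, rpd_rm h hz, rpd_rm h hz]
  refine ext_b (f := fun d => (Gq g z (Gam g z a b) d).re) (g := fun d => (1 / 2) * ((fderiv ℝ (Gq g) z a d b).re +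
      (fderiv ℝ (Gq g) z b a d).re - (fderiv ℝ (Gq g) z d a b).re)) 
      ⟨by intros; simp, by intros; simp⟩ ⟨by intros; simp; ring, by intros; simp; ring⟩ (fun d => ?_) d
  refine ext_b (f := fun b => (Gq g z (Gam g z a b) (bvec d)).re) (g := fun b => (1 / 2) * ((fderiv ℝ (Gq g) z a (bvec d) b).re +
      (fderiv ℝ (Gq g) z b a (bvec d)).re - (fderiv ℝ (Gq g) z (bvec d) a b).re)) 
      ⟨by intros; simp, by intros; simp⟩ ⟨by intros; simp; ring, by intros; simp; ring⟩ (fun b => ?_) b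
  exact ext_b (f := fun a => (Gq g z (Gam g z a (bvec b)) (bvec d)).re) (g := fun a => (1 / 2) * ((fderiv ℝ (Gq g) z a (bvec d) (bvec b)).re +
      (fderiv ℝ (Gq g) z (bvec b) a (bvec d)).re - (fderiv ℝ (Gq g) z (bvec d) a (bvec b)).re)) 
      ⟨by intros; simp, by intros; simp⟩ ⟨by intros; simp; ring, by intros; simp; ring⟩ (fun a => base a b d) a

theorem fderiv_Gq (hopen : IsOpen D) (hg : IsHermitianMetricOn D g) {z : Fin n → ℂ} (hz : z ∈ D)
    (a v w : Fin n → ℂ) : fderiv ℝ (Gq g) z a v w =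
      ∑ i, ∑ j, fderiv ℝ (fun y => g y i j) z a * v i * (starRingEnd ℂ) (w j) := by
  have hd : ∀ i j, HasFDerivAt (fun y => g y i j) (fderiv ℝ (fun y => g y i j) z) z := fun i j =>
    (((hg.smooth i j).contDiffAt (hopen.mem_nhds hz)).differentiableAt (by simp)).hasFDerivAt
  have h1 : HasFDerivAt (Gq g) (∑ i, ∑ j, (LBij i j).comp (fderiv ℝ (fun y => g y i j) z)) z := by
    unfold Gq
    refine HasFDerivAt.fun_sum fun i _ => HasFDerivAt.fun_sum fun j _ => ?_
    exact (LBij i j).hasFDerivAt.comp z (hd i j)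
  rw [h1.fderiv]
  simp only [sum_apply, ContinuousLinearMap.comp_apply, LBij_apply]

theorem wlin (L : (Fin n → ℂ) →L[ℝ] ℂ) (a : Fin n → ℂ) :
    (1 / 2) * (L a - Complex.I * L (Complex.I • a)) = ∑ k, (1 / 2) * (L (Pi.single k 1) -
      Complex.I * L (Pi.single k Complex.I)) * a k := by
  have e0 : ∀ (k : Fin n) (c : ℂ), L (Pi.single k c) = c.re * L (Pi.single k 1) + c.im * L (Pi.single k Complex.I) := by
    intro k c
    have : (Pi.single k c : Fin n → ℂ) = c.re • (Pi.single k (1:ℂ) : Fin n → ℂ) + c.im • (Pi.single k Complex.I : Fin n → ℂ) := by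
      rw [← Pi.single_smul, ← Pi.single_smul, ← Pi.single_add]
      simp
    rw [this, map_add, map_smul, map_smul]; simp
  have e1 : ∀ a : Fin n → ℂ, L a = ∑ k, L (Pi.single k (a k)) := by
    intro a
    rw [← map_sum, Finset.univ_sum_single]
  rw [e1 a, e1 (Complex.I • a), Finset.mul_sum, ← Finset.sum_sub_distrib, Finset.mul_sum]
  refine Finset.sum_congr rfl fun k _ => ?_
  rw [e0 k (a k), e0 k ((Complex.I • a) k)]
  have : a k = (a k).re + (a k).im * Complex.I := (Complex.re_add_im _).symm
  simp only [Pi.smul_apply, smul_eq_mul, Complex.mul_re, Complex.mul_im, Complex.I_re, Complex.I_im]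
  conv_rhs => rw [this]
  push_cast
  linear_combination (1/2) * L (Pi.single k Complex.I) * (a k).im * Complex.I_mul_I

theorem Pq_eq (hopen : IsOpen D) (hg : IsHermitianMetricOn D g) {z : Fin n → ℂ} (hz : z ∈ D)
    (a v w : Fin n → ℂ) : Pq (Gq g) z a v w =
      ∑ j, ∑ i, ∑ k, wDeriv (fun y => g y i j) z k * a k * v i * (starRingEnd ℂ) (w j) := by
  unfold Pq wDeriv
  rw [fderiv_Gq hopen hg hz, fderiv_Gq hopen hg hz, Finset.sum_comm, Finset.sum_comm (s := Finset.univ)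
    (f := fun i j => fderiv ℝ (fun y => g y i j) z (Complex.I • a) * v i * (starRingEnd ℂ) (w j)),
    Finset.mul_sum, ← Finset.sum_sub_distrib, Finset.mul_sum]
  refine Finset.sum_congr rfl fun j _ => ?_
  rw [Finset.mul_sum, ← Finset.sum_sub_distrib, Finset.mul_sum]
  refine Finset.sum_congr rfl fun i _ => ?_
  have := wlin (fderiv ℝ (fun y => g y i j) z) a
  rw [← Finset.sum_mul, ← Finset.sum_mul, ← this]
  ring

theorem kah_Gq (hopen : IsOpen D) (hg : IsKahlerMetricOn D g) {z : Fin n → ℂ} (hz : z ∈ D)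
    (a v w : Fin n → ℂ) : Pq (Gq g) z a v w = Pq (Gq g) z v a w := by
  rw [Pq_eq hopen hg.toIsHermitianMetricOn hz, Pq_eq hopen hg.toIsHermitianMetricOn hz]
  refine Finset.sum_congr rfl fun j _ => ?_
  rw [Finset.sum_comm]
  refine Finset.sum_congr rfl fun i _ => Finset.sum_congr rfl fun k _ => ?_
  rw [hg.kahler z hz k j i]; ring

theorem gam_Gq (hopen : IsOpen D) (hg : IsKahlerMetricOn D g) {z : Fin n → ℂ} (hz : z ∈ D)
    (a b d : Fin n → ℂ) : Gq g z (Gam g z a b) d = Pq (Gq g) z a b d := by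
  have h := hPre_Gq hopen hg.toIsHermitianMetricOn
  have hre : ∀ d, (Gq g z (Gam g z a b) d).re = (Pq (Gq g) z a b d).re := by
    intro d
    rw [koszul h hz]
    have Pre : ∀ a b d, (Pq (Gq g) z a b d).re = (1/2) * ((fderiv ℝ (Gq g) z a b d).re +
        (fderiv ℝ (Gq g) z (Complex.I • a) b d).im) := by
      intro a b d
      unfold Pq
      have : (1 / 2 : ℂ) = ((1 / 2 : ℝ) : ℂ) := by norm_num
      rw [this, Complex.re_ofReal_mul]; simp
    have dre : ∀ a v w, (fderiv ℝ (Gq g) z a v w).re = (fderiv ℝ (Gq g) z a w v).re := by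
      intro a v w; rw [← h.dherm hz]; simp
    have dim : ∀ a v w, (fderiv ℝ (Gq g) z a v w).im = - (fderiv ℝ (Gq g) z a w v).im := by
      intro a v w; rw [← h.dherm hz]; simp
    have k1 := congrArg Complex.re (kah_Gq hopen hg hz a b d)
    have k2 := congrArg Complex.re (kah_Gq hopen hg hz b d a)
    have k3 := congrArg Complex.re (kah_Gq hopen hg hz d a b)
    rw [Pre, Pre] at k1 k2 k3
    rw [Pre]
    have := dre a b d
    have := dre b a d
    have := dre d a b
    have := dim (Complex.I • a) b d
    have := dim (Complex.I • b) a d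
    have := dim (Complex.I • d) a b
    linarith
  apply Complex.ext (hre d)
  have h1 := hre (Complex.I • d)
  have h2 : Pq (Gq g) z a b (Complex.I • d) = - Complex.I * Pq (Gq g) z a b d := by
    unfold Pq; rw [h.dlinR hz, h.dlinR hz]; ring
  rw [h.linR hz, h2] at h1
  simpa using h1

theorem gamd_Gq (hopen : IsOpen D) (hg : IsKahlerMetricOn D g) : DifferentiableOn ℝ (Gam g) D := by
  have h := hPre_Gq hopen hg.toIsHermitianMetricOn
  intro z hz
  apply DifferentiableAt.differentiableWithinAt
  unfold Gam
  refine DifferentiableAt.fun_sum fun c _ => DifferentiableAt.fun_sum fun a _ =>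
    DifferentiableAt.fun_sum fun b _ => DifferentiableAt.smul_const ?_ _
  unfold christoffelK
  refine DifferentiableAt.const_mul (DifferentiableAt.fun_sum fun d _ => DifferentiableAt.mul ?_ ?_) _
  · exact diffAt_inv (fun i j => (rm_has h hz i j).differentiableAt) (rm_det h hz) c d
  · have gen : ∀ a b c, DifferentiableAt ℝ (fun y => rpd (fun w => realMetric g w a b) y c) z := by
      intro a b c
      have h1 : (fun y => rpd (fun w => realMetric g w a b) y c) =ᶠ[𝓝 z]
          fun y => (fderiv ℝ (Gq g) y (bvec c) (bvec a) (bvec b)).re := by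
        filter_upwards [hopen.mem_nhds hz] with y hy
        exact rpd_rm h hy a b c
      refine DifferentiableAt.congr_of_eventuallyEq ?_ h1
      exact (Complex.reCLM.hasFDerivAt.comp z (h.hasF2 hz (bvec c) (bvec a) (bvec b))).differentiableAt
    exact ((gen _ _ _).add (gen _ _ _)).sub (gen _ _ _)

theorem kPre_Gq (hopen : IsOpen D) (hg : IsKahlerMetricOn D g) : KPre D (Gq g) (Gam g) where
  toHPre := hPre_Gq hopen hg.toIsHermitianMetricOn
  kah := fun _ hz a v w => kah_Gq hopen hg hz a v w
  gam := fun _ hz a v w => gam_Gq hopen hg hz a v w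
  gamd := gamd_Gq hopen hg

end concrete2

section concrete3
variable {n : ℕ} {D : Set (Fin n → ℂ)} {g : (Fin n → ℂ) → Matrix (Fin n) (Fin n) ℂ}

theorem rpd_chr (h : KPre D (Gq g) (Gam g)) {z : Fin n → ℂ} (hz : z ∈ D) (a b c d : Fin n ⊕ Fin n) :
    rpd (fun w => christoffelK g w d b c) z a =
      realComp (fderiv ℝ (Gam g) z (bvec a) (bvec b) (bvec c)) d := by
  have hΓ : HasFDerivAt (Gam g) (fderiv ℝ (Gam g) z) z :=
    (h.gamd.differentiableAt (h.isOpen.mem_nhds hz)).hasFDerivAt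
  have h0 : HasFDerivAt (fun y => rcL d (Gam g y (bvec b) (bvec c)))
      ((((rcL d).comp (ContinuousLinearMap.apply ℝ (Fin n → ℂ) (bvec c))).comp
        (ContinuousLinearMap.apply ℝ ((Fin n → ℂ) →L[ℝ] (Fin n → ℂ)) (bvec b))).comp
        (fderiv ℝ (Gam g) z)) z :=
    ((((rcL d).comp (ContinuousLinearMap.apply ℝ (Fin n → ℂ) (bvec c))).comp
        (ContinuousLinearMap.apply ℝ ((Fin n → ℂ) →L[ℝ] (Fin n → ℂ)) (bvec b))).hasFDerivAt).comp z hΓ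
  simp only [rcL_apply, rc_Gam] at h0
  unfold rpd
  rw [h0.fderiv, ← rcL_apply]
  rfl

theorem riem_eq (h : KPre D (Gq g) (Gam g)) {z : Fin n → ℂ} (hz : z ∈ D) (a b c d : Fin n ⊕ Fin n) :
    riemCurvK g z d c a b = realComp (KPre.Rv (Gam g) z (bvec a) (bvec b) (bvec c)) d := by
  unfold riemCurvK KPre.Rv
  rw [rpd_chr h hz, rpd_chr h hz, Gam_bvec, Gam_bvec, ← rcL_apply, ← rcL_apply, ← rcL_apply]
  simp only [map_add, map_sub, map_sum, map_smul, smul_eq_mul]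
  rw [← Finset.sum_sub_distrib]
  congr 1
  refine Finset.sum_congr rfl fun e _ => ?_
  rw [rcL_apply, rcL_apply, rc_Gam, rc_Gam]

theorem num_eq (h : KPre D (Gq g) (Gam g)) {z : Fin n → ℂ} (hz : z ∈ D) (u v : Fin n → ℂ) :
    (∑ a, ∑ b, ∑ c, ∑ e, realComp u a * realComp v b * realComp v c * realComp u e *
      ∑ d, realMetric g z e d * riemCurvK g z d c a b) = (Gq g z (KPre.Rv (Gam g) z u v v) u).re := by
  have e1 : ∀ a b c e, ∑ d, realMetric g z e d * riemCurvK g z d c a b =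
      (Gq g z (KPre.Rv (Gam g) z (bvec a) (bvec b) (bvec c)) (bvec e)).re := by
    intro a b c e
    set X := KPre.Rv (Gam g) z (bvec a) (bvec b) (bvec c) with hX
    rw [lin_expand (f := fun X => (Gq g z X (bvec e)).re) ⟨by intros; simp, by intros; simp⟩ X]
    refine Finset.sum_congr rfl fun d _ => ?_
    rw [riem_eq h hz, rm_symm h.toHPre hz, rm_eq, smul_eq_mul, mul_comm]
  simp only [e1]
  rw [lin_expand (f := fun a => (Gq g z (KPre.Rv (Gam g) z a v v) u).re)
    ⟨by intros; simp [KPre.Rv]; ring, by intros; simp [KPre.Rv]; ring⟩ u]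
  refine Finset.sum_congr rfl fun a _ => ?_
  rw [lin_expand (f := fun b => (Gq g z (KPre.Rv (Gam g) z (bvec a) b v) u).re)
    ⟨by intros; simp [KPre.Rv]; ring, by intros; simp [KPre.Rv]; ring⟩ v, Finset.smul_sum]
  refine Finset.sum_congr rfl fun b _ => ?_
  rw [lin_expand (f := fun c => (Gq g z (KPre.Rv (Gam g) z (bvec a) (bvec b) c) u).re)
    ⟨by intros; simp [KPre.Rv]; ring, by intros; simp [KPre.Rv]; ring⟩ v, Finset.smul_sum, Finset.smul_sum]
  refine Finset.sum_congr rfl fun c _ => ?_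
  rw [lin_expand (f := fun e => (Gq g z (KPre.Rv (Gam g) z (bvec a) (bvec b) (bvec c)) e).re)
    ⟨by intros; simp, by intros; simp⟩ u, Finset.smul_sum, Finset.smul_sum, Finset.smul_sum]
  refine Finset.sum_congr rfl fun e _ => ?_
  simp only [smul_eq_mul]; ring

theorem sec_num (h : KPre D (Gq g) (Gam g)) {c₁ c₂ : ℝ} (hc₁ : 0 < c₁)
    (hsec : ∀ z ∈ D, ∀ u v : Fin n → ℂ, LinearIndependent ℝ ![u, v] →
      -c₂ ≤ secCurvK g z u v ∧ secCurvK g z u v ≤ -c₁) {z : Fin n → ℂ} (hz : z ∈ D) (u v : Fin n → ℂ) :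
    let den := Nq (Gq g) z u * Nq (Gq g) z v - ((Gq g z u v).re) ^ 2
    0 ≤ den ∧ - c₂ * den ≤ (Gq g z (KPre.Rv (Gam g) z u v v) u).re ∧
      (Gq g z (KPre.Rv (Gam g) z u v v) u).re ≤ - c₁ * den := by
  intro den
  have hden : 0 ≤ den := by
    have := h.cs hz u v
    rw [Complex.normSq_apply] at this
    simp only [den]; nlinarith [mul_self_nonneg (Gq g z u v).im]
  refine ⟨hden, ?_⟩
  by_cases hli : LinearIndependent ℝ ![u, v]
  · have h1 := hsec z hz u v hli
    have e : secCurvK g z u v = (Gq g z (KPre.Rv (Gam g) z u v v) u).re / den := by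
      unfold secCurvK
      rw [num_eq h hz, ← Gq_apply, ← Gq_apply, ← Gq_apply]; rfl
    rw [e] at h1
    have hd : den ≠ 0 := by
      intro h0
      rw [h0, div_zero] at h1
      linarith
    have hd' : 0 < den := lt_of_le_of_ne hden hd.symm
    rw [le_div_iff₀ hd', div_le_iff₀ hd'] at h1
    exact h1
  · have : ∃ t : ℝ, (u = 0) ∨ v = t • u := by
      by_cases hu : u = 0
      · exact ⟨0, Or.inl hu⟩
      · rw [LinearIndependent.pair_iff' hu] at hli
        push Not at hli
        obtain ⟨t, ht⟩ := hli
        exact ⟨t, Or.inr ht.symm⟩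
    obtain ⟨t, ht | ht⟩ := this
    · have e1 : den = 0 := by simp [den, ht, Nq]
      rw [e1, ht]; simp
    · have e1 : den = 0 := by simp [den, ht, Nq]; ring
      have e2 : KPre.Rv (Gam g) z u v v = 0 := by
        rw [ht]; simp [KPre.Rv]
      rw [e1, e2]; simp

theorem kData_Gq (hopen : IsOpen D) (hg : IsKahlerMetricOn D g) {c₁ c₂ : ℝ} (hc₁ : 0 < c₁) (hc₁₂ : c₁ ≤ c₂)
    (hsec : ∀ z ∈ D, ∀ u v : Fin n → ℂ, LinearIndependent ℝ ![u, v] →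
      -c₂ ≤ secCurvK g z u v ∧ secCurvK g z u v ≤ -c₁) :
    KData D (Gq g) (Gam g) (c₁ / 2) c₂ where
  toKPre := kPre_Gq hopen hg
  low := by
    intro z hz u a
    have h := kPre_Gq hopen hg
    have h1 := sec_num h hc₁ hsec hz u a
    have h2 := sec_num h hc₁ hsec hz u (Complex.I • a)
    have h3 := h.two_Rc hz u a
    have eN : Nq (Gq g) z (Complex.I • a) = Nq (Gq g) z a := by
      unfold Nq; rw [h.lin, h.linR hz]; simp
    simp only [eN] at h1 h2
    obtain ⟨h11, h12, h13⟩ := h1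
    obtain ⟨h21, h22, h23⟩ := h2
    nlinarith [sq_nonneg (Gq g z u a).re, sq_nonneg (Gq g z u (Complex.I • a)).re]
  upp := by
    intro z hz u
    have h := kPre_Gq hopen hg
    have h1 := sec_num h hc₁ hsec hz u u
    have h2 := sec_num h hc₁ hsec hz u (Complex.I • u)
    have h3 := h.two_Rc hz u u
    have eN : Nq (Gq g) z (Complex.I • u) = Nq (Gq g) z u := by
      unfold Nq; rw [h.lin, h.linR hz]; simp
    have e0 : KPre.Rv (Gam g) z u u u = 0 := by simp [KPre.Rv]
    have e1 : (Gq g z u (Complex.I • u)).re = 0 := by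
      rw [h.linR hz, h.G_self hz]; simp
    simp only [eN] at h1 h2
    obtain ⟨h11, h12, h13⟩ := h1
    obtain ⟨h21, h22, h23⟩ := h2
    rw [e0] at h3
    rw [e1] at h23
    simp at h3
    nlinarith

end concrete3

section regularity
variable {E : Type*} [NormedAddCommGroup E] [NormedSpace ℂ E]

theorem slice_hasDeriv {f : E → ℂ} {y w : E} {s : ℂ} (hf : DifferentiableAt ℂ f (y + s • w)) :
    HasDerivAt (fun s : ℂ => f (y + s • w)) (fderiv ℂ f (y + s • w) w) s := by
  have h1 : HasDerivAt (fun s : ℂ => y + s • w) w s := by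
    simpa using ((hasDerivAt_id s).smul_const w).const_add y
  exact hf.hasFDerivAt.comp_hasDerivAt s h1

theorem cauchy_fderiv {f : E → ℂ} {D : Set E} (hD : IsOpen D) (hf : DifferentiableOn ℂ f D) {y : E} {R C : ℝ}
    (hR : 0 < R) (hsub : closedBall y R ⊆ D) (hC : ∀ z ∈ closedBall y R, ‖f z‖ ≤ C) :
    ‖fderiv ℂ f y‖ ≤ C / R := by
  have hC0 : 0 ≤ C := (norm_nonneg _).trans (hC y (mem_closedBall_self hR.le))
  refine ContinuousLinearMap.opNorm_le_bound _ (by positivity) fun w => ?_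
  by_cases hw : w = 0
  · simp [hw]
  have hw' : 0 < ‖w‖ := norm_pos_iff.2 hw
  have hmem : ∀ s : ℂ, ‖s‖ ≤ R / ‖w‖ → y + s • w ∈ closedBall y R := by
    intro s hs
    rw [mem_closedBall, dist_eq_norm, add_sub_cancel_left, norm_smul]
    exact (le_div_iff₀ hw').1 hs
  have hd : ∀ s : ℂ, ‖s‖ ≤ R / ‖w‖ → HasDerivAt (fun s : ℂ => f (y + s • w)) (fderiv ℂ f (y + s • w) w) s :=
    fun s hs => slice_hasDeriv (hf.differentiableAt (hD.mem_nhds (hsub (hmem s hs))))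
  have h0 := hd 0 (by simp; positivity)
  have h1 := Complex.norm_deriv_le_of_forall_mem_sphere_norm_le (c := 0) (R := R / ‖w‖) (C := C)
    (f := fun s : ℂ => f (y + s • w)) (by positivity)
    (DifferentiableOn.diffContOnCl_ball (U := closedBall 0 (R / ‖w‖))
      (fun s hs => (hd s (by simpa using hs)).differentiableAt.differentiableWithinAt) (fun x hx => hx))
    (fun s hs => hC _ (hmem s (by simpa using (mem_sphere_zero_iff_norm.1 hs).le)))
  rw [h0.deriv] at h1
  simp only [zero_smul, add_zero] at h1
  refine h1.trans (le_of_eq ?_)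
  field_simp

theorem diffOn_dir [FiniteDimensional ℂ E] {f : E → ℂ} {D : Set E} (hD : IsOpen D)
    (hf : DifferentiableOn ℂ f D) (v : E) : DifferentiableOn ℂ (fun x => fderiv ℂ f x v) D := by
  intro x0 hx0
  apply DifferentiableAt.differentiableWithinAt
  have : ProperSpace E := FiniteDimensional.proper ℂ E
  obtain ⟨R', hR', hsub'⟩ := Metric.nhds_basis_closedBall.mem_iff.1 (hD.mem_nhds hx0)
  obtain ⟨R, hR, hR3⟩ : ∃ R : ℝ, 0 < R ∧ 3 * R = R' := ⟨R' / 3, by positivity, by ring⟩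
  subst hR3
  obtain ⟨r, hr, hrv⟩ : ∃ r : ℝ, 0 < r ∧ r * ‖v‖ ≤ R := by
    refine ⟨R / (1 + ‖v‖), by positivity, ?_⟩
    rw [div_mul_eq_mul_div, div_le_iff₀ (by positivity)]
    nlinarith [norm_nonneg v]
  obtain ⟨C, hC⟩ := (isCompact_closedBall x0 (3 * R)).exists_bound_of_continuousOn (hf.continuousOn.mono hsub')
  have hfd : ∀ y ∈ closedBall x0 (2 * R), ‖fderiv ℂ f y‖ ≤ C / R := by
    intro y hy
    have : closedBall y R ⊆ closedBall x0 (3 * R) := by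
      apply closedBall_subset_closedBall'
      rw [mem_closedBall] at hy; linarith
    exact cauchy_fderiv hD hf hR (this.trans hsub') fun z hz => hC z (this hz)
  have hin : ∀ x ∈ ball x0 R, ∀ s : ℂ, ‖s‖ ≤ r → x + s • v ∈ closedBall x0 (2 * R) := by
    intro x hx s hs
    rw [mem_closedBall, dist_eq_norm]
    rw [mem_ball, dist_eq_norm] at hx
    calc ‖x + s • v - x0‖ = ‖(x - x0) + s • v‖ := by congr 1; abel
      _ ≤ ‖x - x0‖ + ‖s‖ * ‖v‖ := by rw [← norm_smul]; exact norm_add_le _ _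
      _ ≤ 2 * R := by nlinarith [norm_nonneg v]
  have hsub2 : closedBall x0 (2 * R) ⊆ D := (closedBall_subset_closedBall (by linarith)).trans hsub'
  have hfa : ∀ x ∈ ball x0 R, ∀ s : ℂ, ‖s‖ ≤ r → DifferentiableAt ℂ f (x + s • v) :=
    fun x hx s hs => hf.differentiableAt (hD.mem_nhds (hsub2 (hin x hx s hs)))
  have hcm : ∀ θ, ‖circleMap 0 r θ‖ ≤ r := fun θ => by simp [abs_of_pos hr]
  -- Cauchy formula
  have hform : ∀ x ∈ ball x0 R, fderiv ℂ f x v = (2 * Real.pi * Complex.I)⁻¹ *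
      ∫ θ in (0:ℝ)..2 * Real.pi, deriv (circleMap 0 r) θ • ((1 / (circleMap 0 r θ - 0) ^ 2) •
        f (x + circleMap 0 r θ • v)) := by
    intro x hx
    have h1 := DiffContOnCl.circleIntegral_one_div_sub_center_pow_smul (c := 0) (R := r) (f := fun s : ℂ => f (x + s • v)) hr 1
      (DifferentiableOn.diffContOnCl_ball (U := closedBall 0 r)
      (fun s hs => (slice_hasDeriv (hfa x hx s (by simpa using hs))).differentiableAt.differentiableWithinAt) (fun x hx => hx))
    have h0 := (slice_hasDeriv (hfa x hx 0 (by simpa using hr.le))).deriv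
    simp only [iteratedDeriv_one, zero_smul, add_zero] at h1 h0
    rw [h0] at h1
    unfold circleIntegral at h1
    have hpi : (2 * Real.pi * Complex.I : ℂ) ≠ 0 := by simp [Real.pi_ne_zero]
    rw [eq_inv_mul_iff_mul_eq₀ hpi]
    rw [show (1 + 1 : ℕ) = 2 from rfl] at h1
    rw [h1]; simp
  have hcirc : Continuous fun θ : ℝ => deriv (circleMap 0 r) θ := by
    simp only [deriv_circleMap]; fun_prop
  have hcirc2 : Continuous fun θ : ℝ => (1 / (circleMap 0 r θ - 0) ^ 2) := by
    refine continuous_const.div (by fun_prop) fun θ => ?_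
    simp [hr.ne']
  have hintg : HasFDerivAt (fun x => ∫ θ in (0:ℝ)..2 * Real.pi, deriv (circleMap 0 r) θ • ((1 / (circleMap 0 r θ - 0) ^ 2) •
        f (x + circleMap 0 r θ • v))) (∫ θ in (0:ℝ)..2 * Real.pi, deriv (circleMap 0 r) θ • ((1 / (circleMap 0 r θ - 0) ^ 2) •
        fderiv ℂ f (x0 + circleMap 0 r θ • v))) x0 := by
    have hcont : ∀ x ∈ ball x0 R, Continuous fun θ => deriv (circleMap 0 r) θ • ((1 / (circleMap 0 r θ - 0) ^ 2) •
        f (x + circleMap 0 r θ • v)) := by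
      intro x hx
      refine hcirc.smul (hcirc2.smul ?_)
      refine continuous_iff_continuousAt.2 fun θ => ?_
      exact ContinuousAt.comp (f := fun θ => x + circleMap 0 r θ • v) (hfa x hx _ (hcm θ)).continuousAt (by fun_prop)
    refine intervalIntegral.hasFDerivAt_integral_of_dominated_of_fderiv_le (𝕜 := ℂ)
      (F := fun x θ => deriv (circleMap 0 r) θ • ((1 / (circleMap 0 r θ - 0) ^ 2) •
        f (x + circleMap 0 r θ • v)))
      (F' := fun x θ => deriv (circleMap 0 r) θ • ((1 / (circleMap 0 r θ - 0) ^ 2) •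
        fderiv ℂ f (x + circleMap 0 r θ • v)))
      (bound := fun θ => ‖deriv (circleMap 0 r) θ‖ * (‖1 / (circleMap 0 r θ - 0) ^ 2‖ * (C / R)))
      (ball_mem_nhds x0 hR) ?_ ?_ ?_ ?_ ?_ ?_
    · filter_upwards [ball_mem_nhds x0 hR] with x hx
      exact (hcont x hx).aestronglyMeasurable
    · exact (hcont x0 (mem_ball_self hR)).intervalIntegrable _ _
    · borelize E
      have hm : Measurable (fun θ : ℝ => fderiv ℂ f (x0 + circleMap 0 r θ • v)) :=
        (measurable_fderiv ℂ f).comp (by fun_prop : Continuous fun θ : ℝ => x0 + circleMap 0 r θ • v).measurable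
      have : SecondCountableTopology (E →L[ℂ] ℂ) := by
        have : FiniteDimensional ℂ (E →L[ℂ] ℂ) := inferInstance
        have : ProperSpace (E →L[ℂ] ℂ) := FiniteDimensional.proper ℂ _
        infer_instance
      exact hcirc.aestronglyMeasurable.smul (hcirc2.aestronglyMeasurable.smul hm.aestronglyMeasurable)
    · refine Eventually.of_forall fun θ _ x hx => ?_
      rw [norm_smul, norm_smul]
      gcongr
      exact hfd _ (hin x hx _ (hcm θ))
    · exact Continuous.intervalIntegrable (by fun_prop) _ _
    · refine Eventually.of_forall fun θ _ x hx => ?_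
      have h3 := (hfa x hx _ (hcm θ)).hasFDerivAt.comp x ((hasFDerivAt_id x).add_const (circleMap 0 r θ • v))
      have h4 := (h3.const_smul (1 / (circleMap 0 r θ - 0) ^ 2)).const_smul (deriv (circleMap 0 r) θ)
      exact h4
  have h2 := (hintg.const_mul ((2 * Real.pi * Complex.I)⁻¹ : ℂ)).differentiableAt
  refine h2.congr_of_eventuallyEq ?_
  filter_upwards [ball_mem_nhds x0 hR] with x hx
  exact hform x hx

theorem hol_contDiffOn [FiniteDimensional ℂ E] {D : Set E} (hD : IsOpen D) (n : ℕ) : ∀ {f : E → ℂ}, 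
    DifferentiableOn ℂ f D → ContDiffOn ℂ n f D := by
  induction n with
  | zero => intro f hf; exact contDiffOn_zero.2 hf.continuousOn
  | succ n ih =>
    intro f hf
    push_cast
    rw [contDiffOn_succ_iff_fderiv_of_isOpen hD]
    refine ⟨hf, by simp, ?_⟩
    rw [contDiffOn_clm_apply]
    exact fun y => ih (diffOn_dir hD hf y)

end regularity

section paths
variable {E : Type*} [NormedAddCommGroup E] [NormedSpace ℂ E] [NormedSpace ℝ E]
  [IsScalarTower ℝ ℂ E]
variable {D : Set E} {G : E → E →L[ℝ] E →L[ℝ] ℂ} {Γ : E → E →L[ℝ] E →L[ℝ] E}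

/-- C1 paths in `D` with their velocity -/
structure IsPath (D : Set E) (γ δ : ℝ → E) : Prop where
  mem : ∀ t ∈ Icc (0:ℝ) 1, γ t ∈ D
  der : ∀ t ∈ Icc (0:ℝ) 1, HasDerivWithinAt γ (δ t) (Icc 0 1) t
  cont : ContinuousOn δ (Icc 0 1)

/-- speed -/
noncomputable def spd (G : E → E →L[ℝ] E →L[ℝ] ℂ) (γ δ : ℝ → E) (t : ℝ) : ℝ :=
  Real.sqrt (Nq G (γ t) (δ t))

/-- abstract Riemannian distance -/
noncomputable def dK (D : Set E) (G : E → E →L[ℝ] E →L[ℝ] ℂ) (x y : E) : ℝ :=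
  sInf {L : ℝ | ∃ γ δ : ℝ → E, IsPath D γ δ ∧ γ 0 = x ∧ γ 1 = y ∧ L = ∫ t in (0:ℝ)..1, spd G γ δ t}

theorem HPre.contN (h : HPre D G) : ContinuousOn (fun p : E × E => Nq G p.1 p.2) (D ×ˢ univ) := by
  have h1 : ContinuousOn (fun p : E × E => G p.1) (D ×ˢ univ) :=
    h.smooth.continuousOn.comp continuousOn_fst (fun p hp => hp.1)
  unfold Nq
  exact Complex.continuous_re.comp_continuousOn
    ((h1.clm_apply continuousOn_snd).clm_apply continuousOn_snd)

theorem IsPath.contγ {γ δ : ℝ → E} (hp : IsPath D γ δ) : ContinuousOn γ (Icc 0 1) :=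
  fun t ht => (hp.der t ht).continuousWithinAt

theorem HPre.contNpath (h : HPre D G) {γ δ : ℝ → E} (hp : IsPath D γ δ) :
    ContinuousOn (fun t => Nq G (γ t) (δ t)) (Icc 0 1) :=
  h.contN.comp (hp.contγ.prodMk hp.cont) (fun t ht => ⟨hp.mem t ht, mem_univ _⟩)

theorem HPre.contSpd (h : HPre D G) {γ δ : ℝ → E} (hp : IsPath D γ δ) :
    ContinuousOn (spd G γ δ) (Icc 0 1) :=
  Real.continuous_sqrt.comp_continuousOn (h.contNpath hp)

theorem spd_nonneg (γ δ : ℝ → E) (t : ℝ) : 0 ≤ spd G γ δ t := Real.sqrt_nonneg _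

theorem dK_le {x y : E} {γ δ : ℝ → E} (hp : IsPath D γ δ) (h0 : γ 0 = x) (h1 : γ 1 = y) :
    dK D G x y ≤ ∫ t in (0:ℝ)..1, spd G γ δ t := by
  refine csInf_le ⟨0, ?_⟩ ⟨γ, δ, hp, h0, h1, rfl⟩
  rintro L ⟨γ, δ, -, -, -, rfl⟩
  exact intervalIntegral.integral_nonneg zero_le_one fun t _ => spd_nonneg _ _ _

theorem dK_nonneg (x y : E) : 0 ≤ dK D G x y := by
  refine Real.sInf_nonneg ?_
  rintro L ⟨γ, δ, -, -, -, rfl⟩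
  exact intervalIntegral.integral_nonneg zero_le_one fun t _ => spd_nonneg _ _ _

theorem seg_path (hc : Convex ℝ D) {x y : E} (hx : x ∈ D) (hy : y ∈ D) :
    IsPath D (fun t => x + t • (y - x)) (fun _ => y - x) where
  mem := fun t ht => hc.add_smul_sub_mem hx hy ht
  der := fun t _ => by
    have : HasDerivAt (fun t : ℝ => x + t • (y - x)) (y - x) t := by
      simpa using ((hasDerivAt_id t).smul_const (y - x)).const_add x
    exact this.hasDerivWithinAt
  cont := continuousOn_const

theorem dK_exists (hc : Convex ℝ D) {x y : E} (hx : x ∈ D) (hy : y ∈ D) {ρ : ℝ} (h : dK D G x y < ρ) :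
    ∃ γ δ : ℝ → E, IsPath D γ δ ∧ γ 0 = x ∧ γ 1 = y ∧ ∫ t in (0:ℝ)..1, spd G γ δ t < ρ := by
  have hne : {L : ℝ | ∃ γ δ : ℝ → E, IsPath D γ δ ∧ γ 0 = x ∧ γ 1 = y ∧
      L = ∫ t in (0:ℝ)..1, spd G γ δ t}.Nonempty :=
    ⟨_, _, _, seg_path hc hx hy, by simp, by simp, rfl⟩
  obtain ⟨L, ⟨γ, δ, hp, h0, h1, rfl⟩, hL⟩ := exists_lt_of_csInf_lt hne h
  exact ⟨γ, δ, hp, h0, h1, hL⟩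

theorem dK_self {x : E} (hc : Convex ℝ D) (hx : x ∈ D) : dK D G x x = 0 := by
  refine le_antisymm ?_ (dK_nonneg _ _)
  have := dK_le (G := G) (seg_path hc hx hx) (x := x) (y := x) (by simp) (by simp)
  simpa [spd, Nq] using this

theorem spd_smul (γ δ : ℝ → E) (t c : ℝ) : 
    Real.sqrt (Nq G (γ t) (c • δ t)) = |c| * spd G γ δ t := by
  rw [Nq_rsmul, Real.sqrt_mul (sq_nonneg c), Real.sqrt_sq_eq_abs]; rfl

/-- reparametrisation -/
theorem IsPath.reparam {γ δ : ℝ → E} (hp : IsPath D γ δ) {φ φ' : ℝ → ℝ}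
    (hφ : ∀ t ∈ Icc (0:ℝ) 1, HasDerivAt φ (φ' t) t) (hφ' : ContinuousOn φ' (Icc 0 1))
    (hm : MapsTo φ (Icc 0 1) (Icc 0 1)) : IsPath D (fun t => γ (φ t)) (fun t => φ' t • δ (φ t)) where
  mem := fun t ht => hp.mem _ (hm ht)
  der := fun t ht => (hp.der _ (hm ht)).scomp t (hφ t ht).hasDerivWithinAt hm
  cont := hφ'.smul (hp.cont.comp (fun t ht => (hφ t ht).continuousAt.continuousWithinAt) hm)

theorem dK_sub (h : HPre D G) {γ δ : ℝ → E} (hp : IsPath D γ δ) {a b : ℝ} (ha : 0 ≤ a) (hab : a ≤ b) (hb : b ≤ 1) :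
    dK D G (γ a) (γ b) ≤ ∫ t in a..b, spd G γ δ t := by
  have hd : ∀ t ∈ Icc (0:ℝ) 1, HasDerivAt (fun t => a + (b - a) * t) (b - a) t := fun t _ => by
    simpa using ((hasDerivAt_id t).const_mul (b - a)).const_add a
  have hm : MapsTo (fun t => a + (b - a) * t) (Icc 0 1) (Icc (0:ℝ) 1) := by
    intro t ht
    have := mul_nonneg (sub_nonneg.2 hab) ht.1
    have := mul_le_of_le_one_right (sub_nonneg.2 hab) ht.2
    exact ⟨by linarith, by linarith⟩
  have hp2 := hp.reparam (φ' := fun _ => b - a) hd continuousOn_const hm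
  refine (dK_le hp2 (by simp) (by simp)).trans (le_of_eq ?_)
  have e : ∀ t, spd G (fun t => γ (a + (b - a) * t)) (fun t => (b - a) • δ (a + (b - a) * t)) t =
      (b - a) * spd G γ δ (a + (b - a) * t) := by
    intro t
    have := spd_smul (G := G) γ δ (a + (b - a) * t) (b - a)
    rw [abs_of_nonneg (sub_nonneg.2 hab)] at this
    exact this
  simp only [e]
  rw [intervalIntegral.integral_const_mul]
  rw [intervalIntegral.mul_integral_comp_add_mul]
  simp

theorem dK_symm_le (hc : Convex ℝ D) {x y : E} (hx : x ∈ D) (hy : y ∈ D) : dK D G x y ≤ dK D G y x := by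
  refine le_of_forall_gt fun ρ hρ => ?_
  obtain ⟨γ, δ, hp, h0, h1, hL⟩ := dK_exists hc hy hx hρ
  have hd : ∀ t ∈ Icc (0:ℝ) 1, HasDerivAt (fun t : ℝ => 1 - t) (-1) t := fun t _ => by
    simpa using (hasDerivAt_id t).const_sub 1
  have hp2 := hp.reparam (φ' := fun _ => -1) hd continuousOn_const
    (fun t ht => ⟨by linarith [ht.2], by linarith [ht.1]⟩)
  refine (dK_le hp2 (x := x) (y := y) (by simpa using h1) (by simpa using h0)).trans_lt ?_
  have e : ∀ t, spd G (fun t => γ (1 - t)) (fun t => (-1 : ℝ) • δ (1 - t)) t = spd G γ δ (1 - t) := by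
    intro t
    have := spd_smul (G := G) γ δ (1 - t) (-1)
    rw [abs_neg, abs_one, one_mul] at this
    exact this
  simp only [e]
  rw [intervalIntegral.integral_comp_sub_left]
  simpa using hL

theorem dK_symm (hc : Convex ℝ D) {x y : E} (hx : x ∈ D) (hy : y ∈ D) : dK D G x y = dK D G y x :=
  le_antisymm (dK_symm_le hc hx hy) (dK_symm_le hc hy hx)

theorem dK_triangle (h : HPre D G) (hc : Convex ℝ D) {x y z : E} (hx : x ∈ D) (hy : y ∈ D) (hz : z ∈ D) :
    dK D G x z ≤ dK D G x y + dK D G y z := by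
  refine le_of_forall_gt fun ρ hρ => ?_
  obtain ⟨ρ1, ρ2, hr1, hr2, hr⟩ : ∃ ρ1 ρ2, dK D G x y < ρ1 ∧ dK D G y z < ρ2 ∧ ρ1 + ρ2 = ρ :=
    ⟨dK D G x y + (ρ - (dK D G x y + dK D G y z)) / 2, dK D G y z + (ρ - (dK D G x y + dK D G y z)) / 2,
      by linarith, by linarith, by ring⟩
  obtain ⟨γ₁, δ₁, hp₁, h10, h11, hL1⟩ := dK_exists hc hx hy hr1
  obtain ⟨γ₂, δ₂, hp₂, h20, h21, hL2⟩ := dK_exists hc hy hz hr2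
  set S := Real.smoothTransition with hS
  have hSd : ContDiff ℝ 1 S := Real.smoothTransition.contDiff
  have hS' : Continuous (deriv S) := hSd.continuous_deriv le_rfl
  have hSh : ∀ t, HasDerivAt S (deriv S t) t := fun t => (hSd.differentiable one_ne_zero t).hasDerivAt
  have hSI : ∀ t, S t ∈ Icc (0:ℝ) 1 := fun t => ⟨Real.smoothTransition.nonneg t, Real.smoothTransition.le_one t⟩
  have hS0 : ∀ t, t ≤ 0 → S t = 0 := fun t ht => Real.smoothTransition.zero_of_nonpos ht
  have hS1 : ∀ t, 1 ≤ t → S t = 1 := fun t ht => Real.smoothTransition.one_of_one_le ht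
  have hmono : Monotone S := Real.smoothTransition.monotone
  have hS'n : ∀ t, 0 ≤ deriv S t := fun t => hmono.deriv_nonneg
  have hd1 : ∀ t, HasDerivAt (fun t => S (2 * t)) (2 * deriv S (2 * t)) t := fun t => by
    have h1 : HasDerivAt (fun t => S (2 * t)) (deriv S (2 * t) * (2 * 1)) t :=
      HasDerivAt.comp t (h := fun t => 2 * t) (hSh (2 * t)) ((hasDerivAt_id t).const_mul 2)
    convert h1 using 1; ring
  have hd2 : ∀ t, HasDerivAt (fun t => S (2 * t - 1)) (2 * deriv S (2 * t - 1)) t := fun t => by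
    have h1 : HasDerivAt (fun t => S (2 * t - 1)) (deriv S (2 * t - 1) * (2 * 1)) t :=
      HasDerivAt.comp t (h := fun t => 2 * t - 1) (hSh (2 * t - 1)) (((hasDerivAt_id t).const_mul 2).sub_const 1)
    convert h1 using 1; ring
  have q1 := hp₁.reparam (φ := fun t => S (2 * t)) (fun t _ => hd1 t) (by fun_prop) (fun t _ => hSI _)
  have q2 := hp₂.reparam (φ := fun t => S (2 * t - 1)) (fun t _ => hd2 t) (by fun_prop) (fun t _ => hSI _)
  have eqL : ∀ t ≤ (1/2 : ℝ), γ₁ (S (2 * t)) + γ₂ (S (2 * t - 1)) - y = γ₁ (S (2 * t)) := by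
    intro t ht
    rw [hS0 (2 * t - 1) (by linarith), h20]; abel
  have eqR : ∀ t ≥ (1/2 : ℝ), γ₁ (S (2 * t)) + γ₂ (S (2 * t - 1)) - y = γ₂ (S (2 * t - 1)) := by
    intro t ht
    rw [hS1 (2 * t) (by linarith), h11]; abel
  have dL : ∀ t, t ≤ 0 → deriv S t = 0 := by
    intro t ht
    have : deriv S 0 = 0 := by
      have : IsLocalMin S 0 := Eventually.of_forall fun s => by rw [hS0 0 le_rfl]; exact (hSI s).1
      exact this.deriv_eq_zero
    rcases ht.lt_or_eq with h' | h'
    · have : S =ᶠ[𝓝 t] fun _ => 0 := by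
        filter_upwards [Iio_mem_nhds h'] with s hs
        exact hS0 s (le_of_lt hs)
      rw [this.deriv_eq]; simp
    · rw [h', this]
  have dR : ∀ t, 1 ≤ t → deriv S t = 0 := by
    intro t ht
    have : deriv S 1 = 0 := by
      have : IsLocalMax S 1 := Eventually.of_forall fun s => by rw [hS1 1 le_rfl]; exact (hSI s).2
      exact this.deriv_eq_zero
    rcases ht.lt_or_eq with h' | h'
    · have : S =ᶠ[𝓝 t] fun _ => 1 := by
        filter_upwards [Ioi_mem_nhds h'] with s hs
        exact hS1 s (le_of_lt hs)
      rw [this.deriv_eq]; simp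
    · rw [← h', this]
  have hp : IsPath D (fun t => γ₁ (S (2 * t)) + γ₂ (S (2 * t - 1)) - y)
      (fun t => (2 * deriv S (2 * t)) • δ₁ (S (2 * t)) + (2 * deriv S (2 * t - 1)) • δ₂ (S (2 * t - 1))) := by
    refine ⟨fun t ht => ?_, fun t ht => ((q1.der t ht).add (q2.der t ht)).sub_const y, q1.cont.add q2.cont⟩
    rcases le_total t (1/2) with h' | h'
    · simp only [eqL t h']; exact q1.mem t ht
    · simp only [eqR t h']; exact q2.mem t ht
  refine (dK_le hp (x := x) (y := z) ?_ ?_).trans_lt ?_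
  · rw [eqL 0 (by norm_num)]; simp [hS0 0 le_rfl, h10]
  · rw [eqR 1 (by norm_num), show (2 * 1 - 1 : ℝ) = 1 by norm_num, hS1 1 le_rfl, h21]
  · have hintg := h.contSpd hp
    rw [← intervalIntegral.integral_add_adjacent_intervals (b := 1/2)]
    · rw [← hr]
      refine add_lt_add (lt_of_le_of_lt (le_of_eq ?_) hL1) (lt_of_le_of_lt (le_of_eq ?_) hL2)
      · have : ∀ t ∈ uIcc (0:ℝ) (1/2), spd G (fun t => γ₁ (S (2 * t)) + γ₂ (S (2 * t - 1)) - y)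
          (fun t => (2 * deriv S (2 * t)) • δ₁ (S (2 * t)) + (2 * deriv S (2 * t - 1)) • δ₂ (S (2 * t - 1))) t =
            (spd G γ₁ δ₁ ∘ (fun t => S (2 * t))) t * (2 * deriv S (2 * t)) := by
          intro t ht
          rw [uIcc_of_le (by norm_num)] at ht
          have := spd_smul (G := G) γ₁ δ₁ (S (2 * t)) (2 * deriv S (2 * t))
          rw [abs_of_nonneg (mul_nonneg zero_le_two (hS'n _))] at this
          unfold spd at this ⊢
          simp only [eqL t ht.2, dL (2 * t - 1) (by linarith [ht.2]), mul_zero, zero_smul, add_zero]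
          rw [this, mul_comm]; rfl
        rw [intervalIntegral.integral_congr this]
        rw [intervalIntegral.integral_comp_mul_deriv'' (f := fun t => S (2 * t)) (f' := fun t => 2 * deriv S (2 * t))
          (g := spd G γ₁ δ₁) (fun t _ => (hd1 t).continuousAt.continuousWithinAt) (fun t _ => (hd1 t).hasDerivWithinAt)
          (by fun_prop) ((h.contSpd hp₁).mono (by rintro _ ⟨t, -, rfl⟩; exact hSI _))]
        simp [hS0 0 le_rfl, hS1 1 le_rfl]
      · have : ∀ t ∈ uIcc (1/2:ℝ) 1, spd G (fun t => γ₁ (S (2 * t)) + γ₂ (S (2 * t - 1)) - y)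
          (fun t => (2 * deriv S (2 * t)) • δ₁ (S (2 * t)) + (2 * deriv S (2 * t - 1)) • δ₂ (S (2 * t - 1))) t =
            (spd G γ₂ δ₂ ∘ (fun t => S (2 * t - 1))) t * (2 * deriv S (2 * t - 1)) := by
          intro t ht
          rw [uIcc_of_le (by norm_num)] at ht
          have := spd_smul (G := G) γ₂ δ₂ (S (2 * t - 1)) (2 * deriv S (2 * t - 1))
          rw [abs_of_nonneg (mul_nonneg zero_le_two (hS'n _))] at this
          unfold spd at this ⊢
          simp only [eqR t ht.1, dR (2 * t) (by linarith [ht.1]), mul_zero, zero_smul, zero_add]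
          rw [this, mul_comm]; rfl
        rw [intervalIntegral.integral_congr this]
        rw [intervalIntegral.integral_comp_mul_deriv'' (f := fun t => S (2 * t - 1)) (f' := fun t => 2 * deriv S (2 * t - 1))
          (g := spd G γ₂ δ₂) (fun t _ => (hd2 t).continuousAt.continuousWithinAt) (fun t _ => (hd2 t).hasDerivWithinAt)
          (by fun_prop) ((h.contSpd hp₂).mono (by rintro _ ⟨t, -, rfl⟩; exact hSI _))]
        norm_num [hS0 0 le_rfl, hS1 1 le_rfl]
    · exact (hintg.mono (by rw [uIcc_of_le (by norm_num)]; exact Icc_subset_Icc le_rfl (by norm_num))).intervalIntegrable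
    · exact (hintg.mono (by rw [uIcc_of_le (by norm_num)]; exact Icc_subset_Icc (by norm_num) le_rfl)).intervalIntegrable

end paths

section hopf
variable {E : Type*} [NormedAddCommGroup E] [NormedSpace ℂ E] [NormedSpace ℝ E]
  [IsScalarTower ℝ ℂ E] [ProperSpace E]
variable {D : Set E} {G : E → E →L[ℝ] E →L[ℝ] ℂ} {Γ : E → E →L[ℝ] E →L[ℝ] E}

theorem HPre.cmp (h : HPre D G) {K : Set E} (hK : IsCompact K) (hKD : K ⊆ D) :
    ∃ m > 0, ∃ M > 0, ∀ z ∈ K, ∀ v, m * ‖v‖ ^ 2 ≤ Nq G z v ∧ Nq G z v ≤ M * ‖v‖ ^ 2 := by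
  have hc : IsCompact (K ×ˢ sphere (0:E) 1) := hK.prod (isCompact_sphere 0 1)
  have hcont : ContinuousOn (fun p : E × E => Nq G p.1 p.2) (K ×ˢ sphere (0:E) 1) :=
    h.contN.mono (prod_mono hKD (subset_univ _))
  obtain ⟨m, hm, hm'⟩ := hc.exists_forall_le' hcont (a := 0) (by
    rintro ⟨z, v⟩ ⟨hz, hv⟩
    refine h.pos z (hKD hz) v ?_
    rintro rfl
    simp at hv)
  obtain ⟨M, hM⟩ := hc.exists_bound_of_continuousOn hcont
  refine ⟨m, hm, max M 1, by positivity, fun z hz v => ?_⟩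
  by_cases hv : v = 0
  · simp [hv, Nq]
  have hv' : 0 < ‖v‖ := norm_pos_iff.2 hv
  have hs : ‖v‖⁻¹ • v ∈ sphere (0:E) 1 := by
    rw [mem_sphere_zero_iff_norm, norm_smul]; simp [hv'.ne']
  have e : Nq G z v = ‖v‖ ^ 2 * Nq G z (‖v‖⁻¹ • v) := by
    rw [Nq_rsmul]; field_simp
  have h1 := hm' (z, ‖v‖⁻¹ • v) ⟨hz, hs⟩
  have h2 := (le_abs_self _).trans (hM (z, ‖v‖⁻¹ • v) ⟨hz, hs⟩)
  simp only at h1 h2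
  rw [e, mul_comm m, mul_comm (max M 1)]
  exact ⟨by gcongr, by gcongr; exact h2.trans (le_max_left _ _)⟩

theorem HPre.dK_lower (h : HPre D G) (hc : Convex ℝ D) {x : E} (hx : x ∈ D) {r m : ℝ} (hr : 0 < r) (hm : 0 < m)
    (hsub : closedBall x r ⊆ D)
    (hml : ∀ z ∈ closedBall x r, ∀ v, m * ‖v‖ ^ 2 ≤ Nq G z v) {y : E} (hy : y ∈ D)
    (hd : dK D G x y < Real.sqrt m * r) : y ∈ closedBall x r := by
  by_contra hyr
  obtain ⟨γ, δ, hp, h0, h1, hL⟩ := dK_exists hc hx hy hd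
  set A : Set ℝ := Icc 0 1 ∩ {t | r ≤ ‖γ t - x‖} with hA
  have hcn : ContinuousOn (fun t => ‖γ t - x‖) (Icc 0 1) := (hp.contγ.sub continuousOn_const).norm
  have hAc : IsClosed A := hcn.preimage_isClosed_of_isClosed isClosed_Icc isClosed_Ici
  have h1A : (1:ℝ) ∈ A := by
    refine ⟨by simp, ?_⟩
    rw [mem_closedBall, dist_eq_norm] at hyr
    simp only [mem_setOf_eq, h1]; linarith
  have hAb : BddBelow A := ⟨0, fun t ht => ht.1.1⟩
  set τ := sInf A with hτ
  have hτA : τ ∈ A := hAc.csInf_mem ⟨1, h1A⟩ hAb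
  have hlt : ∀ t ∈ Icc 0 1, t < τ → ‖γ t - x‖ < r := by
    intro t ht htτ
    by_contra hcon
    exact absurd (csInf_le hAb (⟨ht, not_lt.1 hcon⟩ : t ∈ A)) (not_le.2 htτ)
  have hsubτ : Icc 0 τ ⊆ Icc (0:ℝ) 1 := Icc_subset_Icc le_rfl hτA.1.2
  have hball : ∀ t ∈ Ico 0 τ, γ t ∈ closedBall x r := by
    intro t ht
    rw [mem_closedBall, dist_eq_norm]
    exact (hlt t ⟨ht.1, ht.2.le.trans hτA.1.2⟩ ht.2).le
  have hsp := h.contSpd hp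
  have i1 : IntervalIntegrable (spd G γ δ) MeasureTheory.volume 0 τ :=
    (hsp.mono (by rw [uIcc_of_le hτA.1.1]; exact hsubτ)).intervalIntegrable
  have i2 : IntervalIntegrable (spd G γ δ) MeasureTheory.volume τ 1 :=
    (hsp.mono (by rw [uIcc_of_le hτA.1.2]; exact Icc_subset_Icc hτA.1.1 le_rfl)).intervalIntegrable
  have i3 : IntervalIntegrable δ MeasureTheory.volume 0 τ :=
    (hp.cont.mono (by rw [uIcc_of_le hτA.1.1]; exact hsubτ)).intervalIntegrable
  have e1 : ∫ t in (0:ℝ)..τ, δ t = γ τ - γ 0 := by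
    refine intervalIntegral.integral_eq_sub_of_hasDerivAt_of_le hτA.1.1 (hp.contγ.mono hsubτ) (fun t ht => ?_) i3
    exact (hp.der t ⟨ht.1.le, ht.2.le.trans hτA.1.2⟩).hasDerivAt (Icc_mem_nhds ht.1 (ht.2.trans_le hτA.1.2))
  have e2 : Real.sqrt m * r ≤ ∫ t in (0:ℝ)..τ, spd G γ δ t := by
    calc Real.sqrt m * r ≤ Real.sqrt m * ‖∫ t in (0:ℝ)..τ, δ t‖ := by
          rw [e1, h0]; gcongr; exact hτA.2
      _ ≤ Real.sqrt m * ∫ t in (0:ℝ)..τ, ‖δ t‖ := by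
          gcongr; exact intervalIntegral.norm_integral_le_integral_norm hτA.1.1
      _ = ∫ t in (0:ℝ)..τ, Real.sqrt m * ‖δ t‖ := by rw [intervalIntegral.integral_const_mul]
      _ ≤ ∫ t in (0:ℝ)..τ, spd G γ δ t := by
          refine intervalIntegral.integral_mono_on_of_le_Ioo hτA.1.1 (i3.norm.const_mul _) i1 fun t ht => ?_
          have := hml _ (hball t ⟨ht.1.le, ht.2⟩) (δ t)
          unfold spd
          rw [← Real.sqrt_sq (norm_nonneg (δ t)), ← Real.sqrt_mul hm.le]
          exact Real.sqrt_le_sqrt this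
  have e3 : 0 ≤ ∫ t in τ..1, spd G γ δ t := intervalIntegral.integral_nonneg hτA.1.2 fun t _ => spd_nonneg _ _ _
  have e4 := intervalIntegral.integral_add_adjacent_intervals i1 i2
  linarith

theorem HPre.dK_upper (h : HPre D G) (hc : Convex ℝ D) {x : E} (hx : x ∈ D) {ε : ℝ} (hε : 0 < ε) :
    ∃ U ∈ 𝓝 x, ∀ y ∈ U, y ∈ D ∧ dK D G x y < ε := by
  obtain ⟨r, hr, hsub⟩ := Metric.nhds_basis_closedBall.mem_iff.1 (h.isOpen.mem_nhds hx)
  obtain ⟨m, hm, M, hM, hcmp⟩ := h.cmp (isCompact_closedBall x r) hsub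
  refine ⟨ball x (min r (ε / Real.sqrt M)), ball_mem_nhds _ (by positivity), fun y hy => ?_⟩
  rw [mem_ball, lt_min_iff] at hy
  have hyr : y ∈ closedBall x r := hy.1.le
  refine ⟨hsub hyr, ?_⟩
  have hp := seg_path (convex_closedBall x r) (mem_closedBall_self hr.le) hyr
  have hp' := seg_path hc hx (hsub hyr)
  refine (dK_le hp' (x := x) (y := y) (by simp) (by simp)).trans_lt ?_
  calc ∫ t in (0:ℝ)..1, spd G (fun t => x + t • (y - x)) (fun _ => y - x) t
      ≤ ∫ t in (0:ℝ)..1, Real.sqrt M * ‖y - x‖ := by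
        refine intervalIntegral.integral_mono_on zero_le_one ?_ (by simp) fun t ht => ?_
        · exact ((h.contSpd hp').mono (by rw [uIcc_of_le zero_le_one])).intervalIntegrable
        · unfold spd
          rw [← Real.sqrt_sq (norm_nonneg (y - x)), ← Real.sqrt_mul hM.le]
          exact Real.sqrt_le_sqrt (hcmp _ (hp.mem t ht) _).2
    _ = Real.sqrt M * ‖y - x‖ := by simp
    _ < ε := by
        rw [← dist_eq_norm, mul_comm]
        exact (lt_div_iff₀ (Real.sqrt_pos.2 hM)).1 hy.2

/-- precompactness of metric balls -/
def PreC (D : Set E) (G : E → E →L[ℝ] E →L[ℝ] ℂ) (x : E) (ρ : ℝ) : Prop :=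
  ∃ K, IsCompact K ∧ K ⊆ D ∧ ∀ y ∈ D, dK D G x y < ρ → y ∈ K

theorem PreC.mono {x : E} {ρ σ : ℝ} (h : PreC D G x σ) (hρ : ρ ≤ σ) : PreC D G x ρ := by
  obtain ⟨K, h1, h2, h3⟩ := h
  exact ⟨K, h1, h2, fun y hy hd => h3 y hy (hd.trans_le hρ)⟩

theorem HPre.preC_small (h : HPre D G) (hc : Convex ℝ D) {x : E} (hx : x ∈ D) : ∃ r > 0, PreC D G x r := by
  obtain ⟨r, hr, hsub⟩ := Metric.nhds_basis_closedBall.mem_iff.1 (h.isOpen.mem_nhds hx)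
  obtain ⟨m, hm, M, hM, hcmp⟩ := h.cmp (isCompact_closedBall x r) hsub
  exact ⟨Real.sqrt m * r, by positivity, _, isCompact_closedBall x r, hsub, fun y hy hd =>
    h.dK_lower hc hx hr hm hsub (fun z hz v => (hcmp z hz v).1) hy hd⟩

theorem HPre.midpoint (h : HPre D G) (hc : Convex ℝ D) {x z : E} (hx : x ∈ D) (hz : z ∈ D) {ρ : ℝ}
    (hd : dK D G x z < ρ) : ∃ w ∈ D, dK D G x w < ρ / 2 ∧ dK D G w z < ρ / 2 := by
  obtain ⟨γ, δ, hp, h0, h1, hL⟩ := dK_exists hc hx hz hd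
  have hsp := h.contSpd hp
  have hii : IntervalIntegrable (spd G γ δ) MeasureTheory.volume 0 1 :=
    (hsp.mono (by rw [uIcc_of_le zero_le_one])).intervalIntegrable
  set F : ℝ → ℝ := fun t => ∫ s in (0:ℝ)..t, spd G γ δ s with hF
  have hFc : ContinuousOn F (Icc 0 1) := by
    have := intervalIntegral.continuousOn_primitive_interval' hii (a := 0) (by simp)
    rwa [uIcc_of_le zero_le_one] at this
  have hL0 : 0 ≤ F 1 := intervalIntegral.integral_nonneg zero_le_one fun t _ => spd_nonneg _ _ _
  have hF0 : F 0 = 0 := by simp [hF]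
  obtain ⟨t, ht, hFt⟩ := intermediate_value_Icc zero_le_one hFc (show F 1 / 2 ∈ Icc (F 0) (F 1) by
    rw [hF0]; exact ⟨by linarith, by linarith⟩)
  have j1 : IntervalIntegrable (spd G γ δ) MeasureTheory.volume 0 t :=
    (hsp.mono (by rw [uIcc_of_le ht.1]; exact Icc_subset_Icc le_rfl ht.2)).intervalIntegrable
  have j2 : IntervalIntegrable (spd G γ δ) MeasureTheory.volume t 1 :=
    (hsp.mono (by rw [uIcc_of_le ht.2]; exact Icc_subset_Icc ht.1 le_rfl)).intervalIntegrable
  have e := intervalIntegral.integral_add_adjacent_intervals j1 j2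
  have d1 := dK_sub h hp le_rfl ht.1 ht.2
  have d2 := dK_sub h hp ht.1 ht.2 le_rfl
  rw [h0] at d1
  rw [h1] at d2
  have hL' : F 1 < ρ := hL
  have hFt' : ∫ s in (0:ℝ)..t, spd G γ δ s = F 1 / 2 := hFt
  have e' : (∫ s in (0:ℝ)..t, spd G γ δ s) + (∫ s in t..1, spd G γ δ s) = F 1 := e
  exact ⟨γ t, hp.mem t ht, by linarith, by linarith⟩

theorem HPre.preC_step (h : HPre D G) (hc : Convex ℝ D) {x : E} (hx : x ∈ D) {ρ : ℝ} (hρ : 0 < ρ)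
    (hn : ¬ PreC D G x ρ) : ∃ y ∈ D, dK D G x y < ρ ∧ ¬ PreC D G y (3 / 4 * ρ) := by
  by_cases hh : PreC D G x (ρ / 2)
  · by_contra hcon
    push Not at hcon
    apply hn
    obtain ⟨K0, hK0, hK0D, hK0b⟩ := hh
    have hKf : ∀ y : E, ∃ K, IsCompact K ∧ K ⊆ D ∧ (y ∈ D → dK D G x y < ρ →
        ∀ z ∈ D, dK D G y z < 3 / 4 * ρ → z ∈ K) := by
      intro y
      by_cases hy : y ∈ D ∧ dK D G x y < ρ
      · obtain ⟨K, k1, k2, k3⟩ := hcon y hy.1 hy.2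
        exact ⟨K, k1, k2, fun _ _ => k3⟩
      · exact ⟨∅, isCompact_empty, empty_subset _, fun h1 h2 => absurd ⟨h1, h2⟩ hy⟩
    choose Kf hKf1 hKf2 hKf3 using hKf
    have hU : ∀ y : E, ∃ U, y ∈ K0 → U ∈ 𝓝 y ∧ ∀ z ∈ U, z ∈ D ∧ dK D G y z < ρ / 16 := by
      intro y
      by_cases hy : y ∈ K0
      · obtain ⟨U, hU1, hU2⟩ := h.dK_upper hc (hK0D hy) (ε := ρ / 16) (by positivity)
        exact ⟨U, fun _ => ⟨hU1, hU2⟩⟩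
      · exact ⟨univ, fun h' => absurd h' hy⟩
    choose U hU using hU
    obtain ⟨t, ht, hcov⟩ := hK0.elim_nhds_subcover U fun y hy => (hU y hy).1
    refine ⟨⋃ y ∈ t, Kf y, t.isCompact_biUnion fun y _ => hKf1 y, iUnion₂_subset fun y _ => hKf2 y, ?_⟩
    intro z hz hdz
    obtain ⟨w, hw, hw1, hw2⟩ := h.midpoint hc hx hz hdz
    obtain ⟨y, hyt, hwy⟩ := mem_iUnion₂.1 (hcov (hK0b w hw hw1))
    have hyD := hK0D (ht y hyt)
    have h3 := ((hU y (ht y hyt)).2 w hwy).2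
    refine mem_iUnion₂.2 ⟨y, hyt, hKf3 y hyD ?_ z hz ?_⟩
    · have := dK_triangle h hc hx hw hyD
      rw [dK_symm hc hw hyD] at this
      linarith
    · have := dK_triangle h hc hyD hw hz
      linarith
  · exact ⟨x, hx, by rw [dK_self hc hx]; exact hρ, fun hcon => hh (hcon.mono (by linarith))⟩

/-- Hopf-Rinow -/
theorem HPre.hopf_rinow (h : HPre D G) (hc : Convex ℝ D)
    (hcomp : ∀ x : ℕ → E, (∀ k, x k ∈ D) →
      (∀ ε > (0:ℝ), ∃ N : ℕ, ∀ k ≥ N, ∀ m ≥ N, dK D G (x k) (x m) < ε) →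
      ∃ y ∈ D, Tendsto (fun k => dK D G (x k) y) atTop (𝓝 0)) {p : E} (hp : p ∈ D) (ρ : ℝ) :
    PreC D G p ρ := by
  suffices hs : ∀ ρ > 0, PreC D G p ρ from (hs (max ρ 1) (by positivity)).mono (le_max_left _ _)
  clear ρ
  intro ρ hρ
  by_contra hn
  set r : ℕ → ℝ := fun k => ρ * (3 / 4) ^ k with hr
  have hrpos : ∀ k, 0 < r k := fun k => by positivity
  have hrs : ∀ k, r (k + 1) = 3 / 4 * r k := fun k => by simp only [hr, pow_succ]; ring
  choose! nx hnx1 hnx2 hnx3 using fun (x : E) (hx : x ∈ D) (σ : ℝ) (hσ : 0 < σ) (hn : ¬ PreC D G x σ) =>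
    h.preC_step hc hx hσ hn
  let x : ℕ → E := fun k => Nat.rec p (fun k y => nx y (r k)) k
  have hx0 : x 0 = p := rfl
  have hxs : ∀ k, x (k + 1) = nx (x k) (r k) := fun k => rfl
  have hinv : ∀ k, x k ∈ D ∧ ¬ PreC D G (x k) (r k) := by
    intro k
    induction k with
    | zero => exact ⟨hp, by rw [hx0]; simpa [hr] using hn⟩
    | succ k ih =>
      rw [hxs, hrs]
      exact ⟨hnx1 _ ih.1 _ (hrpos k) ih.2, hnx3 _ ih.1 _ (hrpos k) ih.2⟩
  have hstep : ∀ k, dK D G (x k) (x (k + 1)) < r k := by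
    intro k
    rw [hxs]
    exact hnx2 _ (hinv k).1 _ (hrpos k) (hinv k).2
  have hdist : ∀ k j, dK D G (x k) (x (k + j)) ≤ 4 * r k - 4 * r (k + j) := by
    intro k j
    induction j with
    | zero => simp [dK_self hc (hinv k).1]
    | succ j ih =>
      have h1 := dK_triangle h hc (hinv k).1 (hinv (k + j)).1 (hinv (k + j + 1)).1
      have h2 := hstep (k + j)
      have h3 := hrs (k + j)
      rw [← add_assoc]
      linarith
  have hr0 : Tendsto r atTop (𝓝 0) := by
    have := (tendsto_pow_atTop_nhds_zero_of_lt_one (r := (3/4:ℝ)) (by norm_num) (by norm_num)).const_mul ρ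
    simpa using this
  have hle : ∀ k m, k ≤ m → dK D G (x k) (x m) ≤ 4 * r k := by
    intro k m hkm
    obtain ⟨j, rfl⟩ := Nat.exists_eq_add_of_le hkm
    have := hdist k j
    have := hrpos (k + j)
    linarith
  have hanti : ∀ k m, k ≤ m → r m ≤ r k := by
    intro k m hkm
    simp only [hr]
    gcongr ρ * ?_
    exact pow_le_pow_of_le_one (by norm_num) (by norm_num) hkm
  obtain ⟨y, hy, hlim⟩ := hcomp x (fun k => (hinv k).1) (by
    intro ε hε
    obtain ⟨N, hN⟩ := (hr0.eventually (gt_mem_nhds (show (0:ℝ) < ε / 8 by positivity))).exists_forall_of_atTop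
    refine ⟨N, fun k hk m hm => ?_⟩
    rcases le_total k m with hkm | hkm
    · have := hle k m hkm
      have := hN k hk
      linarith
    · rw [dK_symm hc (hinv k).1 (hinv m).1]
      have := hle m k hkm
      have := hN m hm
      linarith)
  obtain ⟨s, hs, K, hK1, hK2, hK3⟩ := h.preC_small hc hy
  obtain ⟨k, hk1, hk2⟩ := ((hr0.eventually (gt_mem_nhds (show (0:ℝ) < s / 2 by positivity))).and
    (hlim.eventually (gt_mem_nhds (show (0:ℝ) < s / 2 by positivity)))).exists
  refine (hinv k).2 ⟨K, hK1, hK2, fun z hz hd => hK3 z hz ?_⟩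
  have := dK_triangle h hc hy (hinv k).1 hz
  rw [dK_symm hc hy (hinv k).1] at this
  linarith

end hopf

section ode
variable {E : Type*} [NormedAddCommGroup E] [NormedSpace ℝ E] [CompleteSpace E]

/-- radial cutoff -/
noncomputable def cutR (R : ℝ) (x : E) : ℝ := max 0 (min 1 (2 - ‖x‖ / R))

theorem cutR_nonneg (R : ℝ) (x : E) : 0 ≤ cutR R x := le_max_left _ _

theorem cutR_le (R : ℝ) (x : E) : cutR R x ≤ 1 := max_le zero_le_one (min_le_left _ _)

theorem cutR_one {R : ℝ} (hR : 0 < R) {x : E} (hx : ‖x‖ ≤ R) : cutR R x = 1 := by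
  unfold cutR
  have : ‖x‖ / R ≤ 1 := by rw [div_le_one hR]; exact hx
  rw [min_eq_left (by linarith), max_eq_right zero_le_one]

theorem cutR_norm {R : ℝ} (hR : 0 < R) (x : E) : cutR R x * ‖x‖ ≤ 2 * R := by
  by_cases hx : ‖x‖ ≤ 2 * R
  · calc cutR R x * ‖x‖ ≤ 1 * ‖x‖ := by gcongr; exact cutR_le _ _
      _ ≤ 2 * R := by linarith
  · push Not at hx
    have : cutR R x = 0 := by
      unfold cutR
      have : 2 ≤ ‖x‖ / R := by rw [le_div_iff₀ hR]; linarith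
      rw [max_eq_left]
      exact (min_le_right _ _).trans (by linarith)
    rw [this]; simp; positivity

theorem cutR_lip {R : ℝ} (hR : 0 < R) (x y : E) : |cutR R x - cutR R y| ≤ ‖x - y‖ / R := by
  unfold cutR
  calc |max 0 (min 1 (2 - ‖x‖ / R)) - max 0 (min 1 (2 - ‖y‖ / R))|
      ≤ |min 1 (2 - ‖x‖ / R) - min 1 (2 - ‖y‖ / R)| := by
        simpa using abs_max_sub_max_le_max 0 (min 1 (2 - ‖x‖ / R)) 0 (min 1 (2 - ‖y‖ / R))
    _ ≤ |(2 - ‖x‖ / R) - (2 - ‖y‖ / R)| := by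
        simpa using abs_min_sub_min_le_max 1 (2 - ‖x‖ / R) 1 (2 - ‖y‖ / R)
    _ = |‖y‖ - ‖x‖| / R := by
        rw [← abs_of_pos hR, ← abs_div, abs_of_pos hR]; congr 1; ring
    _ ≤ _ := by
        gcongr
        rw [norm_sub_rev]
        exact abs_norm_sub_norm_le _ _

theorem lin_ode {A : ℝ → E →L[ℝ] E} (hA : ContinuousOn A (Icc 0 1)) (v : E) :
    ∃ P : ℝ → E, P 0 = v ∧ ∀ t ∈ Icc (0:ℝ) 1, HasDerivWithinAt P (A t (P t)) (Icc 0 1) t := by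
  obtain ⟨M, hM⟩ := isCompact_Icc.exists_bound_of_continuousOn hA
  have hM0 : 0 ≤ M := (norm_nonneg _).trans (hM 0 (by simp))
  set R : ℝ := (‖v‖ + 1) * Real.exp M with hRd
  have hR : 0 < R := by positivity
  set a : ℝ := M * (2 * R) with ha
  have ha0 : 0 ≤ a := by positivity
  set K : ℝ := M * ((‖v‖ + a) / R + 1) with hK
  have hK0 : 0 ≤ K := by positivity
  have hnl : ∀ t ∈ Icc (0:ℝ) 1, ∀ x : E, ‖cutR R x • A t x‖ ≤ a := by
    intro t ht x
    rw [norm_smul, Real.norm_of_nonneg (cutR_nonneg _ _)]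
    calc cutR R x * ‖A t x‖ ≤ cutR R x * (M * ‖x‖) := by
          gcongr
          · exact cutR_nonneg _ _
          · exact (A t).le_of_opNorm_le (hM t ht) x
      _ = M * (cutR R x * ‖x‖) := by ring
      _ ≤ a := by rw [ha]; exact mul_le_mul_of_nonneg_left (cutR_norm hR x) hM0
  have hpl : IsPicardLindelof (fun t x => cutR R x • A t x)
      (⟨0, by simp⟩ : Icc (0:ℝ) 1) v ⟨a, ha0⟩ 0 ⟨a, ha0⟩ ⟨K, hK0⟩ := by
    constructor
    · intro t ht
      apply LipschitzOnWith.of_dist_le_mul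
      intro x hx y hy
      rw [dist_eq_norm, dist_eq_norm]
      have hxn : ‖x‖ ≤ ‖v‖ + a := by
        have : ‖x - v‖ ≤ a := by rw [← dist_eq_norm]; exact hx
        calc ‖x‖ = ‖v + (x - v)‖ := by congr 1; abel
          _ ≤ _ := (norm_add_le _ _).trans (by gcongr)
      have e : cutR R x • A t x - cutR R y • A t y =
          A t ((cutR R x - cutR R y) • x + cutR R y • (x - y)) := by
        simp only [map_add, map_smul, map_sub]
        module
      rw [e]
      calc ‖A t ((cutR R x - cutR R y) • x + cutR R y • (x - y))‖
          ≤ M * ‖(cutR R x - cutR R y) • x + cutR R y • (x - y)‖ := (A t).le_of_opNorm_le (hM t ht) _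
        _ ≤ M * (‖x - y‖ / R * (‖v‖ + a) + 1 * ‖x - y‖) := by
            gcongr
            refine (norm_add_le _ _).trans ?_
            rw [norm_smul, norm_smul, Real.norm_eq_abs, Real.norm_of_nonneg (cutR_nonneg _ _)]
            gcongr
            · exact cutR_lip hR x y
            · exact cutR_le _ _
        _ = K * ‖x - y‖ := by rw [hK]; ring
    · intro x hx
      exact (hA.clm_apply continuousOn_const).const_smul _
    · intro t ht x hx
      exact hnl t ht x
    · change a * max (1 - (0:ℝ)) (0 - 0) ≤ a - 0
      simp
  obtain ⟨P, hP0, hP⟩ := hpl.exists_eq_forall_mem_Icc_hasDerivWithinAt₀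
  refine ⟨P, hP0, ?_⟩
  have hg := norm_le_gronwallBound_of_norm_deriv_right_le (f := P) (a := 0) (b := 1)
    (f' := fun t => cutR R (P t) • A t (P t)) (δ := ‖v‖) (K := M) (ε := 0)
    (fun t ht => (hP t ht).continuousWithinAt)
    (fun t ht => ((hP t (Ico_subset_Icc_self ht)).mono_of_mem_nhdsWithin (Icc_mem_nhdsGE_of_mem ht)))
    (by rw [show P 0 = v from hP0]) (by
      intro t ht
      rw [norm_smul, Real.norm_of_nonneg (cutR_nonneg _ _), add_zero]
      calc cutR R (P t) * ‖A t (P t)‖ ≤ 1 * (M * ‖P t‖) := by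
            gcongr
            · exact cutR_le _ _
            · exact (A t).le_of_opNorm_le (hM t (Ico_subset_Icc_self ht)) _
        _ = _ := one_mul _)
  intro t ht
  have h1 := hP t ht
  have h2 := hg t ht
  rw [gronwallBound_ε0] at h2
  have h3 : ‖P t‖ ≤ R := h2.trans (by
    rw [hRd]
    gcongr
    · linarith
    · have := ht.2; nlinarith)
  simpa [cutR_one hR h3] using h1

theorem lin_ode_rev {A : ℝ → E →L[ℝ] E} (hA : ContinuousOn A (Icc 0 1)) (v : E) :
    ∃ P : ℝ → E, P 1 = v ∧ ∀ t ∈ Icc (0:ℝ) 1, HasDerivWithinAt P (A t (P t)) (Icc 0 1) t := by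
  have hm : MapsTo (fun t : ℝ => 1 - t) (Icc 0 1) (Icc 0 1) := by
    intro t ht; exact ⟨by linarith [ht.2], by linarith [ht.1]⟩
  obtain ⟨P, h0, hP⟩ := lin_ode (A := fun t => - A (1 - t))
    ((hA.comp (by fun_prop) hm).neg) v
  refine ⟨fun t => P (1 - t), by simpa using h0, fun t ht => ?_⟩
  have h1 := hP (1 - t) (hm ht)
  have h2 : HasDerivWithinAt (fun t : ℝ => 1 - t) (-1) (Icc 0 1) t := by
    simpa using (hasDerivWithinAt_id t _).const_sub (1:ℝ)
  have := h1.scomp t h2 hm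
  simpa [Function.comp_def] using this

end ode

section transport
variable {E : Type*} [NormedAddCommGroup E] [NormedSpace ℂ E] [NormedSpace ℝ E]
  [IsScalarTower ℝ ℂ E] [CompleteSpace E]
variable {D : Set E} {G : E → E →L[ℝ] E →L[ℝ] ℂ} {Γ : E → E →L[ℝ] E →L[ℝ] E}

theorem KPre.metric_compat (h : KPre D G Γ) {z : E} (hz : z ∈ D) (a v : E) :
    (fderiv ℝ G z a v v).re = 2 * (G z (Γ z a v) v).re := by
  rw [h.gam z hz]
  have e := h.toHPre.dherm hz (Complex.I • a) v v
  have : (fderiv ℝ G z (Complex.I • a) v v).im = 0 := by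
    have := congrArg Complex.im e
    simp at this
    linarith
  simp [Pq, this]

/-- parallel transport to the end point -/
theorem KPre.transport (h : KPre D G Γ) {γ δ : ℝ → E} (hp : IsPath D γ δ) (v : E) :
    ∃ P : ℝ → E, P 1 = v ∧
      (∀ t ∈ Icc (0:ℝ) 1, HasDerivWithinAt P (- Γ (γ t) (δ t) (P t)) (Icc 0 1) t) ∧
      ∀ t ∈ Icc (0:ℝ) 1, Nq G (γ t) (P t) = Nq G (γ 1) v := by
  have hΓ : ContinuousOn (fun t => Γ (γ t)) (Icc 0 1) :=
    h.gamd.continuousOn.comp hp.contγ (fun t ht => hp.mem t ht)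
  obtain ⟨P, h1, hP⟩ := lin_ode_rev (A := fun t => - Γ (γ t) (δ t)) ((hΓ.clm_apply hp.cont).neg) v
  refine ⟨P, h1, fun t ht => by simpa using hP t ht, ?_⟩
  have hd : ∀ t ∈ Icc (0:ℝ) 1, HasDerivWithinAt (fun t => Nq G (γ t) (P t)) 0 (Icc 0 1) t := by
    intro t ht
    have hz := hp.mem t ht
    have hG : HasDerivWithinAt (fun t => G (γ t)) (fderiv ℝ G (γ t) (δ t)) (Icc 0 1) t :=
      (h.toHPre.diffAt hz).hasFDerivAt.comp_hasDerivWithinAt t (hp.der t ht)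
    have h2 := (hG.clm_apply (hP t ht)).clm_apply (hP t ht)
    have h3 := Complex.reCLM.hasFDerivAt.comp_hasDerivWithinAt t h2
    refine (h3.congr_deriv ?_)
    have e1 := h.metric_compat hz (δ t) (P t)
    have e2 := congrArg Complex.re (h.herm _ hz (P t) (Γ (γ t) (δ t) (P t)))
    rw [Complex.conj_re] at e2
    simp [e1, e2]
    ring
  intro t ht
  have hc : ∀ x ∈ Icc (0:ℝ) 1, Nq G (γ x) (P x) = Nq G (γ 0) (P 0) := by
    apply constant_of_derivWithin_zero
    · exact fun t ht => (hd t ht).differentiableWithinAt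
    · intro t ht
      exact (hd t (Ico_subset_Icc_self ht)).derivWithin
        (uniqueDiffOn_Icc zero_lt_one t (Ico_subset_Icc_self ht))
  rw [hc t ht, ← h1, hc 1 (by simp)]

end transport

section energy
variable {E : Type*} [NormedAddCommGroup E] [NormedSpace ℂ E] [NormedSpace ℝ E]
  [IsScalarTower ℝ ℂ E]
variable {D : Set E} {G : E → E →L[ℝ] E →L[ℝ] ℂ} {Γ : E → E →L[ℝ] E →L[ℝ] E}

theorem aff_diff (x y : E) : (∀ᶠ z in 𝓝 (0:ℂ), DifferentiableAt ℂ (fun ζ : ℂ => x + ζ • y) z) ∧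
    DifferentiableAt ℂ (deriv (fun ζ : ℂ => x + ζ • y)) 0 ∧ deriv (fun ζ : ℂ => x + ζ • y) 0 = y := by
  have hd : ∀ z : ℂ, HasDerivAt (fun ζ : ℂ => x + ζ • y) y z := fun z => by
    simpa using ((hasDerivAt_id z).smul_const y).const_add x
  have e : deriv (fun ζ : ℂ => x + ζ • y) = fun _ => y := funext fun z => (hd z).deriv
  refine ⟨Eventually.of_forall fun z => (hd z).differentiableAt, ?_, (hd 0).deriv⟩
  rw [e]
  exact differentiableAt_const _

theorem contDiff_aff : ContDiff ℝ ∞ (fun q : (E × E) × ℂ => q.1.1 + q.2 • q.1.2) := by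
  fun_prop

/-- set of parameters where the variation stays in `D` -/
def Ovar (D : Set E) : Set ((E × E × E × E) × ℂ) := {q | q.1.1 + q.2 • q.1.2.1 ∈ D}

theorem Ovar_open (hD : IsOpen D) : IsOpen (Ovar D) := by
  have : Continuous (fun q : (E × E × E × E) × ℂ => q.1.1 + q.2 • q.1.2.1) := by fun_prop
  exact hD.preimage this

theorem HPre.contDiff_var (h : HPre D G) : ContDiffOn ℝ 2
    (fun q : (E × E × E × E) × ℂ => Nq G (q.1.1 + q.2 • q.1.2.1) (q.1.2.2.1 + q.2 • q.1.2.2.2))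
    (Ovar D) := by
  have h1 : ContDiff ℝ ∞ (fun q : (E × E × E × E) × ℂ => q.1.1 + q.2 • q.1.2.1) := by fun_prop
  have h2 : ContDiff ℝ ∞ (fun q : (E × E × E × E) × ℂ => q.1.2.2.1 + q.2 • q.1.2.2.2) := by fun_prop
  have h3 : ContDiffOn ℝ ∞ (fun q : (E × E × E × E) × ℂ => G (q.1.1 + q.2 • q.1.2.1)) (Ovar D) :=
    h.smooth.comp h1.contDiffOn (fun q hq => hq)
  have h4 := (h3.clm_apply h2.contDiffOn).clm_apply h2.contDiffOn
  exact (Complex.reCLM.contDiff.comp_contDiffOn h4).of_le (WithTop.coe_le_coe.2 le_top)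

theorem KPre.first_bound (h : KPre D G Γ) {z : E} (hz : z ∈ D) (ν V : E) (d : ℂ) (hd : ‖d‖ = 1) :
    |2 * (d * G z ν V).re| ≤ 2 * Real.sqrt (Nq G z ν * Nq G z V) := by
  rw [abs_mul, abs_of_pos (by norm_num : (0:ℝ) < 2)]
  gcongr
  refine (Complex.abs_re_le_norm _).trans ?_
  rw [norm_mul, hd, one_mul]
  refine Real.le_sqrt_of_sq_le ?_
  rw [← Complex.normSq_eq_norm_sq]
  exact h.cs hz ν V

set_option maxHeartbeats 1600000 in
/-- uniform variation of the squared norm, unscaled -/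
theorem KData.var_unscaled [ProperSpace E] {c₁ c₂ : ℝ} (h : KData D G Γ c₁ c₂)
    {K : Set E} (hK : IsCompact K) (hKD : K ⊆ D) (C1 C2 : ℝ) {η : ℝ} (hη : 0 < η) :
    ∃ r0 > (0:ℝ), ∀ r : ℝ, 0 < r → r ≤ r0 → ∀ z ∈ K, ∀ X V W : E, ‖X‖ ≤ C1 → ‖V‖ ≤ 1 → ‖W‖ ≤ C2 →
      (∀ ζ : ℂ, ζ = r ∨ ζ = -r ∨ ζ = r * Complex.I ∨ ζ = -r * Complex.I → z + ζ • X ∈ D ∧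
        |Nq G (z + ζ • X) (V + ζ • W) - Nq G z V| ≤
          r * (2 * Real.sqrt (Nq G z (W + Γ z X V) * Nq G z V)) + η * r) ∧
      Nq G (z + (r:ℂ) • X) (V + (r:ℂ) • W) + Nq G (z + (-r:ℂ) • X) (V + (-r:ℂ) • W) +
        (Nq G (z + (r * Complex.I) • X) (V + (r * Complex.I) • W) +
          Nq G (z + (-r * Complex.I) • X) (V + (-r * Complex.I) • W)) - 4 * Nq G z V ≤
        r ^ 2 * (4 * (c₂ * (Nq G z V * Nq G z X) + Nq G z (W + Γ z X V))) + 2 * η * r ^ 2 := by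
  set Kc : Set (E × E × E × E) := K ×ˢ closedBall 0 C1 ×ˢ closedBall 0 1 ×ˢ closedBall 0 C2 with hKc
  have hKcc : IsCompact Kc := hK.prod ((isCompact_closedBall _ _).prod
    ((isCompact_closedBall _ _).prod (isCompact_closedBall _ _)))
  have hKO : ∀ k ∈ Kc, (k, (0:ℂ)) ∈ Ovar D := by
    rintro ⟨z, X, V, W⟩ hk
    change z + (0:ℂ) • X ∈ D
    rw [zero_smul, add_zero]
    exact hKD hk.1
  have hΨ := h.toHPre.contDiff_var
  have hOo := Ovar_open h.isOpen
  have L := fun d : ℂ => lemU (W := E × E × E × E) hOo hΨ hKcc hKO d hη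
  obtain ⟨r1, hr1, H1⟩ := L 1
  obtain ⟨r2, hr2, H2⟩ := L Complex.I
  refine ⟨min r1 r2, lt_min hr1 hr2, fun r hr hrr z hz X V W hX hV hW => ?_⟩
  have hk : (z, X, V, W) ∈ Kc := by
    refine ⟨hz, ?_, ?_, ?_⟩ <;> simpa
  obtain ⟨m1, m2, A1⟩ := H1 _ hk r hr (hrr.trans (min_le_left _ _))
  obtain ⟨n1, n2, A2⟩ := H2 _ hk r hr (hrr.trans (min_le_right _ _))
  have hzD := hKD hz
  obtain ⟨q1, q2, q3⟩ := aff_diff z X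
  obtain ⟨p1, p2, p3⟩ := aff_diff V W
  obtain ⟨b1, b2, k1, k2, k3⟩ := h.key q1 q2 p1 p2 (by simpa using hzD)
  simp only [q3, p3, zero_smul, add_zero] at k1 k2 k3
  obtain ⟨s1, s2, s3⟩ := A1 _ _ k1
  obtain ⟨t1, t2, t3⟩ := A2 _ _ k2
  have B1 := h.first_bound hzD (W + Γ z X V) V 1 (by simp)
  have B2 := h.first_bound hzD (W + Γ z X V) V Complex.I (by simp)
  rw [one_mul] at B1
  simp only [mul_one, zero_smul, add_zero] at s1 s2 s3 t1 t2 t3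
  set B := 2 * Real.sqrt (Nq G z (W + Γ z X V) * Nq G z V) with hB
  set a1 := 2 * (G z (W + Γ z X V) V).re
  set a2 := 2 * (Complex.I * G z (W + Γ z X V) V).re
  have fin1 : ∀ y a : ℝ, |a| ≤ B → |y - Nq G z V - r * a| ≤ η * r → |y - Nq G z V| ≤ r * B + η * r := by
    intro y a ha hy
    rw [abs_le] at *
    constructor <;> nlinarith
  have fin2 : ∀ y a : ℝ, |a| ≤ B → |y - Nq G z V + r * a| ≤ η * r → |y - Nq G z V| ≤ r * B + η * r := by
    intro y a ha hy
    rw [abs_le] at *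
    constructor <;> nlinarith
  refine ⟨?_, ?_⟩
  · rintro ζ (rfl | rfl | rfl | rfl)
    · exact ⟨by simpa [Ovar] using m1, fin1 _ _ B1 s1⟩
    · exact ⟨by simpa [Ovar] using m2, fin2 _ _ B1 s2⟩
    · exact ⟨n1, fin1 _ _ B2 t1⟩
    · exact ⟨n2, fin2 _ _ B2 t2⟩
  · have hl := h.low z hzD V X
    rw [abs_le] at s3 t3
    have : r ^ 2 * (b1 + b2) ≤ r ^ 2 * (4 * (c₂ * (Nq G z V * Nq G z X) + Nq G z (W + Γ z X V))) := by
      gcongr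
      rw [k3]
      linarith
    linarith [s3.2, t3.2]

/-- uniform variation of the squared norm, scaled -/
theorem KData.var_scaled [ProperSpace E] {c₁ c₂ : ℝ} (h : KData D G Γ c₁ c₂)
    {K : Set E} (hK : IsCompact K) (hKD : K ⊆ D) (C1 C2 : ℝ) {η : ℝ} (hη : 0 < η) :
    ∃ r0 > (0:ℝ), ∀ r : ℝ, 0 < r → r ≤ r0 → ∀ z ∈ K, ∀ X V W : E, ∀ l : ℝ, 0 < l →
      ‖X‖ ≤ C1 → ‖V‖ ≤ l → ‖W‖ ≤ C2 * l →
      (∀ ζ : ℂ, ζ = r ∨ ζ = -r ∨ ζ = r * Complex.I ∨ ζ = -r * Complex.I → z + ζ • X ∈ D ∧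
        |Nq G (z + ζ • X) (V + ζ • W) - Nq G z V| ≤
          r * (2 * Real.sqrt (Nq G z (W + Γ z X V) * Nq G z V)) + η * r * l ^ 2) ∧
      Nq G (z + (r:ℂ) • X) (V + (r:ℂ) • W) + Nq G (z + (-r:ℂ) • X) (V + (-r:ℂ) • W) +
        (Nq G (z + (r * Complex.I) • X) (V + (r * Complex.I) • W) +
          Nq G (z + (-r * Complex.I) • X) (V + (-r * Complex.I) • W)) - 4 * Nq G z V ≤
        r ^ 2 * (4 * (c₂ * (Nq G z V * Nq G z X) + Nq G z (W + Γ z X V))) + 2 * η * r ^ 2 * l ^ 2 := by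
  obtain ⟨r0, hr0, H⟩ := h.var_unscaled hK hKD C1 C2 hη
  refine ⟨r0, hr0, fun r hr hrr z hz X V W l hl hX hV hW => ?_⟩
  have hV' : ‖l⁻¹ • V‖ ≤ 1 := by
    rw [norm_smul, norm_inv, Real.norm_of_nonneg hl.le, inv_mul_le_iff₀ hl, mul_one]; exact hV
  have hW' : ‖l⁻¹ • W‖ ≤ C2 := by
    rw [norm_smul, norm_inv, Real.norm_of_nonneg hl.le, inv_mul_le_iff₀ hl, mul_comm]; exact hW
  obtain ⟨A, B⟩ := H r hr hrr z hz X _ _ hX hV' hW'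
  have e0 : ∀ y, Nq G y (l⁻¹ • V) = (l⁻¹) ^ 2 * Nq G y V := fun y => Nq_rsmul y _ V
  have e1 : ∀ (y : E) (ζ : ℂ), Nq G y (l⁻¹ • V + ζ • (l⁻¹ • W)) = (l⁻¹) ^ 2 * Nq G y (V + ζ • W) := by
    intro y ζ
    rw [smul_comm ζ, ← smul_add, Nq_rsmul]
  have e2 : Nq G z (l⁻¹ • W + Γ z X (l⁻¹ • V)) = (l⁻¹) ^ 2 * Nq G z (W + Γ z X V) := by
    rw [map_smul, ← smul_add, Nq_rsmul]
  have hli : 0 < l⁻¹ := inv_pos.2 hl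
  have hll : l⁻¹ * l = 1 := inv_mul_cancel₀ hl.ne'
  have hl2 : l ^ 2 * (l⁻¹) ^ 2 = 1 := by rw [← mul_pow, mul_comm, hll, one_pow]
  simp only [e0, e1, e2] at A B
  refine ⟨fun ζ hζ => ⟨(A ζ hζ).1, ?_⟩, ?_⟩
  · have := (A ζ hζ).2
    rw [show (l⁻¹) ^ 2 * Nq G z (W + Γ z X V) * ((l⁻¹) ^ 2 * Nq G z V) =
      ((l⁻¹) ^ 2) ^ 2 * (Nq G z (W + Γ z X V) * Nq G z V) by ring, Real.sqrt_mul (by positivity),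
      Real.sqrt_sq (by positivity), ← mul_sub, abs_mul, abs_of_pos (by positivity)] at this
    have t2 := mul_le_mul_of_nonneg_left this (sq_nonneg l)
    rw [← mul_assoc, hl2, one_mul] at t2
    refine t2.trans (le_of_eq ?_)
    rw [mul_add]
    congr 1
    · calc _ = (l ^ 2 * (l⁻¹) ^ 2) * (r * (2 * √(Nq G z (W + Γ z X V) * Nq G z V))) := by ring
        _ = _ := by rw [hl2, one_mul]
    · ring
  · have t2 := mul_le_mul_of_nonneg_left B (sq_nonneg l)
    have g : ∀ x, l ^ 2 * ((l⁻¹) ^ 2 * x) = x := fun x => by rw [← mul_assoc, hl2, one_mul]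
    calc _ = l ^ 2 * ((l⁻¹) ^ 2 * (Nq G (z + (r:ℂ) • X) (V + (r:ℂ) • W) + Nq G (z + (-r:ℂ) • X) (V + (-r:ℂ) • W) +
        (Nq G (z + (r * Complex.I) • X) (V + (r * Complex.I) • W) +
          Nq G (z + (-r * Complex.I) • X) (V + (-r * Complex.I) • W)) - 4 * Nq G z V)) := (g _).symm
      _ ≤ _ := by refine le_trans (le_of_eq ?_) t2; ring
      _ = l ^ 2 * ((l⁻¹) ^ 2 * (r ^ 2 * (4 * (c₂ * (Nq G z V * Nq G z X) + Nq G z (W + Γ z X V)))))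
          + 2 * η * r ^ 2 * l ^ 2 := by ring
      _ = _ := by rw [g]

end energy

section energy2
variable {E : Type*} [NormedAddCommGroup E] [NormedSpace ℂ E] [NormedSpace ℝ E]
  [IsScalarTower ℝ ℂ E]
variable {D : Set E} {G : E → E →L[ℝ] E →L[ℝ] ℂ} {Γ : E → E →L[ℝ] E →L[ℝ] E}

/-- energy of a path -/
noncomputable def enr (G : E → E →L[ℝ] E →L[ℝ] ℂ) (γ δ : ℝ → E) : ℝ :=
  ∫ t in (0:ℝ)..1, Nq G (γ t) (δ t)

theorem HPre.intN (h : HPre D G) {γ δ : ℝ → E} (hp : IsPath D γ δ) :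
    IntervalIntegrable (fun t => Nq G (γ t) (δ t)) MeasureTheory.volume 0 1 :=
  ((h.contNpath hp).mono (by rw [uIcc_of_le zero_le_one])).intervalIntegrable

theorem int_mono01 {f g : ℝ → ℝ} (hf : IntervalIntegrable f MeasureTheory.volume 0 1)
    (hg : IntervalIntegrable g MeasureTheory.volume 0 1) (hfg : ∀ t ∈ Icc (0:ℝ) 1, f t ≤ g t) :
    ∫ t in (0:ℝ)..1, f t ≤ ∫ t in (0:ℝ)..1, g t :=
  intervalIntegral.integral_mono_on zero_le_one hf hg hfg

theorem KData.energy [ProperSpace E] {c₁ c₂ : ℝ} (h : KData D G Γ c₁ c₂) (hc₂ : 0 ≤ c₂)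
    {K : Set E} (hK : IsCompact K) (hKD : K ⊆ D) :
    ∃ r0 > (0:ℝ), ∀ r : ℝ, 0 < r → r ≤ r0 → ∀ γ δ : ℝ → E, IsPath D γ δ →
      (∀ t ∈ Icc (0:ℝ) 1, γ t ∈ K) → enr G γ δ ≤ 1 → ∀ v : E, Nq G (γ 1) v = 1 →
      ∃ X X' : ℝ → E, X 0 = 0 ∧ X 1 = v ∧
      (∀ ζ : ℂ, ζ = r ∨ ζ = -r ∨ ζ = r * Complex.I ∨ ζ = -r * Complex.I →
        IsPath D (fun t => γ t + ζ • X t) (fun t => δ t + ζ • X' t) ∧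
        |enr G (fun t => γ t + ζ • X t) (fun t => δ t + ζ • X' t) - enr G γ δ| ≤ 3 * r) ∧
      enr G (fun t => γ t + (r:ℂ) • X t) (fun t => δ t + (r:ℂ) • X' t) +
      enr G (fun t => γ t + (-r:ℂ) • X t) (fun t => δ t + (-r:ℂ) • X' t) +
      (enr G (fun t => γ t + (r * Complex.I) • X t) (fun t => δ t + (r * Complex.I) • X' t) +
      enr G (fun t => γ t + (-r * Complex.I) • X t) (fun t => δ t + (-r * Complex.I) • X' t)) -
      4 * enr G γ δ ≤ r ^ 2 * (4 * c₂ + 5) := by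
  have hcs : CompleteSpace E := inferInstance
  obtain ⟨m, hm, M, hM, hcmp⟩ := h.toHPre.cmp hK hKD
  obtain ⟨CG, hCG⟩ := hK.exists_bound_of_continuousOn (h.gamd.continuousOn.mono hKD)
  set CG' : ℝ := max CG 0 with hCG'
  have hCG0 : 0 ≤ CG' := le_max_right _ _
  have hCGb : ∀ z ∈ K, ‖Γ z‖ ≤ CG' := fun z hz => (hCG z hz).trans (le_max_left _ _)
  set C1 : ℝ := Real.sqrt (1 / m) with hC1
  have hC10 : 0 ≤ C1 := Real.sqrt_nonneg _
  set C2 : ℝ := C1 * (1 + CG') with hC2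
  set C : ℝ := 2 + 2 * (1 / m) with hC
  have hCpos : 0 < C := by positivity
  set η : ℝ := 1 / (2 * C) with hη
  have hη0 : 0 < η := by positivity
  have hηC : η * C = 1 / 2 := by rw [hη]; field_simp
  obtain ⟨r0, hr0, H⟩ := h.var_scaled hK hKD C1 C2 hη0
  refine ⟨r0, hr0, fun r hr hrr γ δ hp hγK he v hv => ?_⟩
  obtain ⟨P, hP1, hPd, hPN⟩ := h.transport hp v
  have hPc : ContinuousOn P (Icc 0 1) := fun t ht => (hPd t ht).continuousWithinAt
  have hΓc : ContinuousOn (fun t => Γ (γ t)) (Icc 0 1) :=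
    h.gamd.continuousOn.comp hp.contγ (fun t ht => hp.mem t ht)
  have hPN1 : ∀ t ∈ Icc (0:ℝ) 1, Nq G (γ t) (P t) = 1 := fun t ht => by rw [hPN t ht, hv]
  have hPb : ∀ t ∈ Icc (0:ℝ) 1, ‖P t‖ ≤ C1 := by
    intro t ht
    refine Real.le_sqrt_of_sq_le ?_
    have := (hcmp _ (hγK t ht) (P t)).1
    rw [hPN1 t ht] at this
    rw [le_div_iff₀ hm]; linarith
  set X : ℝ → E := fun t => t • P t with hX
  set X' : ℝ → E := fun t => P t - t • Γ (γ t) (δ t) (P t) with hX'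
  have hXd : ∀ t ∈ Icc (0:ℝ) 1, HasDerivWithinAt X (X' t) (Icc 0 1) t := by
    intro t ht
    have := (hasDerivWithinAt_id t (Icc (0:ℝ) 1)).smul (hPd t ht)
    refine this.congr_deriv ?_
    simp [hX', smul_neg]
    abel
  have hX'c : ContinuousOn X' (Icc 0 1) :=
    hPc.sub (continuousOn_id.smul ((hΓc.clm_apply hp.cont).clm_apply hPc))
  have hXb : ∀ t ∈ Icc (0:ℝ) 1, ‖X t‖ ≤ C1 := by
    intro t ht
    rw [hX, norm_smul, Real.norm_of_nonneg ht.1]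
    calc t * ‖P t‖ ≤ 1 * C1 := by gcongr; exact ht.2; exact hPb t ht
      _ = C1 := one_mul _
  have hX'b : ∀ t ∈ Icc (0:ℝ) 1, ‖X' t‖ ≤ C2 * (1 + ‖δ t‖) := by
    intro t ht
    have h1 : ‖Γ (γ t) (δ t) (P t)‖ ≤ CG' * ‖δ t‖ * C1 := by
      refine (ContinuousLinearMap.le_opNorm _ _).trans ?_
      gcongr
      · exact (Γ (γ t)).le_of_opNorm_le (hCGb _ (hγK t ht)) _
      · exact hPb t ht
    calc ‖X' t‖ ≤ ‖P t‖ + ‖t • Γ (γ t) (δ t) (P t)‖ := norm_sub_le _ _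
      _ ≤ C1 + 1 * (CG' * ‖δ t‖ * C1) := by
          rw [norm_smul, Real.norm_of_nonneg ht.1]
          gcongr
          · exact hPb t ht
          · exact ht.2
      _ ≤ C2 * (1 + ‖δ t‖) := by
          rw [hC2]
          have := norm_nonneg (δ t)
          have i1 : 0 ≤ C1 * CG' := by positivity
          have i2 : 0 ≤ C1 * ‖δ t‖ := by positivity
          nlinarith
  have hν : ∀ t ∈ Icc (0:ℝ) 1, X' t + Γ (γ t) (X t) (δ t) = P t := by
    intro t ht
    rw [h.toKPre.gam_symm (hp.mem t ht)]
    simp [hX, hX']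
  have hNX : ∀ t ∈ Icc (0:ℝ) 1, Nq G (γ t) (X t) ≤ 1 := by
    intro t ht
    rw [hX, Nq_rsmul, hPN1 t ht]
    nlinarith [ht.1, ht.2]
  have hHt := fun t (ht : t ∈ Icc (0:ℝ) 1) => H r hr hrr (γ t) (hγK t ht) (X t) (δ t) (X' t)
    (1 + ‖δ t‖) (by positivity) (hXb t ht) (by linarith [norm_nonneg (δ t)]) (hX'b t ht)
  have hpath : ∀ ζ : ℂ, ζ = r ∨ ζ = -r ∨ ζ = r * Complex.I ∨ ζ = -r * Complex.I →
      IsPath D (fun t => γ t + ζ • X t) (fun t => δ t + ζ • X' t) := by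
    intro ζ hζ
    refine ⟨fun t ht => ((hHt t ht).1 ζ hζ).1, fun t ht => ?_, ?_⟩
    · exact (hp.der t ht).add ((hXd t ht).const_smul ζ)
    · exact hp.cont.add (hX'c.const_smul ζ)
  have i0 := h.toHPre.intN hp
  have iδ : IntervalIntegrable (fun t => (1 + ‖δ t‖) ^ 2) MeasureTheory.volume 0 1 := by
    refine ContinuousOn.intervalIntegrable ?_
    rw [uIcc_of_le zero_le_one]
    exact (continuousOn_const.add hp.cont.norm).pow 2
  have ic : ∀ k : ℝ, IntervalIntegrable (fun _ : ℝ => k) MeasureTheory.volume 0 1 :=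
    fun k => intervalIntegrable_const
  have hlam : ∫ t in (0:ℝ)..1, (1 + ‖δ t‖) ^ 2 ≤ C := by
    calc ∫ t in (0:ℝ)..1, (1 + ‖δ t‖) ^ 2
        ≤ ∫ t in (0:ℝ)..1, (2 + (2 / m) * Nq G (γ t) (δ t)) := by
          refine int_mono01 iδ ((ic 2).add (i0.const_mul _)) fun t ht => ?_
          have h1 := (hcmp _ (hγK t ht) (δ t)).1
          have h2 : ‖δ t‖ ^ 2 ≤ (1 / m) * Nq G (γ t) (δ t) := by
            rw [one_div, le_inv_mul_iff₀ hm]; exact h1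
          have h3 : (2 / m) * Nq G (γ t) (δ t) = 2 * ((1 / m) * Nq G (γ t) (δ t)) := by ring
          nlinarith [sq_nonneg (1 - ‖δ t‖)]
      _ = 2 + (2 / m) * enr G γ δ := by
          rw [intervalIntegral.integral_add (ic 2) (i0.const_mul _),
            intervalIntegral.integral_const_mul]
          simp [enr]
      _ ≤ C := by
          rw [hC]
          have : (2 / m) * enr G γ δ ≤ (2 / m) * 1 := by gcongr
          have e : 2 * (1 / m) = (2 / m) * 1 := by ring
          linarith
  refine ⟨X, X', by simp [hX], by simp [hX, hP1], fun ζ hζ => ⟨hpath ζ hζ, ?_⟩, ?_⟩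
  · have iζ := h.toHPre.intN (hpath ζ hζ)
    unfold enr
    rw [← intervalIntegral.integral_sub iζ i0]
    have hb : ∀ t ∈ Icc (0:ℝ) 1, |Nq G (γ t + ζ • X t) (δ t + ζ • X' t) - Nq G (γ t) (δ t)| ≤
        r * (1 + Nq G (γ t) (δ t)) + η * r * (1 + ‖δ t‖) ^ 2 := by
      intro t ht
      refine ((hHt t ht).1 ζ hζ).2.trans ?_
      rw [hν t ht, hPN1 t ht, one_mul]
      have n0 := h.toKPre.N_nonneg (hp.mem t ht) (δ t)
      have : 2 * √(Nq G (γ t) (δ t)) ≤ 1 + Nq G (γ t) (δ t) := by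
        nlinarith [Real.sq_sqrt n0, sq_nonneg (1 - √(Nq G (γ t) (δ t)))]
      gcongr
    have ib : IntervalIntegrable (fun t => r * (1 + Nq G (γ t) (δ t)) + η * r * (1 + ‖δ t‖) ^ 2)
        MeasureTheory.volume 0 1 := (((ic 1).add i0).const_mul _).add (iδ.const_mul _)
    have hbi : ∫ t in (0:ℝ)..1, (r * (1 + Nq G (γ t) (δ t)) + η * r * (1 + ‖δ t‖) ^ 2) ≤ 3 * r := by
      rw [intervalIntegral.integral_add (((ic 1).add i0).const_mul _) (iδ.const_mul _),
        intervalIntegral.integral_const_mul, intervalIntegral.integral_const_mul,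
        intervalIntegral.integral_add (ic 1) i0]
      have e1 : ∫ t in (0:ℝ)..1, (1:ℝ) = 1 := by simp
      rw [e1]
      have he' : ∫ t in (0:ℝ)..1, Nq G (γ t) (δ t) ≤ 1 := he
      have j1 : r * (1 + ∫ t in (0:ℝ)..1, Nq G (γ t) (δ t)) ≤ r * 2 := by gcongr; linarith
      have j2 : η * r * ∫ t in (0:ℝ)..1, (1 + ‖δ t‖) ^ 2 ≤ η * r * C := by gcongr
      have j3 : η * r * C = r / 2 := by rw [mul_right_comm, hηC]; ring
      linarith
    refine le_trans ?_ hbi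
    rw [← Real.norm_eq_abs]
    refine intervalIntegral.norm_integral_le_of_norm_le zero_le_one ?_ ib
    refine Eventually.of_forall fun t ht => ?_
    exact hb t (Ioc_subset_Icc_self ht)
  · have I1 := h.toHPre.intN (hpath r (by simp))
    have I2 := h.toHPre.intN (hpath (-r) (by simp))
    have I3 := h.toHPre.intN (hpath (r * Complex.I) (by simp))
    have I4 := h.toHPre.intN (hpath (-r * Complex.I) (by simp))
    unfold enr
    rw [← intervalIntegral.integral_add I1 I2, ← intervalIntegral.integral_add I3 I4,
      ← intervalIntegral.integral_add (I1.add I2) (I3.add I4),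
      ← intervalIntegral.integral_const_mul, ← intervalIntegral.integral_sub
        ((I1.add I2).add (I3.add I4)) (i0.const_mul 4)]
    have ib : IntervalIntegrable (fun t => r ^ 2 * (4 * (c₂ * Nq G (γ t) (δ t) + 1)) +
        2 * η * r ^ 2 * (1 + ‖δ t‖) ^ 2) MeasureTheory.volume 0 1 :=
      ((((i0.const_mul c₂).add (ic 1)).const_mul 4).const_mul _).add (iδ.const_mul _)
    refine (int_mono01 (((I1.add I2).add (I3.add I4)).sub (i0.const_mul 4)) ib
      fun t ht => ?_).trans ?_
    · refine (hHt t ht).2.trans ?_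
      rw [hν t ht, hPN1 t ht]
      have n0 := h.toKPre.N_nonneg (hp.mem t ht) (δ t)
      have n1 := hNX t ht
      have : Nq G (γ t) (δ t) * Nq G (γ t) (X t) ≤ Nq G (γ t) (δ t) := by nlinarith
      gcongr
    · rw [intervalIntegral.integral_add
        ((((i0.const_mul c₂).add (ic 1)).const_mul 4).const_mul _) (iδ.const_mul _),
        intervalIntegral.integral_const_mul, intervalIntegral.integral_const_mul,
        intervalIntegral.integral_const_mul, intervalIntegral.integral_add (i0.const_mul c₂) (ic 1),
        intervalIntegral.integral_const_mul]
      have e1 : ∫ t in (0:ℝ)..1, (1:ℝ) = 1 := by simp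
      rw [e1]
      have he' : ∫ t in (0:ℝ)..1, Nq G (γ t) (δ t) ≤ 1 := he
      have j1 : r ^ 2 * (4 * (c₂ * (∫ t in (0:ℝ)..1, Nq G (γ t) (δ t)) + 1)) ≤
          r ^ 2 * (4 * (c₂ * 1 + 1)) := by gcongr
      have j2 : 2 * η * r ^ 2 * ∫ t in (0:ℝ)..1, (1 + ‖δ t‖) ^ 2 ≤ 2 * η * r ^ 2 * C := by gcongr
      have j3 : 2 * η * r ^ 2 * C = r ^ 2 := by
        calc _ = 2 * r ^ 2 * (η * C) := by ring
          _ = _ := by rw [hηC]; ring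
      linarith

end energy2

section logside

theorem HasD2.mul {φ ψ : ℝ → ℝ} {a b a' b' : ℝ} (h : HasD2 φ a b) (h' : HasD2 ψ a' b') :
    HasD2 (fun s => φ s * ψ s) (a * ψ 0 + φ 0 * a') (b * ψ 0 + 2 * (a * a') + φ 0 * b') := by
  have d1 := h.hasDerivAt
  have d2 := h'.hasDerivAt
  obtain ⟨φ1, h1, rfl, h3⟩ := h
  obtain ⟨ψ1, g1, rfl, g3⟩ := h'
  refine ⟨fun s => φ1 s * ψ s + φ s * ψ1 s, ?_, rfl, ?_⟩
  · filter_upwards [h1, g1] with s hs gs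
    exact hs.mul gs
  · refine ((h3.mul d2).add (d1.mul g3)).congr_deriv ?_
    ring

theorem hasD2_normSq {c : ℂ → ℂ} (hc : ∀ᶠ z in 𝓝 (0:ℂ), DifferentiableAt ℂ c z)
    (hc' : DifferentiableAt ℂ (deriv c) 0) (d : ℂ) :
    HasD2 (fun s : ℝ => Complex.normSq (c (s * d)))
      (2 * ((starRingEnd ℂ) (c 0) * (d * deriv c 0)).re)
      (2 * Complex.normSq (d * deriv c 0) +
        2 * ((starRingEnd ℂ) (c 0) * (d * d * deriv (deriv c) 0)).re) := by
  have k := hasD2_hol hc hc' d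
  have kr := k.clm Complex.reCLM
  have ki := k.clm Complex.imCLM
  have := (kr.mul kr).add (ki.mul ki)
  simp only [Complex.reCLM_apply, Complex.imCLM_apply, smul_eq_mul, Complex.ofReal_zero,
    zero_mul] at this
  convert this using 1
  · funext s
    exact Complex.normSq_apply _
  · simp only [Complex.mul_re, Complex.conj_re, Complex.conj_im]; ring
  · simp only [Complex.normSq_apply, Complex.mul_re (starRingEnd ℂ _), Complex.conj_re,
      Complex.conj_im]; ring

theorem log_normSq_lap {c : ℂ → ℂ} (hc : ∀ᶠ z in 𝓝 (0:ℂ), DifferentiableAt ℂ c z)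
    (hc' : DifferentiableAt ℂ (deriv c) 0) (h0 : c 0 ≠ 0) :
    ∃ a1 a2 b1 b2 : ℝ, HasD2 (fun s : ℝ => Real.log (Complex.normSq (c (s * 1)))) a1 b1 ∧
      HasD2 (fun s : ℝ => Real.log (Complex.normSq (c (s * Complex.I)))) a2 b2 ∧ b1 + b2 = 0 := by
  have k1 := hasD2_normSq hc hc' 1
  have k2 := hasD2_normSq hc hc' Complex.I
  have hp := Complex.normSq_pos.2 h0
  have l1 := k1.log (by simpa using hp)
  have l2 := k2.log (by simpa using hp)
  refine ⟨_, _, _, _, l1, l2, ?_⟩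
  simp only [Complex.ofReal_zero, zero_mul, one_mul, Complex.I_mul_I]
  have hne := hp.ne'
  rw [Complex.normSq_apply] at hne
  simp only [Complex.normSq_apply, Complex.mul_re, Complex.mul_im, Complex.conj_re,
      Complex.conj_im, Complex.I_re, Complex.I_im, Complex.neg_re, Complex.neg_im, Complex.one_re,
      Complex.one_im]
  field_simp
  ring

theorem log_disc_lap {c : ℂ → ℂ} (hc : ∀ᶠ z in 𝓝 (0:ℂ), DifferentiableAt ℂ c z)
    (hc' : DifferentiableAt ℂ (deriv c) 0) (h0 : 0 < 1 - Complex.normSq (c 0)) :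
    ∃ a1 a2 b1 b2 : ℝ, HasD2 (fun s : ℝ => Real.log (1 - Complex.normSq (c (s * 1)))) a1 b1 ∧
      HasD2 (fun s : ℝ => Real.log (1 - Complex.normSq (c (s * Complex.I)))) a2 b2 ∧
      b1 + b2 = - 4 * Complex.normSq (deriv c 0) / (1 - Complex.normSq (c 0)) ^ 2 := by
  have kc : HasD2 (fun _ : ℝ => (1:ℝ)) 0 0 :=
    ⟨fun _ => 0, Eventually.of_forall fun s => hasDerivAt_const _ _, rfl, hasDerivAt_const _ _⟩
  have k1 := kc.add ((hasD2_normSq hc hc' 1).const_mul (-1))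
  have k2 := kc.add ((hasD2_normSq hc hc' Complex.I).const_mul (-1))
  simp only [neg_mul, one_mul, ← sub_eq_add_neg, zero_sub] at k1 k2
  have l1 := k1.log (by simpa using h0)
  have l2 := k2.log (by simpa using h0)
  refine ⟨_, _, _, _, l1, l2, ?_⟩
  simp only [Complex.ofReal_zero, zero_mul, one_mul, Complex.I_mul_I]
  have hne := h0.ne'
  rw [Complex.normSq_apply] at hne
  simp only [Complex.normSq_apply, Complex.mul_re, Complex.mul_im, Complex.conj_re,
      Complex.conj_im, Complex.I_re, Complex.I_im, Complex.neg_re, Complex.neg_im, Complex.one_re,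
      Complex.one_im]
  field_simp
  ring

variable {E : Type*} [NormedAddCommGroup E] [NormedSpace ℂ E] [NormedSpace ℝ E]
  [IsScalarTower ℝ ℂ E]
variable {D : Set E} {G : E → E →L[ℝ] E →L[ℝ] ℂ} {Γ : E → E →L[ℝ] E →L[ℝ] E}

/-- ratio of the pulled back Poincare metric and the given metric -/
noncomputable def uq (f : E → ℂ) (G : E → E →L[ℝ] E →L[ℝ] ℂ) (x v : E) : ℝ :=
  Complex.normSq (fderiv ℂ f x v) / ((1 - Complex.normSq (f x)) ^ 2 * Nq G x v)

/-- logarithm of the ratio -/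
noncomputable def luq (f : E → ℂ) (G : E → E →L[ℝ] E →L[ℝ] ℂ) (x v : E) : ℝ :=
  Real.log (Complex.normSq (fderiv ℂ f x v)) + (-2 * Real.log (1 - Complex.normSq (f x)) +
    -1 * Real.log (Nq G x v))

theorem disc_pos {f : E → ℂ} (hm : MapsTo f D (ball 0 1)) {x : E} (hx : x ∈ D) :
    0 < 1 - Complex.normSq (f x) := by
  have : ‖f x‖ < 1 := by simpa using hm hx
  rw [Complex.normSq_eq_norm_sq]
  nlinarith [norm_nonneg (f x)]

theorem HPre.log_uq (h : HPre D G) {f : E → ℂ} (hm : MapsTo f D (ball 0 1)) {x v : E} (hx : x ∈ D)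
    (hv : fderiv ℂ f x v ≠ 0) : Real.log (uq f G x v) = luq f G x v := by
  have hv0 : v ≠ 0 := by rintro rfl; simp at hv
  have h1 := disc_pos hm hx
  have h2 := h.pos x hx v hv0
  have h3 := Complex.normSq_pos.2 hv
  unfold uq luq
  rw [Real.log_div h3.ne' (by unfold Nq; positivity), Real.log_mul (by positivity)
    (by unfold Nq; exact h2.ne'), Real.log_pow]
  push_cast
  ring

theorem HPre.uq_pos (h : HPre D G) {f : E → ℂ} (hm : MapsTo f D (ball 0 1)) {x v : E} (hx : x ∈ D)
    (hv : fderiv ℂ f x v ≠ 0) : 0 < uq f G x v := by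
  have hv0 : v ≠ 0 := by rintro rfl; simp at hv
  have h1 := disc_pos hm hx
  have h2 : 0 < Nq G x v := h.pos x hx v hv0
  have h3 := Complex.normSq_pos.2 hv
  unfold uq
  positivity

variable [FiniteDimensional ℂ E]

theorem hol_fderiv_contDiffOn (hD : IsOpen D) {f : E → ℂ} (hf : DifferentiableOn ℂ f D) :
    ContDiffOn ℂ 2 (fderiv ℂ f) D :=
  (hol_contDiffOn hD 3 hf).fderiv_of_isOpen hD (by norm_num)

theorem var_f (hD : IsOpen D) {f : E → ℂ} (hf : DifferentiableOn ℂ f D) :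
    ContDiffOn ℝ 2 (fun q : (E × E × E × E) × ℂ => f (q.1.1 + q.2 • q.1.2.1)) (Ovar D) := by
  have h1 : ContDiff ℂ 2 (fun q : (E × E × E × E) × ℂ => q.1.1 + q.2 • q.1.2.1) := by fun_prop
  exact ((hol_contDiffOn hD 2 hf).comp h1.contDiffOn (fun q hq => hq)).restrict_scalars ℝ

theorem var_F (hD : IsOpen D) {f : E → ℂ} (hf : DifferentiableOn ℂ f D) :
    ContDiffOn ℝ 2 (fun q : (E × E × E × E) × ℂ =>
      fderiv ℂ f (q.1.1 + q.2 • q.1.2.1) (q.1.2.2.1 + q.2 • q.1.2.2.2)) (Ovar D) := by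
  have h1 : ContDiff ℂ 2 (fun q : (E × E × E × E) × ℂ => q.1.1 + q.2 • q.1.2.1) := by fun_prop
  have h2 : ContDiff ℂ 2 (fun q : (E × E × E × E) × ℂ => q.1.2.2.1 + q.2 • q.1.2.2.2) := by fun_prop
  have h3 : ContDiffOn ℂ 2 (fun q : (E × E × E × E) × ℂ => fderiv ℂ f (q.1.1 + q.2 • q.1.2.1)) (Ovar D) :=
    (hol_fderiv_contDiffOn hD hf).comp h1.contDiffOn (fun q hq => hq)
  exact (h3.clm_apply h2.contDiffOn).restrict_scalars ℝ

/-- parameters where the logarithm is smooth -/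
def Olog (D : Set E) (f : E → ℂ) : Set ((E × E × E × E) × ℂ) :=
  Ovar D ∩ {q | fderiv ℂ f (q.1.1 + q.2 • q.1.2.1) (q.1.2.2.1 + q.2 • q.1.2.2.2) ≠ 0}

theorem Olog_open (hD : IsOpen D) {f : E → ℂ} (hf : DifferentiableOn ℂ f D) : IsOpen (Olog D f) :=
  (var_F hD hf).continuousOn.isOpen_inter_preimage (Ovar_open hD) (isOpen_compl_singleton (x := (0:ℂ)))

theorem contDiff_normSq : ContDiff ℝ 2 (fun z : ℂ => Complex.normSq z) := by
  simp only [Complex.normSq_apply]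
  exact ((Complex.reCLM.contDiff.mul Complex.reCLM.contDiff).add
    (Complex.imCLM.contDiff.mul Complex.imCLM.contDiff))

theorem HPre.var_luq (h : HPre D G) {f : E → ℂ} (hf : DifferentiableOn ℂ f D)
    (hm : MapsTo f D (ball 0 1)) :
    ContDiffOn ℝ 2 (fun q : (E × E × E × E) × ℂ =>
      luq f G (q.1.1 + q.2 • q.1.2.1) (q.1.2.2.1 + q.2 • q.1.2.2.2)) (Olog D f) := by
  unfold luq
  have hs : Olog D f ⊆ Ovar D := inter_subset_left
  refine ContDiffOn.add ?_ (ContDiffOn.add ?_ ?_)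
  · refine ContDiffOn.log ?_ ?_
    · exact contDiff_normSq.comp_contDiffOn ((var_F h.isOpen hf).mono hs)
    · intro q hq
      exact (Complex.normSq_pos.2 hq.2).ne'
  · refine contDiffOn_const.mul (ContDiffOn.log ?_ ?_)
    · exact contDiffOn_const.sub (contDiff_normSq.comp_contDiffOn ((var_f h.isOpen hf).mono hs))
    · intro q hq
      exact (disc_pos hm hq.1).ne'
  · refine contDiffOn_const.mul (ContDiffOn.log (h.contDiff_var.mono hs) ?_)
    intro q hq
    have hv0 : q.1.2.2.1 + q.2 • q.1.2.2.2 ≠ 0 := by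
      intro hh
      exact hq.2 (by rw [hh]; simp)
    exact (h.pos _ hq.1 _ hv0).ne'

end logside

section logside2
variable {E : Type*} [NormedAddCommGroup E] [NormedSpace ℂ E] [NormedSpace ℝ E]
  [IsScalarTower ℝ ℂ E]
variable {D : Set E} {G : E → E →L[ℝ] E →L[ℝ] ℂ} {Γ : E → E →L[ℝ] E →L[ℝ] E}
variable [FiniteDimensional ℂ E]

/-- pointwise Laplacian of the logarithm of the ratio -/
theorem KData.luq_lap {c₁ c₂ : ℝ} (h : KData D G Γ c₁ c₂) {f : E → ℂ} (hf : DifferentiableOn ℂ f D)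
    (hm : MapsTo f D (ball 0 1)) {x v : E} (hx : x ∈ D) (hN : Nq G x v = 1)
    (hv : fderiv ℂ f x v ≠ 0) :
    ∃ a1 a2 b1 b2 : ℝ,
      HasD2 (fun s : ℝ => luq f G (x + ((s : ℂ) * 1) • v) (v + ((s : ℂ) * 1) • (- Γ x v v))) a1 b1 ∧
      HasD2 (fun s : ℝ => luq f G (x + ((s : ℂ) * Complex.I) • v)
        (v + ((s : ℂ) * Complex.I) • (- Γ x v v))) a2 b2 ∧
      8 * uq f G x v - 4 * c₂ ≤ b1 + b2 := by
  have hv0 : v ≠ 0 := by rintro rfl; simp at hv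
  obtain ⟨q1, q2, q3⟩ := aff_diff x v
  obtain ⟨p1, p2, p3⟩ := aff_diff v (- Γ x v v)
  obtain ⟨n1, n2, d1, d2, N1, N2, -, N3⟩ := h.key_log q1 q2 p1 p2 (by simpa using hx) (by simpa using hv0)
  simp only [q3, p3, zero_smul, add_zero] at N3
  have N3 := N3 (by simp)
  rw [hN, div_one] at N3
  -- holomorphic functions
  set O : Set ℂ := (fun ζ : ℂ => x + ζ • v) ⁻¹' D with hO
  have hOo : IsOpen O := h.isOpen.preimage (by fun_prop)
  have h0O : (0:ℂ) ∈ O := by simpa [hO] using hx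
  have hOn := hOo.mem_nhds h0O
  have haff : ∀ y w : E, Differentiable ℂ (fun ζ : ℂ => y + ζ • w) := fun y w => by fun_prop
  have hφ : DifferentiableOn ℂ (fun ζ : ℂ => f (x + ζ • v)) O :=
    hf.comp (haff x v).differentiableOn (fun ζ hζ => hζ)
  have hF : DifferentiableOn ℂ (fun ζ : ℂ => fderiv ℂ f (x + ζ • v) (v + ζ • (- Γ x v v))) O := by
    have := ((hol_fderiv_contDiffOn h.isOpen hf).differentiableOn (by norm_num)).comp
      (haff x v).differentiableOn (s := O) (fun ζ hζ => hζ)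
    exact this.clm_apply (haff _ _).differentiableOn
  have ev : ∀ {c : ℂ → ℂ}, DifferentiableOn ℂ c O → (∀ᶠ z in 𝓝 (0:ℂ), DifferentiableAt ℂ c z) ∧
      DifferentiableAt ℂ (deriv c) 0 := by
    intro c hc
    refine ⟨?_, (hc.deriv hOo).differentiableAt hOn⟩
    filter_upwards [hOo.mem_nhds h0O] with z hz
    exact hc.differentiableAt (hOo.mem_nhds hz)
  obtain ⟨f1, f2, g1, g2, F1, F2, F3⟩ := log_normSq_lap (ev hF).1 (ev hF).2 (by simpa using hv)
  obtain ⟨s1, s2, t1, t2, S1, S2, S3⟩ := log_disc_lap (ev hφ).1 (ev hφ).2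
    (by simpa using disc_pos hm hx)
  have hd : deriv (fun ζ : ℂ => f (x + ζ • v)) 0 = fderiv ℂ f x v := by
    have hfx : HasFDerivAt f (fderiv ℂ f x) (x + (0:ℂ) • v) := by
      rw [zero_smul, add_zero]
      exact (hf.differentiableAt (h.isOpen.mem_nhds hx)).hasFDerivAt
    have ha : HasDerivAt (fun ζ : ℂ => x + ζ • v) v 0 := by
      simpa using ((hasDerivAt_id (0:ℂ)).smul_const v).const_add x
    exact (hfx.comp_hasDerivAt (0:ℂ) ha).deriv
  rw [hd] at S3
  simp only [zero_smul, add_zero] at S3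
  refine ⟨_, _, _, _, F1.add ((S1.const_mul (-2)).add (N1.const_mul (-1))),
    F2.add ((S2.const_mul (-2)).add (N2.const_mul (-1))), ?_⟩
  have hl := h.low x hx v v
  rw [hN] at hl
  have hu : 8 * uq f G x v = -2 * (- 4 * Complex.normSq (fderiv ℂ f x v) / (1 - Complex.normSq (f x)) ^ 2) := by
    unfold uq
    rw [hN]; ring
  linarith

theorem HPre.K2_compact [ProperSpace E] (h : HPre D G) {f : E → ℂ} (hf : DifferentiableOn ℂ f D)
    {K : Set E} (hK : IsCompact K) (hKD : K ⊆ D) (δ0 : ℝ) :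
    IsCompact {q : E × E | q.1 ∈ K ∧ Nq G q.1 q.2 = 1 ∧
      δ0 * ((1 - Complex.normSq (f q.1)) ^ 2 * Nq G q.1 q.2) ≤ Complex.normSq (fderiv ℂ f q.1 q.2)} := by
  obtain ⟨m, hm, M, hM, hcmp⟩ := h.cmp hK hKD
  set B : Set (E × E) := K ×ˢ closedBall 0 (Real.sqrt (1 / m)) with hB
  have hBc : IsCompact B := hK.prod (isCompact_closedBall _ _)
  have hBs : ∀ q ∈ B, q.1 ∈ D := fun q hq => hKD hq.1
  have cN : ContinuousOn (fun q : E × E => Nq G q.1 q.2) B :=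
    h.contN.mono (fun q hq => ⟨hBs q hq, mem_univ _⟩)
  have cf : ContinuousOn (fun q : E × E => f q.1) B :=
    hf.continuousOn.comp continuousOn_fst hBs
  have cF : ContinuousOn (fun q : E × E => fderiv ℂ f q.1 q.2) B :=
    ((hol_fderiv_contDiffOn h.isOpen hf).continuousOn.comp continuousOn_fst hBs).clm_apply
      continuousOn_snd
  have cφ : ContinuousOn (fun q : E × E => (Nq G q.1 q.2, Complex.normSq (fderiv ℂ f q.1 q.2) -
      δ0 * ((1 - Complex.normSq (f q.1)) ^ 2 * Nq G q.1 q.2))) B := by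
    refine cN.prodMk ((Complex.continuous_normSq.comp_continuousOn cF).sub
      (continuousOn_const.mul (((continuousOn_const.sub
        (Complex.continuous_normSq.comp_continuousOn cf)).pow 2).mul cN)))
  have hcl := cφ.preimage_isClosed_of_isClosed hBc.isClosed
    ((isClosed_singleton (x := (1:ℝ))).prod (isClosed_Ici (a := (0:ℝ))))
  convert hBc.of_isClosed_subset hcl inter_subset_left using 1
  ext q
  constructor
  swap
  · rintro ⟨⟨h1, h2⟩, h3, h4⟩
    exact ⟨h1, h3, sub_nonneg.1 h4⟩
  · rintro ⟨h1, h2, h3⟩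
    refine ⟨⟨h1, ?_⟩, h2, sub_nonneg.2 h3⟩
    rw [mem_closedBall_zero_iff]
    refine Real.le_sqrt_of_sq_le ?_
    have := (hcmp _ h1 q.2).1
    rw [h2] at this
    rw [le_div_iff₀ hm]; linarith

theorem KData.logside [ProperSpace E] {c₁ c₂ : ℝ} (h : KData D G Γ c₁ c₂) {f : E → ℂ}
    (hf : DifferentiableOn ℂ f D) (hm : MapsTo f D (ball 0 1))
    {K : Set E} (hK : IsCompact K) (hKD : K ⊆ D) {δ0 : ℝ} (hδ0 : 0 < δ0) :
    ∃ r0 > (0:ℝ), ∀ r : ℝ, 0 < r → r ≤ r0 → ∀ x ∈ K, ∀ v : E, Nq G x v = 1 → δ0 ≤ uq f G x v →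
      ∃ a : E, (∀ ζ : ℂ, ζ = r ∨ ζ = -r ∨ ζ = r * Complex.I ∨ ζ = -r * Complex.I →
        x + ζ • v ∈ D ∧ fderiv ℂ f (x + ζ • v) (v + ζ • a) ≠ 0) ∧
      r ^ 2 * (8 * uq f G x v - 4 * c₂ - 2) ≤
        luq f G (x + (r:ℂ) • v) (v + (r:ℂ) • a) + luq f G (x + (-r:ℂ) • v) (v + (-r:ℂ) • a) +
        (luq f G (x + (r * Complex.I) • v) (v + (r * Complex.I) • a) +
          luq f G (x + (-r * Complex.I) • v) (v + (-r * Complex.I) • a)) - 4 * luq f G x v := by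
  set K2 := {q : E × E | q.1 ∈ K ∧ Nq G q.1 q.2 = 1 ∧
      δ0 * ((1 - Complex.normSq (f q.1)) ^ 2 * Nq G q.1 q.2) ≤ Complex.normSq (fderiv ℂ f q.1 q.2)} with hK2
  have hK2c : IsCompact K2 := h.toHPre.K2_compact hf hK hKD δ0
  have hne : ∀ q ∈ K2, fderiv ℂ f q.1 q.2 ≠ 0 := by
    intro q hq h0
    have h1 := hq.2.2
    have h2 := disc_pos hm (hKD hq.1)
    rw [h0, hq.2.1] at h1
    simp only [map_zero, mul_one] at h1
    have : 0 < δ0 * (1 - Complex.normSq (f q.1)) ^ 2 := by positivity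
    linarith
  set J : E × E → E × E × E × E := fun q => (q.1, q.2, q.2, - Γ q.1 q.2 q.2) with hJ
  have hJc : ContinuousOn J K2 := by
    have c1 : ContinuousOn (fun q : E × E => Γ q.1) K2 :=
      h.gamd.continuousOn.comp continuousOn_fst (fun q hq => hKD hq.1)
    exact continuousOn_fst.prodMk (continuousOn_snd.prodMk (continuousOn_snd.prodMk
      ((c1.clm_apply continuousOn_snd).clm_apply continuousOn_snd).neg))
  have hKcc : IsCompact (J '' K2) := hK2c.image_of_continuousOn hJc
  have hKO : ∀ k ∈ J '' K2, (k, (0:ℂ)) ∈ Olog D f := by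
    rintro _ ⟨q, hq, rfl⟩
    refine ⟨?_, ?_⟩
    · change q.1 + (0:ℂ) • q.2 ∈ D
      rw [zero_smul, add_zero]; exact hKD hq.1
    · change fderiv ℂ f (q.1 + (0:ℂ) • q.2) (q.2 + (0:ℂ) • _) ≠ 0
      rw [zero_smul, add_zero, zero_smul, add_zero]; exact hne q hq
  have hΨ := h.toHPre.var_luq hf hm
  have hOo := Olog_open h.isOpen hf
  have L := fun d : ℂ => lemU (W := E × E × E × E) hOo hΨ hKcc hKO d one_pos
  obtain ⟨r1, hr1, H1⟩ := L 1
  obtain ⟨r2, hr2, H2⟩ := L Complex.I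
  refine ⟨min r1 r2, lt_min hr1 hr2, fun r hr hrr x hx v hN hu => ⟨- Γ x v v, ?_⟩⟩
  have hq : (x, v) ∈ K2 := by
    refine ⟨hx, hN, ?_⟩
    unfold uq at hu
    have h2 := disc_pos hm (hKD hx)
    have h3 : 0 < (1 - Complex.normSq (f x)) ^ 2 * Nq G x v := by rw [hN]; positivity
    exact (le_div_iff₀ h3).1 hu
  have hk : (x, v, v, - Γ x v v) ∈ J '' K2 := ⟨(x, v), hq, rfl⟩
  obtain ⟨m1, m2, A1⟩ := H1 _ hk r hr (hrr.trans (min_le_left _ _))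
  obtain ⟨n1, n2, A2⟩ := H2 _ hk r hr (hrr.trans (min_le_right _ _))
  obtain ⟨a1, a2, b1, b2, k1, k2, k3⟩ := h.luq_lap hf hm (hKD hx) hN (hne _ hq)
  obtain ⟨-, -, s3⟩ := A1 _ _ k1
  obtain ⟨-, -, t3⟩ := A2 _ _ k2
  rw [mul_one] at m1 m2
  refine ⟨?_, ?_⟩
  · rintro ζ (rfl | rfl | rfl | rfl)
    · exact m1
    · exact m2
    · exact n1
    · exact n2
  · simp only [mul_one, zero_smul, add_zero] at s3 t3
    rw [abs_le] at s3 t3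
    have : r ^ 2 * (8 * uq f G x v - 4 * c₂) ≤ r ^ 2 * (b1 + b2) := by gcongr
    linarith [s3.1, t3.1]

end logside2

section yau

theorem neg_log_le_aux {d : ℝ} (hd : |d| ≤ 1 / 2) : - Real.log (1 - d) ≤ d + d ^ 2 := by
  have h1 := abs_le.1 hd
  have hpos : 0 < 1 - d := by linarith
  have key : 1 ≤ (1 - d) * Real.exp (d + d ^ 2) := by
    rcases le_total d 0 with h | h
    · have := Real.add_one_le_exp (d + d ^ 2)
      have h3 : (1 - d) * (d + d ^ 2 + 1) ≤ (1 - d) * Real.exp (d + d ^ 2) :=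
        mul_le_mul_of_nonneg_left this hpos.le
      have h4 : 0 ≤ (-d) ^ 3 := pow_nonneg (by linarith) 3
      nlinarith
    · have := Real.quadratic_le_exp_of_nonneg (x := d + d ^ 2) (by positivity)
      have h3 := mul_le_mul_of_nonneg_left this hpos.le
      have h4 : 0 ≤ d ^ 2 * ((1 - d) * (1 + d) ^ 2 / 2 - d) := by
        refine mul_nonneg (sq_nonneg d) ?_
        nlinarith [mul_nonneg h h, mul_nonneg (mul_nonneg h h) (sub_nonneg.2 h1.2), mul_nonneg h (sub_nonneg.2 h1.2)]
      nlinarith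
  have := Real.log_nonneg key
  rw [Real.log_mul hpos.ne' (Real.exp_pos _).ne', Real.log_exp] at this
  linarith

theorem log_term {e0 e r : ℝ} (hm : 0 < 1 - e0) (hr : 6 * r ≤ 1 - e0) (he : |e - e0| ≤ 3 * r) :
    Real.log (1 - e0) - Real.log (1 - e) ≤ (e - e0) / (1 - e0) + 9 * r ^ 2 / (1 - e0) ^ 2 := by
  have hd : |(e - e0) / (1 - e0)| ≤ 1 / 2 := by
    rw [abs_div, abs_of_pos hm, div_le_iff₀ hm]; linarith
  have h1 := neg_log_le_aux hd
  have h2 : 1 - (e - e0) / (1 - e0) = (1 - e) / (1 - e0) := by field_simp; ring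
  have h3 := abs_le.1 he
  have h4 : 0 < 1 - e := by linarith
  rw [h2, Real.log_div h4.ne' hm.ne'] at h1
  have h5 : ((e - e0) / (1 - e0)) ^ 2 ≤ 9 * r ^ 2 / (1 - e0) ^ 2 := by
    rw [div_pow]
    gcongr
    nlinarith
  linarith

variable {E : Type*} [NormedAddCommGroup E] [NormedSpace ℂ E] [NormedSpace ℝ E]
  [IsScalarTower ℝ ℂ E]
variable {D : Set E} {G : E → E →L[ℝ] E →L[ℝ] ℂ} {Γ : E → E →L[ℝ] E →L[ℝ] E}

theorem HPre.N_nonneg2 (h : HPre D G) {z : E} (hz : z ∈ D) (v : E) : 0 ≤ Nq G z v := by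
  by_cases hv : v = 0
  · simp [hv, Nq]
  · exact (h.pos z hz v hv).le

theorem HPre.enr_nonneg (h : HPre D G) {γ δ : ℝ → E} (hp : IsPath D γ δ) : 0 ≤ enr G γ δ :=
  intervalIntegral.integral_nonneg zero_le_one fun t ht => h.N_nonneg2 (hp.mem t ht) _

theorem HPre.confine (h : HPre D G) {p : E} (hP : PreC D G p 2) :
    ∃ K, IsCompact K ∧ K ⊆ D ∧ ∀ γ δ : ℝ → E, IsPath D γ δ → γ 0 = p → enr G γ δ ≤ 1 →
      ∀ t ∈ Icc (0:ℝ) 1, γ t ∈ K := by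
  obtain ⟨K, hK, hKD, hb⟩ := hP
  refine ⟨K, hK, hKD, fun γ δ hp h0 he t ht => hb _ (hp.mem t ht) ?_⟩
  have h1 := dK_sub h hp le_rfl ht.1 ht.2
  have hcs := h.contSpd hp
  have hi : IntervalIntegrable (spd G γ δ) MeasureTheory.volume 0 1 :=
    (hcs.mono (by rw [uIcc_of_le zero_le_one])).intervalIntegrable
  have h2 : ∫ s in (0:ℝ)..t, spd G γ δ s ≤ ∫ s in (0:ℝ)..1, spd G γ δ s :=
    intervalIntegral.integral_mono_interval le_rfl ht.1 ht.2
      (Eventually.of_forall fun s => spd_nonneg _ _ _) hi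
  have h3 : ∫ s in (0:ℝ)..1, spd G γ δ s ≤ ∫ s in (0:ℝ)..1, (1 / 2) * (1 + Nq G (γ s) (δ s)) := by
    refine int_mono01 hi (((intervalIntegrable_const).add (h.intN hp)).const_mul _) fun s hs => ?_
    have hN := h.N_nonneg2 (hp.mem s hs) (δ s)
    have := Real.sq_sqrt hN
    unfold spd
    nlinarith [sq_nonneg (Real.sqrt (Nq G (γ s) (δ s)) - 1)]
  rw [intervalIntegral.integral_const_mul, intervalIntegral.integral_add intervalIntegrable_const
    (h.intN hp)] at h3
  have h4 : ∫ s in (0:ℝ)..1, Nq G (γ s) (δ s) ≤ 1 := he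
  simp only [intervalIntegral.integral_const, sub_zero, smul_eq_mul, mul_one] at h3
  rw [h0] at h1
  linarith

theorem uq_smul (f : E → ℂ) (x v : E) {c : ℝ} (hc : c ≠ 0) : uq f G x (c • v) = uq f G x v := by
  unfold uq
  have h1 : c • v = (c : ℂ) • v := by
    rw [← algebraMap_smul ℂ c v]; rfl
  have h2 : fderiv ℂ f x (c • v) = (c : ℂ) * fderiv ℂ f x v := by
    rw [h1, map_smul, smul_eq_mul]
  rw [h2, Nq_rsmul, Complex.normSq_mul, Complex.normSq_ofReal]
  rw [show (1 - Complex.normSq (f x)) ^ 2 * (c ^ 2 * Nq G x v) =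
    (c * c) * ((1 - Complex.normSq (f x)) ^ 2 * Nq G x v) by ring]
  exact mul_div_mul_left _ _ (mul_ne_zero hc hc)

theorem HPre.uq_bdd [FiniteDimensional ℂ E] [ProperSpace E] (h : HPre D G) {f : E → ℂ}
    (hf : DifferentiableOn ℂ f D) (hm : MapsTo f D (ball 0 1)) {K : Set E} (hK : IsCompact K)
    (hKD : K ⊆ D) : ∃ U > 0, ∀ x ∈ K, ∀ v, uq f G x v ≤ U := by
  obtain ⟨m, hm0, M, hM, hcmp⟩ := h.cmp hK hKD
  obtain ⟨C, hC⟩ := hK.exists_bound_of_continuousOn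
    ((hol_fderiv_contDiffOn h.isOpen hf).continuousOn.mono hKD)
  obtain ⟨q, hq0, hq⟩ : ∃ q > 0, ∀ x ∈ K, q ≤ 1 - Complex.normSq (f x) := by
    rcases K.eq_empty_or_nonempty with rfl | hne
    · exact ⟨1, one_pos, by simp⟩
    · have hcont : ContinuousOn (fun x => 1 - Complex.normSq (f x)) K :=
        continuousOn_const.sub (Complex.continuous_normSq.comp_continuousOn
          (hf.continuousOn.mono hKD))
      obtain ⟨x0, hx0, hmin⟩ := hK.exists_isMinOn hne hcont
      exact ⟨_, disc_pos hm (hKD hx0), fun x hx => hmin hx⟩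
  refine ⟨C ^ 2 / (q ^ 2 * m) + 1, by positivity, fun x hx v => ?_⟩
  have : uq f G x v ≤ C ^ 2 / (q ^ 2 * m) := by
    unfold uq
    by_cases hv : v = 0
    · subst hv; simp; positivity
    have hn : 0 < ‖v‖ := norm_pos_iff.2 hv
    have h1 : Complex.normSq (fderiv ℂ f x v) ≤ C ^ 2 * ‖v‖ ^ 2 := by
      rw [Complex.normSq_eq_norm_sq, ← mul_pow]
      exact pow_le_pow_left₀ (norm_nonneg _) (((fderiv ℂ f x).le_opNorm v).trans
        (mul_le_mul_of_nonneg_right (hC x hx) hn.le)) 2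
    have h2 : q ^ 2 * (m * ‖v‖ ^ 2) ≤ (1 - Complex.normSq (f x)) ^ 2 * Nq G x v :=
      mul_le_mul (pow_le_pow_left₀ hq0.le (hq x hx) 2) (hcmp x hx v).1 (by positivity)
        (by positivity)
    calc _ ≤ C ^ 2 * ‖v‖ ^ 2 / (q ^ 2 * (m * ‖v‖ ^ 2)) := by gcongr
      _ = _ := by field_simp
  linarith

set_option maxHeartbeats 1000000 in
theorem KData.yau [FiniteDimensional ℂ E] [ProperSpace E] {c₁ c₂ : ℝ} (h : KData D G Γ c₁ c₂)
    (hc₂ : 0 ≤ c₂) {f : E → ℂ} (hf : DifferentiableOn ℂ f D) (hm : MapsTo f D (ball 0 1))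
    {p : E} (hp : p ∈ D) (hP : PreC D G p 2) {v0 : E} (hv0 : fderiv ℂ f p v0 ≠ 0) :
    uq f G p v0 ≤ 2 * c₂ + 15 := by
  have hH := h.toHPre
  obtain ⟨K, hK, hKD, hconf⟩ := hH.confine hP
  obtain ⟨U, hU0, hU⟩ := hH.uq_bdd hf hm hK hKD
  set δ0 : ℝ := uq f G p v0 with hδ0
  have hδpos : 0 < δ0 := hH.uq_pos hm hp hv0
  obtain ⟨r1, hr1, H1⟩ := h.energy hc₂ hK hKD
  obtain ⟨r2, hr2, H2⟩ := h.logside hf hm hK hKD (half_pos hδpos)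
  set m0 : ℝ := Real.sqrt (δ0 / (2 * U)) with hm0
  have hm0p : 0 < m0 := Real.sqrt_pos.2 (by positivity)
  obtain ⟨r, hr, hrr1, hrr2, hrh, hrm⟩ : ∃ r : ℝ, 0 < r ∧ r ≤ r1 ∧ r ≤ r2 ∧ r ≤ 1 / 2 ∧ 6 * r ≤ m0 := by
    refine ⟨min (min r1 r2) (min (1 / 2) (m0 / 6)), by positivity, ?_, ?_, ?_, ?_⟩
    · exact (min_le_left _ _).trans (min_le_left _ _)
    · exact (min_le_left _ _).trans (min_le_right _ _)
    · exact (min_le_right _ _).trans (min_le_left _ _)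
    · have := (min_le_right (min r1 r2) (min (1 / 2) (m0 / 6))).trans (min_le_right _ _)
      linarith
  set S : Set ℝ := {a : ℝ | ∃ γ δ : ℝ → E, ∃ v : E, IsPath D γ δ ∧ γ 0 = p ∧ enr G γ δ < 1 ∧
    a = (1 - enr G γ δ) ^ 2 * uq f G (γ 1) v} with hS
  have one_mem : (1:ℝ) ∈ Icc (0:ℝ) 1 := ⟨zero_le_one, le_rfl⟩
  have hSb : BddAbove S := by
    refine ⟨U, ?_⟩
    rintro a ⟨γ, δ, v, hpa, h0, he, rfl⟩
    have h1 := hU _ (hconf γ δ hpa h0 he.le 1 one_mem) v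
    have h2 := hH.enr_nonneg hpa
    have h3 : (1 - enr G γ δ) ^ 2 ≤ 1 := by nlinarith
    calc _ ≤ (1 - enr G γ δ) ^ 2 * U := by gcongr
      _ ≤ 1 * U := by gcongr
      _ = U := one_mul U
  have hδS : δ0 ∈ S := by
    refine ⟨fun _ => p, fun _ => 0, v0, ⟨fun t _ => hp, fun t _ => hasDerivWithinAt_const _ _ _,
      continuousOn_const⟩, rfl, ?_, ?_⟩
    · simp [enr, Nq]
    · simp [enr, Nq, hδ0]
  set s : ℝ := sSup S with hs
  have hsδ : δ0 ≤ s := le_csSup hSb hδS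
  have hspos : 0 < s := hδpos.trans_le hsδ
  have hexp : (3 / 4 : ℝ) ≤ Real.exp (- r ^ 2) := by
    have := Real.add_one_le_exp (- r ^ 2)
    nlinarith
  have hlt : s * Real.exp (- r ^ 2) < s := by
    have : Real.exp (- r ^ 2) < 1 := Real.exp_lt_one_iff.2 (by nlinarith)
    nlinarith
  obtain ⟨Φ0, ⟨γ, δ, v', hpa, h0, he, hΦ⟩, hΦs⟩ := exists_lt_of_lt_csSup ⟨_, hδS⟩ hlt
  have hΦδ : (3 / 4) * δ0 ≤ Φ0 := by
    nlinarith
  have hx : γ 1 ∈ K := hconf γ δ hpa h0 he.le 1 one_mem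
  have hxD := hKD hx
  have he0 := hH.enr_nonneg hpa
  set e0 : ℝ := enr G γ δ with he0def
  have hmsq : (1 - e0) ^ 2 ≤ 1 := by nlinarith
  have hmpos : 0 < 1 - e0 := by linarith
  have huv' : 0 < uq f G (γ 1) v' := by
    have : 0 < (1 - e0) ^ 2 * uq f G (γ 1) v' := by rw [← hΦ]; linarith
    exact (mul_pos_iff_of_pos_left (by positivity)).1 this
  have hv'0 : v' ≠ 0 := by
    rintro rfl
    simp [uq] at huv'
  have hN' := h.toKPre.N_pos hxD hv'0
  obtain ⟨v, hNv, huv⟩ : ∃ v, Nq G (γ 1) v = 1 ∧ uq f G (γ 1) v = uq f G (γ 1) v' := by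
    have hsq := Real.sqrt_pos.2 hN'
    refine ⟨(Real.sqrt (Nq G (γ 1) v'))⁻¹ • v', ?_, uq_smul f _ _ (inv_ne_zero hsq.ne')⟩
    rw [Nq_rsmul, inv_pow, Real.sq_sqrt hN'.le, inv_mul_cancel₀ hN'.ne']
  set u : ℝ := uq f G (γ 1) v with hu
  have hΦu : Φ0 = (1 - e0) ^ 2 * u := by rw [hΦ, huv]
  have hupos : 0 < u := by rw [huv]; exact huv'
  have hu2 : δ0 / 2 ≤ u := by nlinarith
  have huU : u ≤ U := hU _ hx v
  have hmm0 : m0 ≤ 1 - e0 := by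
    refine Real.sqrt_le_iff.2 ⟨hmpos.le, ?_⟩
    rw [div_le_iff₀ (by positivity)]
    have : (1 - e0) ^ 2 * u ≤ (1 - e0) ^ 2 * U := by gcongr
    nlinarith
  obtain ⟨X, X', hX0, hX1, hXp, hXe⟩ := H1 r hr hrr1 γ δ hpa (hconf γ δ hpa h0 he.le) he.le v hNv
  obtain ⟨a, ha1, ha2⟩ := H2 r hr hrr2 (γ 1) hx v hNv hu2
  have hfv : fderiv ℂ f (γ 1) v ≠ 0 := by
    intro h'
    rw [hu, uq, h'] at hupos
    simp at hupos
  have hlog0 : Real.log s ≤ 2 * Real.log (1 - e0) + luq f G (γ 1) v + r ^ 2 := by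
    have h1 : Real.log (s * Real.exp (- r ^ 2)) ≤ Real.log Φ0 :=
      Real.log_le_log (by positivity) hΦs.le
    rw [Real.log_mul hspos.ne' (Real.exp_pos _).ne', Real.log_exp, hΦu,
      Real.log_mul (by positivity) hupos.ne', Real.log_pow, hu, hH.log_uq hm hxD hfv] at h1
    push_cast at h1
    linarith
  have hr6 : 6 * r ≤ 1 - e0 := hrm.trans hmm0
  have hterm : ∀ ζ : ℂ, ζ = r ∨ ζ = -r ∨ ζ = r * Complex.I ∨ ζ = -r * Complex.I →
      luq f G (γ 1 + ζ • v) (v + ζ • a) - luq f G (γ 1) v ≤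
      r ^ 2 + 2 * ((enr G (fun t => γ t + ζ • X t) (fun t => δ t + ζ • X' t) - e0) / (1 - e0) +
        9 * r ^ 2 / (1 - e0) ^ 2) := by
    intro ζ hζ
    obtain ⟨hpζ, heζ⟩ := hXp ζ hζ
    obtain ⟨hD', hne⟩ := ha1 ζ hζ
    have h3 := log_term hmpos hr6 heζ
    set e := enr G (fun t => γ t + ζ • X t) (fun t => δ t + ζ • X' t) with hedef
    have h4 := abs_le.1 heζ
    have he1 : 0 < 1 - e := by linarith
    have hmem : (1 - e) ^ 2 * uq f G (γ 1 + ζ • v) (v + ζ • a) ∈ S := by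
      refine ⟨_, _, v + ζ • a, hpζ, ?_, by linarith, ?_⟩
      · simp [hX0, h0]
      · simp only [hX1]; rfl
    have h5 := le_csSup hSb hmem
    have hup := hH.uq_pos hm hD' hne
    have h6 := Real.log_le_log (by positivity) h5
    rw [Real.log_mul (by positivity) hup.ne', Real.log_pow, hH.log_uq hm hD' hne] at h6
    push_cast at h6
    linarith
  have t1 := hterm _ (Or.inl rfl)
  have t2 := hterm _ (Or.inr (Or.inl rfl))
  have t3 := hterm _ (Or.inr (Or.inr (Or.inl rfl)))
  have t4 := hterm _ (Or.inr (Or.inr (Or.inr rfl)))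
  set l1 := luq f G (γ 1 + (r:ℂ) • v) (v + (r:ℂ) • a)
  set l2 := luq f G (γ 1 + (-r:ℂ) • v) (v + (-r:ℂ) • a)
  set l3 := luq f G (γ 1 + (r * Complex.I) • v) (v + (r * Complex.I) • a)
  set l4 := luq f G (γ 1 + (-r * Complex.I) • v) (v + (-r * Complex.I) • a)
  set e1 := enr G (fun t => γ t + (r:ℂ) • X t) (fun t => δ t + (r:ℂ) • X' t)
  set e2 := enr G (fun t => γ t + (-r:ℂ) • X t) (fun t => δ t + (-r:ℂ) • X' t)
  set e3 := enr G (fun t => γ t + (r * Complex.I) • X t) (fun t => δ t + (r * Complex.I) • X' t)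
  set e4 := enr G (fun t => γ t + (-r * Complex.I) • X t) (fun t => δ t + (-r * Complex.I) • X' t)
  set m : ℝ := 1 - e0 with hmdef
  have hsum : (e1 - e0) / m + (e2 - e0) / m + ((e3 - e0) / m + (e4 - e0) / m) ≤
      r ^ 2 * (4 * c₂ + 5) / m := by
    rw [← add_div, ← add_div, ← add_div]
    gcongr
    linarith
  have hfin : r ^ 2 * (8 * u - 4 * c₂ - 2) ≤
      4 * r ^ 2 + 2 * (r ^ 2 * (4 * c₂ + 5) / m) + 72 * r ^ 2 / m ^ 2 := by
    have : 72 * r ^ 2 / m ^ 2 = 8 * (9 * r ^ 2 / m ^ 2) := by ring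
    linarith
  have hr2pos : 0 < r ^ 2 := by positivity
  have hfin2 : 8 * u - 4 * c₂ - 2 ≤ 4 + 2 * ((4 * c₂ + 5) / m) + 72 / m ^ 2 := by
    refine le_of_mul_le_mul_left ?_ hr2pos
    refine hfin.trans (le_of_eq ?_)
    ring
  have hfin3 : m ^ 2 * (8 * u - 4 * c₂ - 2) ≤ 4 * m ^ 2 + 2 * ((4 * c₂ + 5) * m) + 72 := by
    refine (mul_le_mul_of_nonneg_left hfin2 (sq_nonneg m)).trans (le_of_eq ?_)
    field_simp
  have hm1 : m ≤ 1 := by linarith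
  have hq1 : m ^ 2 * (4 * c₂ + 6) ≤ 1 * (4 * c₂ + 6) := by gcongr
  have hq2 : (4 * c₂ + 5) * m ≤ (4 * c₂ + 5) * 1 := by gcongr
  have : 8 * Φ0 ≤ 12 * c₂ + 88 := by
    have e : m ^ 2 * (8 * u - 4 * c₂ - 2) = 8 * (m ^ 2 * u) - m ^ 2 * (4 * c₂ + 6) + 4 * m ^ 2 := by
      ring
    rw [hΦu]
    linarith
  linarith

end yau

section finalpart
variable {n : ℕ} {D : Set (Fin n → ℂ)} {g : (Fin n → ℂ) → Matrix (Fin n) (Fin n) ℂ}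

theorem Nq_Gq (z v : Fin n → ℂ) : Nq (Gq g) z v = (hermForm g z v v).re := by
  rw [Nq, Gq_apply]

theorem riemDistK_eq (x y : Fin n → ℂ) : riemDistK D g x y = dK D (Gq g) x y := by
  unfold riemDistK dK
  congr 1
  ext L
  constructor
  · rintro ⟨γ, hγ, hm, h0, h1, rfl⟩
    refine ⟨γ, derivWithin γ (Icc 0 1), ⟨fun t ht => hm ht, fun t ht => ?_, ?_⟩, h0, h1, ?_⟩
    · exact (hγ.differentiableOn (by simp) t ht).hasDerivWithinAt
    · exact hγ.continuousOn_derivWithin (uniqueDiffOn_Icc zero_lt_one) le_rfl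
    · simp only [spd, Nq_Gq]
  · rintro ⟨γ, δ, hp, h0, h1, rfl⟩
    have hd : ∀ t ∈ Icc (0:ℝ) 1, derivWithin γ (Icc 0 1) t = δ t := fun t ht =>
      (hp.der t ht).derivWithin (uniqueDiffOn_Icc zero_lt_one t ht)
    refine ⟨γ, ?_, fun t ht => hp.mem t ht, h0, h1, ?_⟩
    · rw [contDiffOn_one_iff_derivWithin (uniqueDiffOn_Icc zero_lt_one)]
      exact ⟨fun t ht => (hp.der t ht).differentiableWithinAt, hp.cont.congr hd⟩
    · refine intervalIntegral.integral_congr fun t ht => ?_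
      rw [uIcc_of_le zero_le_one] at ht
      simp only [spd, Nq_Gq, hd t ht]

theorem kob_lower {c₁ c₂ : ℝ} (h : KData D (Gq g) (Gam g) c₁ c₂) (hc₁ : 0 < c₁)
    {p : Fin n → ℂ} (hp : p ∈ D) (v : Fin n → ℂ) :
    Real.sqrt ((hermForm g p v v).re) ≤ Real.sqrt (2 / c₁) * kobMetric D p v := by
  have hs : 0 < Real.sqrt (2 / c₁) := Real.sqrt_pos.2 (by positivity)
  rw [← div_le_iff₀' hs]
  unfold kobMetric
  refine le_csInf ?_ ?_
  · obtain ⟨ε, hε, hb⟩ := Metric.isOpen_iff.1 h.isOpen p hp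
    set α : ℝ := (‖v‖ + 1) / ε with hα
    have hα0 : 0 < α := by positivity
    have hd : ∀ z : ℂ, HasDerivAt (fun ζ : ℂ => p + ζ • (α⁻¹ • v)) (α⁻¹ • v) z := fun z => by
      simpa using ((hasDerivAt_id z).smul_const (α⁻¹ • v)).const_add p
    refine ⟨α, hα0, fun ζ => p + ζ • (α⁻¹ • v), fun z _ =>
      (hd z).differentiableAt.differentiableWithinAt, fun z hz => hb ?_, by simp, ?_⟩
    · rw [mem_ball_zero_iff] at hz
      rw [mem_ball_iff_norm, add_sub_cancel_left, norm_smul, norm_smul, norm_inv, Real.norm_eq_abs,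
        abs_of_pos hα0]
      have h1 : α⁻¹ * ‖v‖ < ε := by
        rw [inv_mul_lt_iff₀ hα0, hα, div_mul_cancel₀ _ hε.ne']
        linarith
      have h2 : 0 ≤ α⁻¹ * ‖v‖ := by positivity
      nlinarith [norm_nonneg z]
    · rw [fderiv_apply_one_eq_deriv]
      exact (hd 0).deriv
  · rintro α ⟨hα, f, hf, hm, h0, h1⟩
    rw [div_le_iff₀' hs]
    have h2 := h.ahlfors hc₁ hf hm
    rw [fderiv_apply_one_eq_deriv] at h1
    rw [h0, h1] at h2
    rw [Nq_rsmul, Nq_Gq] at h2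
    have h3 : (hermForm g p v v).re ≤ 2 / c₁ * α ^ 2 := by
      rw [inv_pow, inv_mul_le_iff₀ (by positivity)] at h2
      linarith
    calc _ ≤ Real.sqrt (2 / c₁ * α ^ 2) := Real.sqrt_le_sqrt h3
      _ = _ := by rw [Real.sqrt_mul (by positivity), Real.sqrt_sq hα.le]

theorem cara_upper {c₁ c₂ : ℝ} (h : KData D (Gq g) (Gam g) c₁ c₂) (hc₂ : 0 ≤ c₂)
    {p : Fin n → ℂ} (hp : p ∈ D) (hP : PreC D (Gq g) p 2) (v : Fin n → ℂ) :
    caraMetric D p v ≤ Real.sqrt (2 * c₂ + 15) * Real.sqrt ((hermForm g p v v).re) := by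
  unfold caraMetric
  refine Real.sSup_le ?_ (by positivity)
  rintro c ⟨f, hf, hm, h0, rfl⟩
  by_cases hv : fderiv ℂ f p v = 0
  · rw [hv, norm_zero]; positivity
  have h1 := h.yau hc₂ hf hm hp hP hv
  have hv0 : v ≠ 0 := by rintro rfl; simp at hv
  have hN := h.toKPre.N_pos hp hv0
  rw [uq, h0] at h1
  simp only [map_zero, sub_zero, one_pow, one_mul] at h1
  rw [div_le_iff₀ hN, Complex.normSq_eq_norm_sq, Nq_Gq] at h1
  rw [← Real.sqrt_mul (by positivity)]
  exact Real.le_sqrt_of_sq_le h1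

theorem main_aux (hconv : Convex ℝ D) (hopen : IsOpen D)
    (hLempert : ∀ p ∈ D, ∀ v : Fin n → ℂ, kobMetric D p v = caraMetric D p v)
    (hg : IsKahlerMetricOn D g) (hcomplete : IsCompleteMetricOn D g)
    (c₁ c₂ : ℝ) (hc₁ : 0 < c₁) (hc₁₂ : c₁ ≤ c₂)
    (hsec : ∀ z ∈ D, ∀ u v : Fin n → ℂ, LinearIndependent ℝ ![u, v] →
      -c₂ ≤ secCurvK g z u v ∧ secCurvK g z u v ≤ -c₁) :
    ∃ A : ℝ, 1 ≤ A ∧ ∀ p ∈ D, ∀ v : Fin n → ℂ,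
      A⁻¹ * Real.sqrt ((hermForm g p v v).re) ≤ kobMetric D p v ∧
        kobMetric D p v ≤ A * Real.sqrt ((hermForm g p v v).re) := by
  have h := kData_Gq hopen hg hc₁ hc₁₂ hsec
  have hcomp := hcomplete
  unfold IsCompleteMetricOn at hcomp
  simp only [riemDistK_eq] at hcomp
  have hk0 : ∀ p v, 0 ≤ kobMetric D p v := fun p v =>
    Real.sInf_nonneg fun α hα => hα.1.le
  refine ⟨max 1 (max (Real.sqrt (2 / (c₁ / 2))) (Real.sqrt (2 * c₂ + 15))), le_max_left _ _,
    fun p hp v => ⟨?_, ?_⟩⟩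
  · rw [inv_mul_le_iff₀ (lt_of_lt_of_le one_pos (le_max_left _ _))]
    refine (kob_lower h (by positivity) hp v).trans (mul_le_mul_of_nonneg_right ?_ (hk0 p v))
    exact (le_max_left _ _).trans (le_max_right _ _)
  · rw [hLempert p hp v]
    refine (cara_upper h (hc₁.le.trans hc₁₂) hp
      (h.toHPre.hopf_rinow hconv hcomp hp 2) v).trans
      (mul_le_mul_of_nonneg_right ?_ (Real.sqrt_nonneg _))
    exact (le_max_right _ _).trans (le_max_right _ _)

end finalpart

end ownwork

/-- let `D ⊆ ℂⁿ` be a bounded convex domain on which the Kobayashi and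
Carathéodory infinitesimal metrics coincide (Lempert's theorem), carrying a complete Kähler
metric `g` with all sectional curvatures between two negative constants `-c₂ ≤ sec ≤ -c₁ < 0`.
Then `K_D` and `v ↦ √(g(v,v))` are bi-Lipschitz. -/
theorem kobayashi_biLipschitz_kahlerEinstein
    (n : ℕ) (D : Set (Fin n → ℂ))
    (hconv : Convex ℝ D) (hopen : IsOpen D) (hne : D.Nonempty)
    (hbdd : Bornology.IsBounded D)
    (hLempert : ∀ p ∈ D, ∀ v : Fin n → ℂ, kobMetric D p v = caraMetric D p v)
    (g : (Fin n → ℂ) → Matrix (Fin n) (Fin n) ℂ)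
    (hg : IsKahlerMetricOn D g) (hcomplete : IsCompleteMetricOn D g)
    (c₁ c₂ : ℝ) (hc₁ : 0 < c₁) (hc₁₂ : c₁ ≤ c₂)
    (hsec : ∀ z ∈ D, ∀ u v : Fin n → ℂ, LinearIndependent ℝ ![u, v] →
      -c₂ ≤ secCurvK g z u v ∧ secCurvK g z u v ≤ -c₁) :
    ∃ A : ℝ, 1 ≤ A ∧ ∀ p ∈ D, ∀ v : Fin n → ℂ,
      A⁻¹ * Real.sqrt ((hermForm g p v v).re) ≤ kobMetric D p v ∧
        kobMetric D p v ≤ A * Real.sqrt ((hermForm g p v v).re) := by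
  exact main_aux hconv hopen hLempert hg hcomplete c₁ c₂ hc₁ hc₁₂ hsec
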